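/- arXiv:2201.08242 — 7 statements merged into one kernel-verified Lean document; each statement's English description precedes it below -/
import Mathlib

section
/- Let K be a finite field with q elements and let L be a field extension of K with q^4 elements. Assume q ≥ 3. Then the tensor rank of the Gabidulin code G = {x ↦ a·x + b·x^q : a, b ∈ L} equals 11; that is, 11 is the least natural number R for which there exist R rank-one K-linear maps f_1, …, f_R : L → L such that G is contained in the K-linear span of {f_1, …, f_R}. -/
/-- The `K`-linear map `x ↦ a·x + b·σ x + c·σ² x + d·σ³ x` with coefficients `((a, b), (c, d))`. -/
def linearized {K L : Type*} [Field K] [Field L] [Algebra K L] (σ : L →ₐ[K] L) :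
    ((L × L) × (L × L)) →ₗ[K] (L →ₗ[K] L) where
  toFun p := LinearMap.mulLeft K p.1.1 + LinearMap.mulLeft K p.1.2 ∘ₗ σ.toLinearMap +
    LinearMap.mulLeft K p.2.1 ∘ₗ (σ.comp σ).toLinearMap +
    LinearMap.mulLeft K p.2.2 ∘ₗ (σ.comp (σ.comp σ)).toLinearMap
  map_add' p r := by
    ext x
    simp
    ring
  map_smul' k p := by
    ext x
    simp

theorem linearized_apply {K L : Type*} [Field K] [Field L] [Algebra K L] (σ : L →ₐ[K] L)
    (a b c d x : L) :
    linearized σ ((a, b), (c, d)) x = a * x + b * σ x + c * σ (σ x) + d * σ (σ (σ x)) := rfl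

/-- The tuple of coefficients of the rank-one map `x ↦ u · Tr (v x)`. -/
def rankOneCoeff {K L : Type*} [Field K] [Field L] [Algebra K L] (σ : L →ₐ[K] L) (u v : L) :
    (L × L) × (L × L) :=
  ((u * v, u * σ v), (u * σ (σ v), u * σ (σ (σ v))))

theorem finrank_eq_four {K L : Type*} [Field K] [Field L] [Algebra K L] [Fintype K] [Fintype L]
    (hL : Fintype.card L = Fintype.card K ^ 4) : Module.finrank K L = 4 := by
  have h := Module.card_eq_pow_finrank (K := K) (V := L)
  rw [hL] at h
  exact (Nat.pow_right_injective Fintype.one_lt_card h).symm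

theorem linearized_injective {K L : Type*} [Field K] [Field L] [Algebra K L] [Fintype K]
    [Fintype L] (hL : Fintype.card L = Fintype.card K ^ 4) :
    Function.Injective (linearized (FiniteField.frobeniusAlgHom K L)) := by
  rw [injective_iff_map_eq_zero]
  rintro ⟨⟨a, b⟩, c, d⟩ h
  have hq : 1 < Fintype.card K := Fintype.one_lt_card
  set q := Fintype.card K with hqdef
  have h1 : 1 < q ^ 2 := Nat.one_lt_pow (by norm_num) hq
  have h2 : 1 < q ^ 3 := Nat.one_lt_pow (by norm_num) hq
  have h3 : q < q ^ 2 := by nlinarith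
  have h4 : q ^ 2 < q ^ 3 := Nat.pow_lt_pow_right hq (by norm_num)
  have h5 : q ^ 3 < q ^ 4 := Nat.pow_lt_pow_right hq (by norm_num)
  open Polynomial in
  have hp : (C a * X + C b * X ^ q + C c * X ^ (q ^ 2) + C d * X ^ (q ^ 3) : L[X]) = 0 := by
    refine Polynomial.eq_zero_of_natDegree_lt_card_of_eval_eq_zero _
      (f := fun x : L => x) Function.injective_id (fun x => ?_) ?_
    · have := LinearMap.congr_fun h x
      rw [linearized_apply] at this
      simpa [FiniteField.coe_frobeniusAlgHom, ← pow_mul, ← hqdef, pow_succ] using this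
    · rw [hL]
      refine lt_of_le_of_lt (b := q ^ 3) ?_ h5
      have e1 : 1 ≤ q ^ 3 := h2.le
      have e2 : q ≤ q ^ 3 := by omega
      compute_degree
      exact max_le e1 (max_le e2 (max_le h4.le le_rfl))
  have c1 := congrArg (Polynomial.coeff · 1) hp
  have c2 := congrArg (Polynomial.coeff · q) hp
  have c3 := congrArg (Polynomial.coeff · (q ^ 2)) hp
  have c4 := congrArg (Polynomial.coeff · (q ^ 3)) hp
  simp only [Polynomial.coeff_add, Polynomial.coeff_C_mul, Polynomial.coeff_X_pow,
    Polynomial.coeff_X, Polynomial.coeff_zero] at c1 c2 c3 c4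
  have n1 : 1 ≠ q := by omega
  have n2 : 1 ≠ q ^ 2 := by omega
  have n3 : 1 ≠ q ^ 3 := by omega
  have n4 : q ≠ q ^ 2 := by omega
  have n5 : q ≠ q ^ 3 := by omega
  have n6 : q ^ 2 ≠ q ^ 3 := by omega
  simp only [n1, n2, n3, n4, n5, n6, n4.symm, n5.symm, n6.symm,
    if_true, if_false, mul_one, mul_zero, add_zero, zero_add] at c1 c2 c3 c4
  simp [c1, c2, c3, c4]

theorem algebraMap_trace_eq_frobenius {K L : Type*} [Field K] [Field L] [Algebra K L] [Fintype K]
    [Fintype L] (hL : Fintype.card L = Fintype.card K ^ 4) (σ : L →ₐ[K] L)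
    (hσ : σ = FiniteField.frobeniusAlgHom K L) (x : L) :
    algebraMap K L (Algebra.trace K L x) = x + σ x + σ (σ x) + σ (σ (σ x)) := by
  rw [FiniteField.algebraMap_trace_eq_sum_pow, finrank_eq_four hL, hσ]
  simp [Finset.sum_range_succ, ← pow_mul, pow_succ]

theorem frobenius_iterate_four {K L : Type*} [Field K] [Field L] [Algebra K L] [Fintype K]
    [Fintype L] (hL : Fintype.card L = Fintype.card K ^ 4) (σ : L →ₐ[K] L)
    (hσ : σ = FiniteField.frobeniusAlgHom K L) (x : L) : σ (σ (σ (σ x))) = x := by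
  have := FiniteField.pow_card x
  rw [hL] at this
  rw [hσ]
  simpa [FiniteField.coe_frobeniusAlgHom, ← pow_mul, pow_succ] using this

theorem exists_algebraMap_eq_of_frobenius_eq {K L : Type*} [Field K] [Field L] [Algebra K L]
    [Fintype K] [Fintype L] (σ : L →ₐ[K] L)
    (hσ : σ = FiniteField.frobeniusAlgHom K L) (x : L) (hx : σ x = x) :
    ∃ k, algebraMap K L k = x := by
  refine (IsGalois.mem_range_algebraMap_iff_fixed (F := K) x).2 fun τ => ?_
  obtain ⟨n, hn⟩ := (FiniteField.bijective_frobeniusAlgEquivOfAlgebraic_pow K L).2 τ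
  rw [← hn]
  simp only [AlgEquiv.coe_pow]
  apply Function.iterate_fixed
  rw [hσ] at hx
  exact hx

theorem exists_trace_mul_eq {K L : Type*} [Field K] [Field L] [Algebra K L] [Fintype K]
    [Fintype L] (φ : L →ₗ[K] K) : ∃ v, ∀ x, φ x = Algebra.trace K L (v * x) := by
  have hn := traceForm_nondegenerate K L
  refine ⟨((Algebra.traceForm K L).toDual hn).symm φ, fun x => ?_⟩
  have := LinearMap.BilinForm.apply_toDual_symm_apply (hB := hn) φ x
  rw [← this, Algebra.traceForm_apply]

theorem exists_trace_eq_one (K L : Type*) [Field K] [Field L] [Algebra K L] [Fintype K]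
    [Fintype L] : ∃ z : L, Algebra.trace K L z = 1 :=
  Algebra.trace_surjective K L 1

theorem exists_eq_mul_trace_of_finrank_range {K L : Type*} [Field K] [Field L] [Algebra K L]
    [Fintype K] [Fintype L] (f : L →ₗ[K] L)
    (hf : Module.finrank K (LinearMap.range f) = 1) :
    ∃ u v : L, u ≠ 0 ∧ v ≠ 0 ∧ ∀ x, f x = u * algebraMap K L (Algebra.trace K L (v * x)) := by
  obtain ⟨⟨u, hu⟩, hu0, hspan⟩ := finrank_eq_one_iff'.1 hf
  have hu1 : u ≠ 0 := fun h => hu0 (Subtype.ext h)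
  obtain ⟨z, hz⟩ := exists_trace_eq_one K L
  obtain ⟨v, hv⟩ := exists_trace_mul_eq
    ((Algebra.trace K L ∘ₗ LinearMap.mulLeft K (z * u⁻¹)) ∘ₗ f)
  have key : ∀ x, f x = u * algebraMap K L (Algebra.trace K L (v * x)) := by
    intro x
    obtain ⟨c, hc⟩ := hspan ⟨f x, x, rfl⟩
    have hc : c • u = f x := congrArg Subtype.val hc
    have e : z * u⁻¹ * (c • u) = c • z := by
      rw [Algebra.smul_def, Algebra.smul_def]
      field_simp
    rw [← hv x]
    rw [LinearMap.comp_apply, LinearMap.comp_apply, LinearMap.mulLeft_apply, ← hc, e, map_smul,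
      hz, Algebra.smul_def, smul_eq_mul, mul_one, mul_comm]
  refine ⟨u, v, hu1, ?_, key⟩
  rintro rfl
  obtain ⟨x, hx⟩ := hu
  exact hu1 (by rw [← hx, key x]; simp)

theorem finrank_range_mul_trace {K L : Type*} [Field K] [Field L] [Algebra K L]
    [Fintype K] [Fintype L] (f : L →ₗ[K] L) (u v : L) (hu : u ≠ 0) (hv : v ≠ 0)
    (hf : ∀ x, f x = u * algebraMap K L (Algebra.trace K L (v * x))) :
    Module.finrank K (LinearMap.range f) = 1 := by
  obtain ⟨z, hz⟩ := exists_trace_eq_one K L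
  have : LinearMap.range f = K ∙ u := by
    ext y
    rw [Submodule.mem_span_singleton]
    constructor
    · rintro ⟨x, rfl⟩
      exact ⟨Algebra.trace K L (v * x), by rw [hf, Algebra.smul_def, mul_comm]⟩
    · rintro ⟨c, rfl⟩
      refine ⟨c • (v⁻¹ * z), ?_⟩
      rw [map_smul, hf, mul_inv_cancel_left₀ hv, hz]
      simp
  rw [this, finrank_span_singleton hu]

theorem linearized_rankOneCoeff {K L : Type*} [Field K] [Field L] [Algebra K L] [Fintype K]
    [Fintype L] (hL : Fintype.card L = Fintype.card K ^ 4) (σ : L →ₐ[K] L)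
    (hσ : σ = FiniteField.frobeniusAlgHom K L) (u v x : L) :
    linearized σ (rankOneCoeff σ u v) x = u * algebraMap K L (Algebra.trace K L (v * x)) := by
  rw [algebraMap_trace_eq_frobenius hL σ hσ, rankOneCoeff, linearized_apply]
  simp only [map_mul]
  ring

theorem exists_coeff_mul_five_linear_forms {R : Type*} [CommRing R]
    (x0 x1 x2 x3 x4 y0 y1 y2 y3 y4 : R) :
    ∃ c : Fin 6 → R, ∀ s t : R,
      (s * x0 + t * y0) * (s * x1 + t * y1) * (s * x2 + t * y2) * (s * x3 + t * y3) *
        (s * x4 + t * y4) = ∑ j : Fin 6, s ^ (5 - j.val) * t ^ j.val * c j := by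
  refine ⟨![x0 * x1 * x2 * x3 * x4,
    y0 * x1 * x2 * x3 * x4 + x0 * y1 * x2 * x3 * x4 + x0 * x1 * y2 * x3 * x4 +
      x0 * x1 * x2 * y3 * x4 + x0 * x1 * x2 * x3 * y4,
    y0 * y1 * x2 * x3 * x4 + y0 * x1 * y2 * x3 * x4 + y0 * x1 * x2 * y3 * x4 +
      y0 * x1 * x2 * x3 * y4 + x0 * y1 * y2 * x3 * x4 + x0 * y1 * x2 * y3 * x4 +
      x0 * y1 * x2 * x3 * y4 + x0 * x1 * y2 * y3 * x4 + x0 * x1 * y2 * x3 * y4 +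
      x0 * x1 * x2 * y3 * y4,
    y0 * y1 * y2 * x3 * x4 + y0 * y1 * x2 * y3 * x4 + y0 * y1 * x2 * x3 * y4 +
      y0 * x1 * y2 * y3 * x4 + y0 * x1 * y2 * x3 * y4 + y0 * x1 * x2 * y3 * y4 +
      x0 * y1 * y2 * y3 * x4 + x0 * y1 * y2 * x3 * y4 + x0 * y1 * x2 * y3 * y4 +
      x0 * x1 * y2 * y3 * y4,
    y0 * y1 * y2 * y3 * x4 + y0 * y1 * y2 * x3 * y4 + y0 * y1 * x2 * y3 * y4 +
      y0 * x1 * y2 * y3 * y4 + x0 * y1 * y2 * y3 * y4,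
    y0 * y1 * y2 * y3 * y4], fun s t => ?_⟩
  simp [Fin.sum_univ_succ]
  ring

theorem exists_span_pair_of_finrank_le_two {K V : Type*} [Field K] [AddCommGroup V] [Module K V]
    [FiniteDimensional K V] (W : Submodule K V) (h : Module.finrank K W ≤ 2) :
    ∃ p r : V, ∀ w ∈ W, ∃ s t : K, w = s • p + t • r := by
  have b := Module.finBasis K W
  generalize hn : Module.finrank K W = n at b h
  have hs := b.sum_repr
  interval_cases n
  · refine ⟨0, 0, fun w hw => ⟨0, 0, ?_⟩⟩
    have := congrArg Subtype.val (hs ⟨w, hw⟩)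
    simpa using this.symm
  · refine ⟨b 0, 0, fun w hw => ⟨b.repr ⟨w, hw⟩ 0, 0, ?_⟩⟩
    have := congrArg Subtype.val (hs ⟨w, hw⟩)
    simpa using this.symm
  · refine ⟨b 0, b 1, fun w hw => ⟨b.repr ⟨w, hw⟩ 0, b.repr ⟨w, hw⟩ 1, ?_⟩⟩
    have := hs ⟨w, hw⟩
    rw [Fin.sum_univ_two] at this
    exact (congrArg Subtype.val this).symm

/-- The tensors of rank one whose last two coefficients are `K`-combinations of two fixed pairs
are parametrised, up to scaling, by binary quintic forms. -/
theorem exists_span_six {K L : Type*} [Field K] [Field L] [Algebra K L] (σ : L →ₐ[K] L)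
    (hfix : ∀ x, σ x = x → ∃ k, algebraMap K L k = x) (h4 : ∀ x, σ (σ (σ (σ x))) = x)
    (p r : L × L) :
    ∃ C : Fin 6 → (L × L) × (L × L), ∀ u v : L, u ≠ 0 → v ≠ 0 → ∀ s t : K,
      (rankOneCoeff σ u v).2 = s • p + t • r →
      rankOneCoeff σ u v ∈ Submodule.span K (Set.range C) := by
  obtain ⟨a, b⟩ := p
  obtain ⟨c, d⟩ := r
  obtain ⟨C1, h1⟩ := exists_coeff_mul_five_linear_forms b (σ b) a (σ (σ a)) (σ (σ (σ a)))
    d (σ d) c (σ (σ c)) (σ (σ (σ c)))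
  obtain ⟨C2, h2⟩ := exists_coeff_mul_five_linear_forms b (σ b) (σ (σ b)) a (σ (σ (σ a)))
    d (σ d) (σ (σ d)) c (σ (σ (σ c)))
  obtain ⟨C3, h3⟩ := exists_coeff_mul_five_linear_forms a a (σ a) (σ (σ a)) (σ (σ (σ a)))
    c c (σ c) (σ (σ c)) (σ (σ (σ c)))
  obtain ⟨C4, h5⟩ := exists_coeff_mul_five_linear_forms b a (σ a) (σ (σ a)) (σ (σ (σ a)))
    d c (σ c) (σ (σ c)) (σ (σ (σ c)))
  refine ⟨fun j => ((C1 j, C2 j), (C3 j, C4 j)), fun u v hu hv s t h => ?_⟩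
  have hα : u * σ (σ v) = algebraMap K L s * a + algebraMap K L t * c := by
    simpa [rankOneCoeff, Algebra.smul_def] using congrArg Prod.fst h
  have hβ : u * σ (σ (σ v)) = algebraMap K L s * b + algebraMap K L t * d := by
    simpa [rankOneCoeff, Algebra.smul_def] using congrArg Prod.snd h
  have hα1 := congrArg σ hα
  have hα2 := congrArg σ hα1
  have hα3 := congrArg σ hα2
  have hβ1 := congrArg σ hβ
  have hβ2 := congrArg σ hβ1
  simp only [map_mul, map_add, h4, AlgHom.commutes] at hα1 hα2 hα3 hβ1 hβ2
  have g1 := h1 (algebraMap K L s) (algebraMap K L t)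
  have g2 := h2 (algebraMap K L s) (algebraMap K L t)
  have g3 := h3 (algebraMap K L s) (algebraMap K L t)
  have g4 := h5 (algebraMap K L s) (algebraMap K L t)
  rw [← hα, ← hα2, ← hα3, ← hβ, ← hβ1] at g1
  rw [← hα, ← hα3, ← hβ, ← hβ1, ← hβ2] at g2
  rw [← hα, ← hα1, ← hα2, ← hα3] at g3
  rw [← hα, ← hα1, ← hα2, ← hα3, ← hβ] at g4
  obtain ⟨k, hk⟩ := hfix ((u * σ u * σ (σ u) * σ (σ (σ u))) * (v * σ v * σ (σ v) * σ (σ (σ v))))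
    (by simp only [map_mul, h4]; ring)
  have inj : ∀ x, x ≠ 0 → σ x ≠ 0 := fun x hx => by simpa using hx
  have hk0 : k ≠ 0 := by
    rintro rfl
    rw [map_zero] at hk
    have := inj u hu
    have := inj _ this
    have := inj _ this
    have := inj v hv
    have := inj _ this
    have := inj _ this
    exact absurd hk.symm (by positivity)
  have hs : k • rankOneCoeff σ u v = ∑ j : Fin 6, (s ^ (5 - j.val) * t ^ j.val) •
      (((C1 j, C2 j), (C3 j, C4 j)) : (L × L) × (L × L)) := by
    refine Prod.ext (Prod.ext ?_ ?_) (Prod.ext ?_ ?_) <;>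
    simp only [rankOneCoeff, Prod.smul_fst, Prod.smul_snd, Prod.fst_sum, Prod.snd_sum] <;>
    simp only [Algebra.smul_def, map_mul, map_pow, ← g1, ← g2, ← g3, ← g4, hk] <;> ring
  rw [← Submodule.smul_mem_iff _ hk0, hs]
  exact Submodule.sum_mem _ fun j _ =>
    Submodule.smul_mem _ _ (Submodule.subset_span ⟨j, rfl⟩)

theorem eleven_le_of_gabidulin_le_span {K L : Type*} [Field K] [Field L] [Algebra K L]
    [Fintype K] [Fintype L] (hL : Fintype.card L = Fintype.card K ^ 4) (R : ℕ)
    (f : Fin R → (L →ₗ[K] L)) (hf : ∀ i, Module.finrank K (LinearMap.range (f i)) = 1)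
    (hG : ∀ a b : L, linearized (FiniteField.frobeniusAlgHom K L) ((a, b), (0, 0)) ∈
      Submodule.span K (Set.range f)) : 11 ≤ R := by
  by_contra! hR
  set σ := FiniteField.frobeniusAlgHom K L with hσ
  have h4 := frobenius_iterate_four hL σ hσ
  have hfix := exists_algebraMap_eq_of_frobenius_eq σ hσ
  have hdim := finrank_eq_four hL
  choose u v hu hv hfuv using fun i => exists_eq_mul_trace_of_finrank_range (f i) (hf i)
  set m : Fin R → (L × L) × (L × L) := fun i => rankOneCoeff σ (u i) (v i) with hm
  have hfm : f = linearized σ ∘ m := by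
    funext i
    ext x
    rw [hfuv, Function.comp_apply, linearized_rankOneCoeff hL σ hσ]
  set S := Submodule.span K (Set.range m) with hS
  have hGS : ∀ x : L × L, LinearMap.inl K (L × L) (L × L) x ∈ S := by
    rintro ⟨a, b⟩
    have := hG a b
    rw [hfm, Set.range_comp, Submodule.span_image] at this
    obtain ⟨y, hy, hy2⟩ := this
    rw [← linearized_injective hL hy2.symm] at hy
    exact hy
  have hL2 : Module.finrank K (L × L) = 8 := by
    rw [Module.finrank_prod, hdim]
  have hSR : Module.finrank K S ≤ R := by
    exact (finrank_range_le_card (R := K) m).trans (by simp)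
  let π : S →ₗ[K] L × L := LinearMap.snd K (L × L) (L × L) ∘ₗ S.subtype
  have hker : 8 ≤ Module.finrank K (LinearMap.ker π) := by
    let g : L × L →ₗ[K] LinearMap.ker π :=
      ((LinearMap.inl K (L × L) (L × L)).codRestrict S hGS).codRestrict _ (fun x => by
        simp [π])
    rw [← hL2]
    refine LinearMap.finrank_le_finrank_of_injective (f := g) fun x y h => ?_
    have h' := congrArg (fun z : LinearMap.ker π => ((z : S) : (L × L) × (L × L)).1) h
    exact h'
  have hrn := LinearMap.finrank_range_add_finrank_ker π
  obtain ⟨p, r, hpr⟩ := exists_span_pair_of_finrank_le_two (LinearMap.range π) (by omega)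
  obtain ⟨C, hC⟩ := exists_span_six σ hfix h4 p r
  have hle : S ≤ Submodule.span K (Set.range C) := by
    rw [hS, Submodule.span_le]
    rintro _ ⟨i, rfl⟩
    obtain ⟨s, t, hst⟩ := hpr (m i).2 ⟨⟨m i, Submodule.subset_span ⟨i, rfl⟩⟩, rfl⟩
    exact hC _ _ (hu i) (hv i) s t hst
  have h6 : Module.finrank K (Submodule.span K (Set.range C)) ≤ 6 := by
    exact (finrank_range_le_card (R := K) C).trans (by simp)
  have h7 := Submodule.finrank_mono hle
  omega

/-- If the tensors `(σ α)⁻¹ ⊗ σ² α · σ³ α` with `α` in `A` are annihilated only by trivial pairs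
`(a, b)`, then they span a space containing the Gabidulin code. -/
theorem exists_rankOne_span_of_trace_condition {K L : Type*} [Field K] [Field L] [Algebra K L]
    [Fintype K] [Fintype L] (hL : Fintype.card L = Fintype.card K ^ 4) (A : Submodule K L)
    (hA : Module.finrank K A ≤ 3) (σ : L →ₐ[K] L) (hσ : σ = FiniteField.frobeniusAlgHom K L)
    (hcore : ∀ a b e : L, (∀ α ∈ A, α ≠ 0 → Algebra.trace K L
      (a * (σ (σ α) * σ (σ (σ α)) / σ α) + b * (α * σ (σ (σ α)) / σ α) + e * α) = 0) →
      a = 0 ∧ b = 0) :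
    ∃ f : Fin 11 → (L →ₗ[K] L), (∀ i, Module.finrank K (LinearMap.range (f i)) = 1) ∧
      ∀ a b : L, linearized σ ((a, b), (0, 0)) ∈ Submodule.span K (Set.range f) := by
  have h4 := frobenius_iterate_four hL σ hσ
  let n : {α : A // α ≠ 0} → (L × L) × A := fun α =>
    ((σ (σ α) * σ (σ (σ α)) / σ α, α * σ (σ (σ α)) / σ α), α)
  have hspan : Submodule.span K (Set.range n) = ⊤ := by
    by_contra hne
    obtain ⟨φ, hφ, hle⟩ := Submodule.exists_le_ker_of_lt_top _ (lt_top_iff_ne_top.2 hne)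
    obtain ⟨a, ha⟩ := exists_trace_mul_eq
      (φ ∘ₗ LinearMap.inl K (L × L) A ∘ₗ LinearMap.inl K L L)
    obtain ⟨b, hb⟩ := exists_trace_mul_eq
      (φ ∘ₗ LinearMap.inl K (L × L) A ∘ₗ LinearMap.inr K L L)
    obtain ⟨χ, hχ⟩ := LinearMap.exists_extend (φ ∘ₗ LinearMap.inr K (L × L) A)
    obtain ⟨e, he⟩ := exists_trace_mul_eq χ
    have hφe : ∀ x y α, φ ((x, y), α) = Algebra.trace K L (a * x + b * y + e * α) := by
      intro x y α
      have h1 : φ ((0, 0), α) = χ α := (LinearMap.congr_fun hχ α).symm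
      rw [map_add, map_add, ← ha, ← hb, ← he, ← h1]
      simp only [LinearMap.comp_apply, LinearMap.inl_apply, LinearMap.inr_apply, ← map_add]
      simp
    have h0 : ∀ α ∈ A, α ≠ 0 → Algebra.trace K L
        (a * (σ (σ α) * σ (σ (σ α)) / σ α) + b * (α * σ (σ (σ α)) / σ α) + e * α) = 0 := by
      intro α hα hα0
      have := hle (Submodule.subset_span ⟨⟨⟨α, hα⟩, fun h => hα0 (congrArg Subtype.val h)⟩, rfl⟩)
      rwa [LinearMap.mem_ker, hφe] at this
    obtain ⟨rfl, rfl⟩ := hcore a b e h0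
    refine hφ (LinearMap.ext ?_)
    rintro ⟨⟨x, y⟩, α, hα⟩
    rw [hφe]
    by_cases hα0 : α = 0
    · simp [hα0]
    · simpa using h0 α hα hα0
  have hfin : Module.finrank K ((L × L) × A) ≤ 11 := by
    rw [Module.finrank_prod, Module.finrank_prod, finrank_eq_four hL]
    omega
  have hpos : 0 < Module.finrank K ((L × L) × A) := Module.finrank_pos
  have hex := Submodule.exists_fun_fin_finrank_span_eq K (Set.range n)
  rw [hspan, finrank_top] at hex
  obtain ⟨g, hg, hgs, -⟩ := hex
  choose r hr using hg
  have hne : Nonempty (Fin (Module.finrank K ((L × L) × A))) := ⟨⟨0, hpos⟩⟩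
  obtain ⟨s, hs⟩ : ∃ s : Fin 11 → Fin (Module.finrank K ((L × L) × A)), Function.Surjective s :=
    ⟨_, Function.invFun_surjective (Fin.castLE_injective hfin)⟩
  let ψ : (L × L) × A →ₗ[K] (L × L) × (L × L) := LinearMap.prodMap LinearMap.id
    (A.subtype.prod (σ.toLinearMap ∘ₗ σ.toLinearMap ∘ₗ A.subtype))
  have hψ : ∀ α : {α : A // α ≠ 0}, ((α : A) : L) ≠ 0 ∧ ψ (n α) =
      rankOneCoeff σ (σ (α : A))⁻¹ (σ (σ (α : A)) * σ (σ (σ (α : A)))) := by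
    rintro ⟨⟨α, hα⟩, h⟩
    have hα0 : α ≠ 0 := fun h' => h (Subtype.ext h')
    have h1 : σ α ≠ 0 := by simpa using hα0
    refine ⟨hα0, ?_⟩
    simp only [ψ, n, rankOneCoeff, LinearMap.prodMap_apply, LinearMap.id_apply,
      LinearMap.prod_apply, Function.prod_apply, Submodule.subtype_apply, LinearMap.comp_apply,
      AlgHom.toLinearMap_apply, map_mul, h4]
    refine Prod.ext (Prod.ext ?_ ?_) (Prod.ext ?_ ?_) <;> dsimp only <;> field_simp
  refine ⟨fun i => linearized σ (ψ (g (s i))), fun i => ?_, fun a b => ?_⟩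
  · have h := hψ (r (s i))
    rw [hr] at h
    obtain ⟨h0, h1⟩ := h
    have h2 : σ ((r (s i) : A) : L) ≠ 0 := by simpa using h0
    refine finrank_range_mul_trace _ (σ (r (s i) : A))⁻¹
      (σ (σ (r (s i) : A)) * σ (σ (σ (r (s i) : A)))) (inv_ne_zero h2) ?_ fun x => ?_
    · simpa using h0
    · dsimp only
      rw [h1, linearized_rankOneCoeff hL σ hσ]
  · have hrange : Set.range (fun i => linearized σ (ψ (g (s i)))) =
        (linearized σ ∘ₗ ψ) '' Set.range g := by
      rw [← Set.range_comp, ← hs.range_comp]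
      rfl
    rw [hrange, Submodule.span_image, hgs]
    exact ⟨((a, b), 0), trivial, by simp [ψ]⟩

/-- The polynomial part of the trace condition at `β`, obtained by division by `σ β`. -/
noncomputable def tracePolar {K L : Type*} [Field K] [Field L] [Algebra K L] (σ : L →ₐ[K] L) (a b e : L) :
    L →ₗ[K] K :=
  Algebra.trace K L ∘ₗ linearized σ ((b + e, -(a + b)), (a, a + b))

theorem tracePolar_add_trace_eq_zero {K L : Type*} [Field K] [Field L] [Algebra K L]
    (σ : L →ₐ[K] L) (A : Submodule K L) (h1A : 1 ∈ A) (a b e : L)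
    (h : ∀ α ∈ A, α ≠ 0 → Algebra.trace K L
      (a * (σ (σ α) * σ (σ (σ α)) / σ α) + b * (α * σ (σ (σ α)) / σ α) + e * α) = 0)
    (β : L) (hβA : β ∈ A) (hβ : σ β ≠ β) (s : K) :
    tracePolar σ a b e β + Algebra.trace K L ((σ (σ (σ β)) - σ β) *
      (a * (σ (σ β) - σ β) + b * (β - σ β)) / (σ β + algebraMap K L s)) = 0 := by
  have hne : ∀ t : K, β + algebraMap K L t ≠ 0 := by
    intro t ht
    rw [eq_neg_of_add_eq_zero_left ht] at hβ
    simp at hβ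
  have hne1 : σ β + algebraMap K L s ≠ 0 := by
    intro h0
    apply hne s
    apply σ.toRingHom.injective
    simpa using h0
  have h1 := h 1 h1A one_ne_zero
  simp only [map_one, mul_one, div_one] at h1
  have h2 := h (β + algebraMap K L s)
    (A.add_mem hβA (by rw [Algebra.algebraMap_eq_smul_one]; exact A.smul_mem s h1A)) (hne s)
  simp only [map_add, AlgHom.commutes] at h2
  have h3 : s * Algebra.trace K L (a + b + e) = 0 := by rw [h1, mul_zero]
  rw [← smul_eq_mul, ← map_smul, Algebra.smul_def] at h3
  rw [tracePolar, LinearMap.comp_apply, ← map_add]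
  rw [← map_add, ← map_add] at h2
  rw [← h2, ← sub_eq_zero, ← neg_eq_zero, ← map_sub, ← map_neg, ← h3, linearized_apply]
  congr 1
  field_simp
  ring

theorem tracePolar_mul_prod_add_eq_zero {K L : Type*} [Field K] [Field L] [Algebra K L]
    [Fintype K] [Fintype L] (hL : Fintype.card L = Fintype.card K ^ 4)
    (σ : L →ₐ[K] L) (hσ : σ = FiniteField.frobeniusAlgHom K L) (A : Submodule K L) (h1A : 1 ∈ A)
    (a b e : L) (h : ∀ α ∈ A, α ≠ 0 → Algebra.trace K L
      (a * (σ (σ α) * σ (σ (σ α)) / σ α) + b * (α * σ (σ (σ α)) / σ α) + e * α) = 0)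
    (β : L) (hβA : β ∈ A) (hβ : σ β ≠ β) (r : L)
    (hr : r = (σ (σ (σ β)) - σ β) * (a * (σ (σ β) - σ β) + b * (β - σ β))) (s : K) :
    algebraMap K L (tracePolar σ a b e β) * ((algebraMap K L s + β) * (algebraMap K L s + σ β) *
        (algebraMap K L s + σ (σ β)) * (algebraMap K L s + σ (σ (σ β)))) +
      r * ((algebraMap K L s + β) * (algebraMap K L s + σ (σ β)) *
        (algebraMap K L s + σ (σ (σ β)))) +
      σ r * ((algebraMap K L s + β) * (algebraMap K L s + σ β) *
        (algebraMap K L s + σ (σ (σ β)))) +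
      σ (σ r) * ((algebraMap K L s + β) * (algebraMap K L s + σ β) *
        (algebraMap K L s + σ (σ β))) +
      σ (σ (σ r)) * ((algebraMap K L s + σ β) * (algebraMap K L s + σ (σ β)) *
        (algebraMap K L s + σ (σ (σ β)))) = 0 := by
  have h4 := frobenius_iterate_four hL σ hσ
  have n0 : algebraMap K L s + β ≠ 0 := by
    intro ht
    rw [eq_neg_of_add_eq_zero_right ht] at hβ
    simp at hβ
  have step : ∀ y, algebraMap K L s + y ≠ 0 → algebraMap K L s + σ y ≠ 0 := by
    intro y hy h0
    apply hy
    apply σ.toRingHom.injective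
    simpa using h0
  have n1 := step _ n0
  have n2 := step _ n1
  have n3 := step _ n2
  have h0 := congrArg (algebraMap K L) (tracePolar_add_trace_eq_zero σ A h1A a b e h β hβA hβ s)
  rw [map_add, algebraMap_trace_eq_frobenius hL σ hσ, ← hr] at h0
  simp only [map_div₀, map_add, AlgHom.commutes, h4, map_zero] at h0
  rw [add_comm (σ β), add_comm (σ (σ β)), add_comm (σ (σ (σ β))), add_comm β] at h0
  field_simp at h0
  linear_combination h0

theorem exists_frobenius_frobenius_ne {K L : Type*} [Field K] [Field L] [Algebra K L]
    [Fintype K] [Fintype L] (hL : Fintype.card L = Fintype.card K ^ 4)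
    (σ : L →ₐ[K] L) (hσ : σ = FiniteField.frobeniusAlgHom K L) : ∃ β, σ (σ β) ≠ β := by
  by_contra! hcon
  have := linearized_injective hL (a₁ := ((1, 0), (0, 0))) (a₂ := ((0, 0), (1, 0))) (by
    ext x
    rw [linearized_apply, linearized_apply, ← hσ, hcon]
    simp)
  simp at this

theorem mul_conj_sub_eq_zero {K L : Type*} [Field K] [Field L] [Algebra K L]
    [Fintype K] [Fintype L] (hK : 5 ≤ Fintype.card K) (hL : Fintype.card L = Fintype.card K ^ 4)
    (σ : L →ₐ[K] L) (hσ : σ = FiniteField.frobeniusAlgHom K L) (A : Submodule K L) (h1A : 1 ∈ A)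
    (a b e : L) (h : ∀ α ∈ A, α ≠ 0 → Algebra.trace K L
      (a * (σ (σ α) * σ (σ (σ α)) / σ α) + b * (α * σ (σ (σ α)) / σ α) + e * α) = 0)
    (β : L) (hβA : β ∈ A) (hβ : σ (σ β) ≠ β) :
    a * (σ (σ β) - σ β) + b * (β - σ β) = 0 := by
  have h4 := frobenius_iterate_four hL σ hσ
  have hβ1 : σ β ≠ β := fun h => hβ (by rw [h, h])
  have hp := tracePolar_mul_prod_add_eq_zero hL σ hσ A h1A a b e h β hβA hβ1 _ rfl
  generalize hr : (σ (σ (σ β)) - σ β) * (a * (σ (σ β) - σ β) + b * (β - σ β)) = r at hp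
  generalize algebraMap K L (tracePolar σ a b e β) = κ at hp
  open Polynomial in
  have hzero : (C κ * ((X + C β) * (X + C (σ β)) * (X + C (σ (σ β))) * (X + C (σ (σ (σ β))))) +
      C r * ((X + C β) * (X + C (σ (σ β))) * (X + C (σ (σ (σ β))))) +
      C (σ r) * ((X + C β) * (X + C (σ β)) * (X + C (σ (σ (σ β))))) +
      C (σ (σ r)) * ((X + C β) * (X + C (σ β)) * (X + C (σ (σ β)))) +
      C (σ (σ (σ r))) * ((X + C (σ β)) * (X + C (σ (σ β))) * (X + C (σ (σ (σ β)))))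
      : L[X]) = 0 := by
    refine Polynomial.eq_zero_of_natDegree_lt_card_of_eval_eq_zero _
      (f := algebraMap K L) (algebraMap K L).injective (fun s => ?_) ?_
    · simpa using hp s
    · refine lt_of_le_of_lt (b := 4) ?_ hK
      compute_degree
  have hev := congrArg (Polynomial.eval (-σ β)) hzero
  simp only [Polynomial.eval_add, Polynomial.eval_mul, Polynomial.eval_C, Polynomial.eval_X,
    neg_add_cancel, mul_zero, zero_mul, zero_add, add_zero, Polynomial.eval_zero] at hev
  have inj : Function.Injective σ := σ.toRingHom.injective
  have d0 : -σ β + β ≠ 0 := fun h => hβ1 (by linear_combination -h)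
  have d2 : -σ β + σ (σ β) ≠ 0 := fun h => hβ1 (inj (by linear_combination h))
  have d3 : -σ β + σ (σ (σ β)) ≠ 0 := fun h => hβ (inj (by linear_combination h))
  have d3' : σ (σ (σ β)) - σ β ≠ 0 := by rwa [sub_eq_neg_add]
  have hr0 : r = 0 := by simpa [d0, d2, d3] using hev
  rw [hr0] at hr
  simpa [d3'] using hr

theorem exists_submodule_trace_condition_of_five_le {K L : Type*} [Field K] [Field L]
    [Algebra K L] [Fintype K] [Fintype L] (hK : 5 ≤ Fintype.card K)
    (hL : Fintype.card L = Fintype.card K ^ 4)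
    (σ : L →ₐ[K] L) (hσ : σ = FiniteField.frobeniusAlgHom K L) :
    ∃ A : Submodule K L, Module.finrank K A ≤ 3 ∧ ∀ a b e : L,
      (∀ α ∈ A, α ≠ 0 → Algebra.trace K L
        (a * (σ (σ α) * σ (σ (σ α)) / σ α) + b * (α * σ (σ (σ α)) / σ α) + e * α) = 0) →
      a = 0 ∧ b = 0 := by
  have inj : Function.Injective σ := σ.toRingHom.injective
  obtain ⟨β, hβ⟩ := exists_frobenius_frobenius_ne hL σ hσ
  have hβ1 : σ β ≠ β := fun h => hβ (by rw [h, h])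
  obtain ⟨γ, hγ, hγ2⟩ : ∃ γ, γ ∉ Submodule.span K (Set.range ![1, β]) ∧ σ (σ γ) ≠ γ := by
    obtain ⟨γ, hγ⟩ : ∃ γ, γ ∉ Submodule.span K (Set.range ![1, β]) := by
      by_contra! hcon
      have h1 := finrank_range_le_card (R := K) ![1, β]
      rw [Set.finrank, Submodule.eq_top_iff'.2 hcon, finrank_top, finrank_eq_four hL] at h1
      simp at h1
    by_cases hc : σ (σ γ) = γ
    · refine ⟨γ + β, fun hm => hγ ?_, fun hm => hβ ?_⟩
      · have m1 : β ∈ Submodule.span K (Set.range ![1, β]) := Submodule.subset_span ⟨1, rfl⟩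
        simpa using Submodule.sub_mem _ hm m1
      · simpa [hc] using hm
    · exact ⟨γ, hγ, hc⟩
  refine ⟨Submodule.span K (Set.range ![1, β, γ]), finrank_range_le_card (R := K) _,
    fun a b e h => ?_⟩
  have m0 : (1 : L) ∈ Submodule.span K (Set.range ![1, β, γ]) :=
    Submodule.subset_span ⟨0, rfl⟩
  have m1 : β ∈ Submodule.span K (Set.range ![1, β, γ]) := Submodule.subset_span ⟨1, rfl⟩
  have m2 : γ ∈ Submodule.span K (Set.range ![1, β, γ]) := Submodule.subset_span ⟨2, rfl⟩
  have e1 := mul_conj_sub_eq_zero hK hL σ hσ _ m0 a b e h β m1 hβ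
  have e2 := mul_conj_sub_eq_zero hK hL σ hσ _ m0 a b e h γ m2 hγ2
  have d1 : σ β - β ≠ 0 := sub_ne_zero.2 hβ1
  have d2 : σ (σ β) - σ β ≠ 0 := sub_ne_zero.2 fun h => hβ1 (inj h)
  have ha : a * ((σ (σ γ) - σ γ) * (σ β - β) - (σ (σ β) - σ β) * (σ γ - γ)) = 0 := by
    linear_combination (σ β - β) * e2 - (σ γ - γ) * e1
  have hdet : (σ (σ γ) - σ γ) * (σ β - β) - (σ (σ β) - σ β) * (σ γ - γ) ≠ 0 := by
    intro hd
    obtain ⟨k, hk⟩ := exists_algebraMap_eq_of_frobenius_eq σ hσ ((σ γ - γ) / (σ β - β)) (by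
      simp only [map_div₀, map_sub]
      rw [div_eq_div_iff d2 d1]
      linear_combination hd)
    rw [eq_div_iff d1] at hk
    obtain ⟨l, hl⟩ := exists_algebraMap_eq_of_frobenius_eq σ hσ (γ - algebraMap K L k * β) (by
      simp only [map_mul, map_sub, AlgHom.commutes]
      linear_combination -hk)
    apply hγ
    have : γ = l • ![1, β] 0 + k • ![1, β] 1 := by
      simp [Algebra.smul_def, hl]
    rw [this]
    exact Submodule.add_mem _ (Submodule.smul_mem _ _ (Submodule.subset_span ⟨0, rfl⟩))
      (Submodule.smul_mem _ _ (Submodule.subset_span ⟨1, rfl⟩))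
  have ha0 : a = 0 := by simpa [hdet] using ha
  refine ⟨ha0, ?_⟩
  rw [ha0, zero_mul, zero_add, mul_eq_zero] at e1
  exact e1.resolve_right fun h => hβ1 (sub_eq_zero.1 h).symm

theorem mul_conj_sub_eq_tracePolar {K L : Type*} [Field K] [Field L] [Algebra K L]
    [Fintype K] [Fintype L] (hK : Fintype.card K = 4) (hL : Fintype.card L = Fintype.card K ^ 4)
    (σ : L →ₐ[K] L) (hσ : σ = FiniteField.frobeniusAlgHom K L) (A : Submodule K L) (h1A : 1 ∈ A)
    (a b e : L) (h : ∀ α ∈ A, α ≠ 0 → Algebra.trace K L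
      (a * (σ (σ α) * σ (σ (σ α)) / σ α) + b * (α * σ (σ (σ α)) / σ α) + e * α) = 0)
    (β y : L) (hβA : β ∈ A) (hβ : σ β = β + y) (hy : σ y = y + 1) (h2 : (2 : L) = 0) :
    (a * (y + 1) + b * y) * y = algebraMap K L (tracePolar σ a b e β) := by
  have h4 := frobenius_iterate_four hL σ hσ
  have hy0 : y ≠ 0 := by
    rintro rfl
    simp at hy
  have hy1 : y + 1 ≠ 0 := by
    rw [← hy]
    simpa using hy0
  have hβ1 : σ β ≠ β := by simpa [hβ] using hy0
  have hp := tracePolar_mul_prod_add_eq_zero hL σ hσ A h1A a b e h β hβA hβ1 _ rfl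
  have e2 : σ (σ β) = β + 1 := by
    rw [hβ, map_add, hβ, hy]
    linear_combination y * h2
  have e3 : σ (σ (σ β)) = β + y + 1 := by
    rw [e2, map_add, hβ, map_one]
  have hfrob : σ (σ β) = (σ β) ^ 4 := by
    rw [← hK, hσ, FiniteField.coe_frobeniusAlgHom]
  generalize hr : (σ (σ (σ β)) - σ β) * (a * (σ (σ β) - σ β) + b * (β - σ β)) = r at hp
  generalize algebraMap K L (tracePolar σ a b e β) = κ at hp ⊢
  rw [e3, e2, hβ] at hp hr
  rw [e2, hβ] at hfrob
  open Polynomial in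
  have hzero : (C κ *
        (C (β + (β + y) + (β + 1) + (β + y + 1)) * X ^ 3 +
        C (β * (β + y) + β * (β + 1) + β * (β + y + 1) + (β + y) * (β + 1) +
          (β + y) * (β + y + 1) + (β + 1) * (β + y + 1)) * X ^ 2 +
        C (β * (β + y) * (β + 1) + β * (β + y) * (β + y + 1) + β * (β + 1) * (β + y + 1) +
          (β + y) * (β + 1) * (β + y + 1) + 1) * X +
        C (β * (β + y) * (β + 1) * (β + y + 1))) +
      C r * ((X + C β) * (X + C (β + 1)) * (X + C (β + y + 1))) +
      C (σ r) * ((X + C β) * (X + C (β + y)) * (X + C (β + y + 1))) +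
      C (σ (σ r)) * ((X + C β) * (X + C (β + y)) * (X + C (β + 1))) +
      C (σ (σ (σ r))) * ((X + C (β + y)) * (X + C (β + 1)) * (X + C (β + y + 1)))
      : L[X]) = 0 := by
    refine Polynomial.eq_zero_of_natDegree_lt_card_of_eval_eq_zero _
      (f := algebraMap K L) (algebraMap K L).injective (fun s => ?_) ?_
    · have hs := congrArg (algebraMap K L) (FiniteField.pow_card s)
      rw [hK, map_pow] at hs
      rw [← hp s]
      simp only [Polynomial.eval_add, Polynomial.eval_mul, Polynomial.eval_C, Polynomial.eval_X,
        Polynomial.eval_pow]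
      linear_combination -κ * hs
    · refine lt_of_le_of_lt (b := 3) ?_ (by omega)
      compute_degree
  have hev := congrArg (Polynomial.eval (-(β + y))) hzero
  simp only [Polynomial.eval_add, Polynomial.eval_mul, Polynomial.eval_C, Polynomial.eval_X,
    Polynomial.eval_pow, neg_add_cancel, mul_zero, zero_mul, add_zero, Polynomial.eval_zero] at hev
  have hr' : r = a * (y + 1) + b * y := by
    linear_combination -hr - (a * y + b * y) * h2
  have key : (y + 1) * ((a * (y + 1) + b * y) * y - κ) = 0 := by
    rw [← hr']
    linear_combination hev - κ * hfrob + (κ * β + y * r) * h2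
  exact sub_eq_zero.1 ((mul_eq_zero.1 key).resolve_left hy1)

theorem exists_submodule_trace_condition_of_eq_four {K L : Type*} [Field K] [Field L]
    [Algebra K L] [Fintype K] [Fintype L] (hK : Fintype.card K = 4)
    (hL : Fintype.card L = Fintype.card K ^ 4)
    (σ : L →ₐ[K] L) (hσ : σ = FiniteField.frobeniusAlgHom K L) :
    ∃ A : Submodule K L, Module.finrank K A ≤ 3 ∧ ∀ a b e : L,
      (∀ α ∈ A, α ≠ 0 → Algebra.trace K L
        (a * (σ (σ α) * σ (σ (σ α)) / σ α) + b * (α * σ (σ (σ α)) / σ α) + e * α) = 0) →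
      a = 0 ∧ b = 0 := by
  have h2K : (2 : K) = 0 := by
    have := FiniteField.cast_card_eq_zero K
    rw [hK] at this
    refine pow_eq_zero_iff (n := 2) two_ne_zero |>.1 ?_
    push_cast at this
    linear_combination this
  have h2 : (2 : L) = 0 := by
    rw [← map_ofNat (algebraMap K L) 2, h2K, map_zero]
  obtain ⟨ω, hω0, hω1⟩ : ∃ ω : K, ω ≠ 0 ∧ ω ≠ 1 := by
    classical
    by_contra! hcon
    have hsub : (Finset.univ : Finset K) ⊆ {0, 1} := fun x _ => by
      by_cases hx : x = 0
      · simp [hx]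
      · simp [hcon x hx]
    have := (Finset.card_le_card hsub).trans Finset.card_le_two
    rw [Finset.card_univ, hK] at this
    omega
  obtain ⟨z, hz⟩ := exists_trace_eq_one K L
  have hzL := algebraMap_trace_eq_frobenius hL σ hσ z
  rw [hz, map_one] at hzL
  obtain ⟨θ, hθdef⟩ : ∃ θ, θ = z + σ (σ z) := ⟨_, rfl⟩
  obtain ⟨η, hηdef⟩ : ∃ η, η = z + σ z := ⟨_, rfl⟩
  have hθ : σ θ = θ + 1 := by
    rw [hθdef, map_add]
    linear_combination -hzL - (z + σ (σ z)) * h2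
  have hη : σ η = η + θ := by
    rw [hηdef, hθdef, map_add]
    linear_combination -z * h2
  refine ⟨Submodule.span K (Set.range ![1, θ, η]), finrank_range_le_card (R := K) _,
    fun a b e h => ?_⟩
  have m0 : (1 : L) ∈ Submodule.span K (Set.range ![1, θ, η]) :=
    Submodule.subset_span ⟨0, rfl⟩
  have m1 : θ ∈ Submodule.span K (Set.range ![1, θ, η]) := Submodule.subset_span ⟨1, rfl⟩
  have m2 : η ∈ Submodule.span K (Set.range ![1, θ, η]) := Submodule.subset_span ⟨2, rfl⟩
  have hf (x : K) : (a * (θ + algebraMap K L x + 1) + b * (θ + algebraMap K L x)) *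
      (θ + algebraMap K L x) = algebraMap K L (tracePolar σ a b e η) +
        algebraMap K L x * algebraMap K L (tracePolar σ a b e θ) := by
    rw [mul_conj_sub_eq_tracePolar hK hL σ hσ _ m0 a b e h (η + x • θ) (θ + algebraMap K L x)
      (Submodule.add_mem _ m2 (Submodule.smul_mem _ x m1)) ?_ ?_ h2]
    · simp
    · rw [map_add, map_smul, hη, hθ, Algebra.smul_def, Algebra.smul_def]
      ring
    · rw [map_add, AlgHom.commutes, hθ]
      ring
  generalize tracePolar σ a b e η = κ at hf
  generalize tracePolar σ a b e θ = ν at hf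
  have f0 := hf 0
  have f1 := hf 1
  have fω := hf ω
  have hw0 : algebraMap K L ω ≠ 0 := by simpa using hω0
  have hw1 : algebraMap K L ω - 1 ≠ 0 := by
    rw [sub_ne_zero, ← map_one (algebraMap K L)]
    exact fun h => hω1 ((algebraMap K L).injective h)
  rw [map_zero] at f0
  rw [map_one] at f1
  have g1 : b = algebraMap K L ν := by
    linear_combination f1 - f0 - (a * (θ + 1) + b * θ) * h2
  have gω : (a + b) * algebraMap K L ω + a = algebraMap K L ν := by
    refine mul_left_cancel₀ hw0 ?_
    linear_combination fω - f0 - (a + b) * θ * algebraMap K L ω * h2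
  have gab : a + b = 0 := by
    refine (mul_eq_zero.1 (?_ : (a + b) * (algebraMap K L ω - 1) = 0)).resolve_right hw1
    linear_combination gω - g1 - a * h2
  have hb : a = algebraMap K L ν := by
    linear_combination gab + g1 - b * h2
  have hκ0 : algebraMap K L ν * θ = algebraMap K L κ := by
    rw [← hb]
    linear_combination f0 - θ ^ 2 * gab
  have hκ1 := congrArg σ hκ0
  rw [map_mul, AlgHom.commutes, AlgHom.commutes, hθ] at hκ1
  have hν : algebraMap K L ν = 0 := by linear_combination hκ1 - hκ0
  exact ⟨hb.trans hν, g1.trans hν⟩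

theorem exists_pow_four_eq_one_sub_sq {L : Type*} [Field L] [Fintype L]
    (hL : Fintype.card L = 81) (h3 : (3 : L) = 0) : ∃ w : L, w ^ 4 = 1 - w ^ 2 := by
  obtain ⟨i, hi⟩ := (FiniteField.isSquare_neg_one_iff (F := L)).2 (by rw [hL]; norm_num)
  have h2 : (2 : L) ≠ 0 := fun h => one_ne_zero (α := L) (by linear_combination h3 - h)
  have hchar : ringChar L ≠ 2 := fun h => h2 (by
    have := ringChar.Nat.cast_ringChar (R := L)
    rw [h] at this
    exact_mod_cast this)
  have h4 : (1 + i) ^ 4 = -1 := by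
    linear_combination (-(i * i) - 4 * i - 5) * hi - h3
  have h0 : 1 + i ≠ 0 := by
    intro h
    rw [h] at h4
    simp at h4
  obtain ⟨w, hw⟩ := (FiniteField.isSquare_iff hchar h0).2 (by
    rw [hL, show 81 / 2 = 4 * 10 from rfl, pow_mul, h4]
    norm_num)
  refine ⟨w, ?_⟩
  linear_combination (1 - w * w - i) * hw - hi + (w * w - 1) * h3

theorem eq_zero_of_trace_mul_pow_eq_zero {K L : Type*} [Field K] [Field L] [Algebra K L]
    [Fintype K] [Fintype L] (hL : Fintype.card L = Fintype.card K ^ 4)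
    (σ : L →ₐ[K] L) (hσ : σ = FiniteField.frobeniusAlgHom K L) (h3 : (3 : L) = 0) (w : L)
    (hw : w ^ 4 = 1 - w ^ 2) (hσw : σ w = w ^ 3) (a : L)
    (h : ∀ j < 4, Algebra.trace K L (a * w ^ j) = 0) : a = 0 := by
  have hw0 : w ≠ 0 := by
    rintro rfl
    simp at hw
  have tr (j : ℕ) (hj : j < 4) := congrArg (algebraMap K L) (h j hj)
  simp only [algebraMap_trace_eq_frobenius hL σ hσ, map_mul, map_pow, hσw, map_zero] at tr
  have t0 := tr 0 (by norm_num)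
  have t1 := tr 1 (by norm_num)
  have t2 := tr 2 (by norm_num)
  have t3 := tr 3 (by norm_num)
  generalize σ a = a1, σ (σ a) = a2, σ (σ (σ a)) = a3 at *
  have hp : w ^ 4 * (a + a2) = 0 := by grind
  have hm : w ^ 6 * (a - a2) = 0 := by grind
  have hp' := (mul_eq_zero.1 hp).resolve_left (pow_ne_zero _ hw0)
  have hm' := (mul_eq_zero.1 hm).resolve_left (pow_ne_zero _ hw0)
  linear_combination a * h3 - hp' - hm'

theorem trace_condition_nat_combination {K L : Type*} [Field K] [Field L] [Algebra K L]
    (σ : L →ₐ[K] L) (h3 : (3 : L) = 0) (w : L) (hw : w ^ 4 = 1 - w ^ 2) (hσw : σ w = w ^ 3)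
    (A : Submodule K L) (m0 : 1 ∈ A) (m1 : w ∈ A) (m2 : w ^ 2 ∈ A) (a b e : L)
    (h : ∀ α ∈ A, α ≠ 0 → Algebra.trace K L
      (a * (σ (σ α) * σ (σ (σ α)) / σ α) + b * (α * σ (σ (σ α)) / σ α) + e * α) = 0)
    (r s t c0 c1 c2 c3 d0 d1 d2 d3 z0 z1 z2 z3 : ℕ)
    (hz : (r + s * w + t * w ^ 2) * (z0 + z1 * w + z2 * w ^ 2 + z3 * w ^ 3) = 1)
    (hc : (c0 + c1 * w + c2 * w ^ 2 + c3 * w ^ 3) * (r + s * w ^ 3 + t * (-1 - w ^ 2)) =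
      (r - s * w + t * w ^ 2) * (r - s * w ^ 3 + t * (-1 - w ^ 2)))
    (hd : (d0 + d1 * w + d2 * w ^ 2 + d3 * w ^ 3) * (r + s * w ^ 3 + t * (-1 - w ^ 2)) =
      (r + s * w + t * w ^ 2) * (r - s * w ^ 3 + t * (-1 - w ^ 2))) :
    c0 * Algebra.trace K L (a * w ^ 0) + c1 * Algebra.trace K L (a * w ^ 1) +
        c2 * Algebra.trace K L (a * w ^ 2) + c3 * Algebra.trace K L (a * w ^ 3) +
      (d0 * Algebra.trace K L (b * w ^ 0) + d1 * Algebra.trace K L (b * w ^ 1) +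
        d2 * Algebra.trace K L (b * w ^ 2) + d3 * Algebra.trace K L (b * w ^ 3)) +
      (r * Algebra.trace K L (e * w ^ 0) + s * Algebra.trace K L (e * w ^ 1) +
        t * Algebra.trace K L (e * w ^ 2)) = 0 := by
  have hne : (r + s * w + t * w ^ 2 : L) ≠ 0 := left_ne_zero_of_mul_eq_one hz
  have hmem : (r + s * w + t * w ^ 2 : L) ∈ A := by
    have := add_mem (add_mem (nsmul_mem m0 r) (nsmul_mem m1 s)) (nsmul_mem m2 t)
    simpa [nsmul_eq_mul] using this
  have s1 : σ (r + s * w + t * w ^ 2 : L) = r + s * w ^ 3 + t * (-1 - w ^ 2) := by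
    simp only [map_add, map_mul, map_pow, map_natCast, hσw]
    linear_combination t * (w ^ 2 - 1) * hw + t * w ^ 2 * h3
  have s2 : σ (r + s * w ^ 3 + t * (-1 - w ^ 2) : L) = r - s * w + t * w ^ 2 := by
    simp only [map_add, map_sub, map_neg, map_one, map_mul, map_pow, map_natCast, hσw]
    linear_combination (s * w * (w ^ 4 + 2 - w ^ 2) - t * (w ^ 2 - 1)) * hw +
      (s * w * (1 - w ^ 2) - t * w ^ 2) * h3
  have s3 : σ (r - s * w + t * w ^ 2 : L) = r - s * w ^ 3 + t * (-1 - w ^ 2) := by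
    simp only [map_add, map_sub, map_mul, map_pow, map_natCast, hσw]
    linear_combination t * (w ^ 2 - 1) * hw + t * w ^ 2 * h3
  have hne1 : σ (r + s * w + t * w ^ 2 : L) ≠ 0 := (map_ne_zero σ).2 hne
  have hα := h _ hmem hne
  rw [s1] at hne1
  rw [s1, s2, s3, ← hc, ← hd, mul_div_cancel_right₀ _ hne1, mul_div_cancel_right₀ _ hne1] at hα
  rw [← hα]
  simp only [← nsmul_eq_mul, ← map_nsmul, ← map_add]
  congr 1
  simp only [nsmul_eq_mul]
  ring

set_option maxHeartbeats 2000000 in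
theorem exists_submodule_trace_condition_of_eq_three {K L : Type*} [Field K] [Field L]
    [Algebra K L] [Fintype K] [Fintype L] (hK : Fintype.card K = 3)
    (hL : Fintype.card L = Fintype.card K ^ 4)
    (σ : L →ₐ[K] L) (hσ : σ = FiniteField.frobeniusAlgHom K L) :
    ∃ A : Submodule K L, Module.finrank K A ≤ 3 ∧ ∀ a b e : L,
      (∀ α ∈ A, α ≠ 0 → Algebra.trace K L
        (a * (σ (σ α) * σ (σ (σ α)) / σ α) + b * (α * σ (σ (σ α)) / σ α) + e * α) = 0) →
      a = 0 ∧ b = 0 := by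
  have h3 : (3 : K) = 0 := by
    simpa [hK] using FiniteField.cast_card_eq_zero K
  have h3L : (3 : L) = 0 := by
    rw [← map_ofNat (algebraMap K L) 3, h3, map_zero]
  obtain ⟨w, hw⟩ := exists_pow_four_eq_one_sub_sq (by rw [hL, hK]; norm_num) h3L
  have hσw : σ w = w ^ 3 := by
    rw [← hK, hσ, FiniteField.coe_frobeniusAlgHom]
  refine ⟨Submodule.span K (Set.range ![1, w, w ^ 2]), finrank_range_le_card (R := K) _,
    fun a b e h => ?_⟩
  have m0 : (1 : L) ∈ Submodule.span K (Set.range ![1, w, w ^ 2]) :=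
    Submodule.subset_span ⟨0, rfl⟩
  have m1 : w ∈ Submodule.span K (Set.range ![1, w, w ^ 2]) := Submodule.subset_span ⟨1, rfl⟩
  have m2 : w ^ 2 ∈ Submodule.span K (Set.range ![1, w, w ^ 2]) :=
    Submodule.subset_span ⟨2, rfl⟩
  have hrow := trace_condition_nat_combination σ h3L w hw hσw _ m0 m1 m2 a b e h
  have e0 := hrow 0 0 1 0 0 1 0 0 0 1 0 1 0 1 0 (by push_cast; grind) (by push_cast; grind)
    (by push_cast; grind)
  have e1 := hrow 0 1 0 0 1 0 0 0 2 0 0 0 1 0 1 (by push_cast; grind) (by push_cast; grind)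
    (by push_cast; grind)
  have e2 := hrow 0 1 1 1 2 0 1 0 0 0 2 1 0 2 2 (by push_cast; grind) (by push_cast; grind)
    (by push_cast; grind)
  have e3 := hrow 0 1 2 2 2 0 1 0 0 0 2 2 0 1 2 (by push_cast; grind) (by push_cast; grind)
    (by push_cast; grind)
  have e4 := hrow 1 0 0 1 0 0 0 1 0 0 0 1 0 0 0 (by push_cast; grind) (by push_cast; grind)
    (by push_cast; grind)
  have e5 := hrow 1 0 1 1 0 1 0 1 0 1 0 0 0 1 0 (by push_cast; grind) (by push_cast; grind)
    (by push_cast; grind)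
  have e6 := hrow 1 0 2 1 0 2 0 1 0 2 0 2 0 1 0 (by push_cast; grind) (by push_cast; grind)
    (by push_cast; grind)
  have e7 := hrow 1 1 0 2 1 1 1 0 0 1 0 2 1 1 2 (by push_cast; grind) (by push_cast; grind)
    (by push_cast; grind)
  have e8 := hrow 1 1 1 0 0 1 2 1 0 2 0 2 1 2 0 (by push_cast; grind) (by push_cast; grind)
    (by push_cast; grind)
  have e9 := hrow 1 1 2 1 1 1 2 0 1 0 1 1 0 1 1 (by push_cast; grind) (by push_cast; grind)
    (by push_cast; grind)
  have e10 := hrow 1 2 0 2 2 1 2 0 0 1 0 2 2 1 1 (by push_cast; grind) (by push_cast; grind)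
    (by push_cast; grind)
  have e11 := hrow 1 2 1 0 0 1 1 1 0 2 0 2 2 2 0 (by push_cast; grind) (by push_cast; grind)
    (by push_cast; grind)
  have e12 := hrow 1 2 2 1 2 1 1 0 2 0 2 1 0 1 2 (by push_cast; grind) (by push_cast; grind)
    (by push_cast; grind)
  generalize hA0 : Algebra.trace K L (a * w ^ 0) = A0,
    hA1 : Algebra.trace K L (a * w ^ 1) = A1,
    hA2 : Algebra.trace K L (a * w ^ 2) = A2,
    hA3 : Algebra.trace K L (a * w ^ 3) = A3,
    hB0 : Algebra.trace K L (b * w ^ 0) = B0,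
    hB1 : Algebra.trace K L (b * w ^ 1) = B1,
    hB2 : Algebra.trace K L (b * w ^ 2) = B2,
    hB3 : Algebra.trace K L (b * w ^ 3) = B3,
    hE0 : Algebra.trace K L (e * w ^ 0) = E0,
    hE1 : Algebra.trace K L (e * w ^ 1) = E1,
    hE2 : Algebra.trace K L (e * w ^ 2) = E2
    at e0 e1 e2 e3 e4 e5 e6 e7 e8 e9 e10 e11 e12
  have zA0 : A0 = 0 := by
    linear_combination e2 + 2 * e3 + e5 + 2 * e7 + e8 + e9 + 2 * e10 + e11 + e12 -
      (5 * A0 + 5 * A1 + 3 * A2 + 5 * A3 + 1 * B0 + 1 * B1 + 3 * B2 + 3 * B3 +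
        3 * E0 + 5 * E1 + 4 * E2) * h3
  have zA1 : A1 = 0 := by
    linear_combination e1 + 2 * e2 + 2 * e3 + 2 * e9 + e12 -
      (3 * A0 + 4 * A1 + 1 * A2 + 3 * A3 + 2 * B1 + 4 * B3 + 1 * E0 + 3 * E1 + 4 * E2) * h3
  have zA2 : A2 = 0 := by
    linear_combination e2 + 2 * e3 + e6 + e8 + e11 -
      (2 * A0 + 2 * A1 + 1 * A2 + 2 * A3 + 1 * B0 + 2 * B2 + 2 * B3 + 1 * E0 + 2 * E1 + 3 * E2) * h3
  have zA3 : A3 = 0 := by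
    linear_combination e1 + 2 * e2 + 2 * e3 + e7 + 2 * e8 + 2 * e9 + 2 * e10 + e11 + e12 -
      (5 * A0 + 6 * A1 + 3 * A2 + 6 * A3 + 1 * B0 + 2 * B1 + 3 * B2 + 4 * B3 +
        3 * E0 + 6 * E1 + 5 * E2) * h3
  have zB0 : B0 = 0 := by
    linear_combination 2 * e7 + 2 * e8 + 2 * e9 + 2 * e10 + 2 * e11 + 2 * e12 -
      (4 * A0 + 4 * A1 + 4 * A2 + 6 * A3 + 1 * B0 + 2 * B1 + 4 * B2 + 2 * B3 +
        4 * E0 + 6 * E1 + 4 * E2) * h3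
  have zB1 : B1 = 0 := by
    linear_combination e1 + e2 + e3 + e7 + e8 + e9 + 2 * e10 + 2 * e11 + 2 * e12 -
      (4 * A0 + 5 * A1 + 3 * A2 + 5 * A3 + 1 * B0 + 2 * B1 + 3 * B2 + 3 * B3 +
        3 * E0 + 6 * E1 + 4 * E2) * h3
  have zB2 : B2 = 0 := by
    linear_combination e2 + 2 * e3 + 2 * e7 + e9 + 2 * e10 + e12 -
      (5 * A0 + 5 * A1 + 2 * A2 + 4 * A3 + 1 * B1 + 1 * B2 + 3 * B3 + 2 * E0 + 4 * E1 + 3 * E2) * h3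
  have zB3 : B3 = 0 := by
    linear_combination e1 + 2 * e7 + 2 * e9 + e10 + e12 -
      (3 * A0 + 3 * A1 + 2 * A2 + 3 * A3 + 2 * B1 + 1 * B2 + 1 * B3 + 2 * E0 + 3 * E1 + 2 * E2) * h3
  refine ⟨eq_zero_of_trace_mul_pow_eq_zero hL σ hσ h3L w hw hσw a fun j hj => ?_,
    eq_zero_of_trace_mul_pow_eq_zero hL σ hσ h3L w hw hσw b fun j hj => ?_⟩
  · interval_cases j
    exacts [hA0.trans zA0, hA1.trans zA1, hA2.trans zA2, hA3.trans zA3]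
  · interval_cases j
    exacts [hB0.trans zB0, hB1.trans zB1, hB2.trans zB2, hB3.trans zB3]

theorem exists_submodule_trace_condition {K L : Type*} [Field K] [Field L]
    [Algebra K L] [Fintype K] [Fintype L] (hK : 3 ≤ Fintype.card K)
    (hL : Fintype.card L = Fintype.card K ^ 4)
    (σ : L →ₐ[K] L) (hσ : σ = FiniteField.frobeniusAlgHom K L) :
    ∃ A : Submodule K L, Module.finrank K A ≤ 3 ∧ ∀ a b e : L,
      (∀ α ∈ A, α ≠ 0 → Algebra.trace K L
        (a * (σ (σ α) * σ (σ (σ α)) / σ α) + b * (α * σ (σ (σ α)) / σ α) + e * α) = 0) →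
      a = 0 ∧ b = 0 := by
  obtain h | h | h : Fintype.card K = 3 ∨ Fintype.card K = 4 ∨ 5 ≤ Fintype.card K := by omega
  · exact exists_submodule_trace_condition_of_eq_three h hL σ hσ
  · exact exists_submodule_trace_condition_of_eq_four h hL σ hσ
  · exact exists_submodule_trace_condition_of_five_le h hL σ hσ

/-- The tensor rank of the Gabidulin code `G_{2,1} = {x ↦ a·x + b·x^q}` in
`L/K` with `|K| = q ≥ 3` and `|L| = q^4` equals `11`. -/
theorem stmt_0 (q : ℕ) (hq : 3 ≤ q) (K L : Type*) [Field K] [Field L]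
    [Algebra K L] [Fintype K] [Fintype L]
    (hK : Fintype.card K = q) (hL : Fintype.card L = q ^ 4) :
    IsLeast {R : ℕ | ∃ f : Fin R → (L →ₗ[K] L),
      (∀ i, Module.finrank K (LinearMap.range (f i)) = 1) ∧
      ∀ g : L →ₗ[K] L, (∃ a b : L, ∀ x : L, g x = a * x + b * x ^ q) →
        g ∈ Submodule.span K (Set.range f)} 11 := by
  subst hK
  refine ⟨?_, fun R hR => ?_⟩
  · obtain ⟨A, hA, hcore⟩ := exists_submodule_trace_condition hq hL _ rfl
    obtain ⟨f, hf, hspan⟩ := exists_rankOne_span_of_trace_condition hL A hA _ rfl hcore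
    refine ⟨f, hf, ?_⟩
    rintro g ⟨a, b, hg⟩
    convert hspan a b using 1
    ext x
    rw [hg, linearized_apply, FiniteField.coe_frobeniusAlgHom]
    simp
  · obtain ⟨f, hf, hG⟩ := hR
    refine eleven_le_of_gabidulin_le_span hL R f hf fun a b => hG _ ⟨a, b, fun x => ?_⟩
    rw [linearized_apply, FiniteField.coe_frobeniusAlgHom]
    simp
end

section
/- Let K be a finite field with q elements and let L be a field extension of K with q^4 elements. Then for any rank-one K-linear maps f_1, …, f_10 : L → L, the Gabidulin code G = {x ↦ a·x + b·x^q : a, b ∈ L} is not contained in the K-linear span of {f_1, …, f_10}. Equivalently, the tensor rank of G is at least 11, so G is not a minimum tensor rank code (its tensor rank strictly exceeds the Kruskal lower bound 8 + 3 − 1 = 10). -/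
open Module Polynomial
open Finset.HasAntidiagonal (antidiagonal)

section Gabidulin

variable {K L : Type*} [Field K] [Field L] [Algebra K L]

/-- The bilinear map sending `a` and `b` to the map `z ↦ Tr(a z) • b`. -/
noncomputable def traceSMulRight (K L : Type*) [Field K] [Field L] [Algebra K L] :
    L →ₗ[K] L →ₗ[K] (L →ₗ[K] L) :=
  LinearMap.smulRightₗ ∘ₗ Algebra.traceForm K L

theorem traceSMulRight_apply (a b z : L) :
    traceSMulRight K L a b z = Algebra.trace K L (a * z) • b := rfl

/-- A linear map whose range is a line has the form `z ↦ Tr(a z) • b`. -/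
theorem exists_eq_traceSMulRight [FiniteDimensional K L] [Algebra.IsSeparable K L]
    {f : L →ₗ[K] L} (hf : finrank K (LinearMap.range f) = 1) :
    ∃ a b : L, a ≠ 0 ∧ b ≠ 0 ∧ f = traceSMulRight K L a b := by
  obtain ⟨v, hv, hspan⟩ := finrank_eq_one_iff'.mp hf
  choose c hc using fun z => hspan ⟨f z, z, rfl⟩
  have hc' : ∀ z, c z • (v : L) = f z := fun z => congrArg Subtype.val (hc z)
  have hv0 : (v : L) ≠ 0 := fun h => hv (Subtype.ext h)
  let φ : L →ₗ[K] K :=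
    { toFun := c
      map_add' := fun x y => smul_left_injective K hv0 (by
        simp only [add_smul, hc', map_add])
      map_smul' := fun r x => smul_left_injective K hv0 (by
        simp only [hc', map_smul, smul_eq_mul, mul_smul, RingHom.id_apply]) }
  let a := ((Algebra.traceForm K L).toDual (traceForm_nondegenerate K L)).symm φ
  have ha : ∀ z, Algebra.trace K L (a * z) = c z := fun z => by
    rw [← Algebra.traceForm_apply]
    exact LinearMap.BilinForm.apply_toDual_symm_apply φ z
  have key : f = traceSMulRight K L a v := by
    ext z
    rw [traceSMulRight_apply, ha, hc']
  refine ⟨a, v, ?_, hv0, key⟩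
  intro h0
  rw [h0] at key
  rw [map_zero, LinearMap.zero_apply] at key
  rw [key, LinearMap.range_zero, finrank_bot] at hf
  exact zero_ne_one hf

/-- `g` is a form of degree `d` in two variables, with coefficients in `V`. -/
def IsBinaryForm {V : Type*} [AddCommGroup V] [Module K V] (d : ℕ) (g : K → K → V) : Prop :=
  ∃ M : ℕ × ℕ → V, ∀ s t, g s t = ∑ p ∈ antidiagonal d, (s ^ p.1 * t ^ p.2) • M p

namespace IsBinaryForm

variable {U V W : Type*} [AddCommGroup U] [Module K U] [AddCommGroup V] [Module K V]
  [AddCommGroup W] [Module K W]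

theorem const (v : V) : IsBinaryForm (K := K) 0 (fun _ _ => v) :=
  ⟨fun _ => v, by simp⟩

theorem linear (u w : V) : IsBinaryForm (K := K) 1 (fun s t => s • u + t • w) :=
  ⟨fun p => if p = (1, 0) then u else w, fun s t => by
    simp [Finset.Nat.antidiagonal_succ, add_comm]⟩

theorem map₂ {d e : ℕ} {g : K → K → U} {h : K → K → V} (B : U →ₗ[K] V →ₗ[K] W)
    (hg : IsBinaryForm d g) (hh : IsBinaryForm e h) :
    IsBinaryForm (d + e) (fun s t => B (g s t) (h s t)) := by
  obtain ⟨M, hM⟩ := hg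
  obtain ⟨N, hN⟩ := hh
  refine ⟨fun p => ∑ i ∈ antidiagonal d, ∑ j ∈ antidiagonal e,
    if p = i + j then B (M i) (N j) else 0, fun s t => ?_⟩
  simp only [hM, hN, map_sum, LinearMap.sum_apply, Finset.smul_sum, map_smul,
    LinearMap.smul_apply]
  rw [Finset.sum_comm]
  conv_rhs => rw [Finset.sum_comm]
  refine Finset.sum_congr rfl fun i hi => ?_
  conv_rhs => rw [Finset.sum_comm]
  refine Finset.sum_congr rfl fun j hj => ?_
  have hij : i + j ∈ antidiagonal (d + e) := by
    simp only [Finset.HasAntidiagonal.mem_antidiagonal, Prod.fst_add, Prod.snd_add] at hi hj ⊢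
    omega
  simp only [smul_ite, smul_zero, Finset.sum_ite_eq', hij, if_true, smul_smul,
    Prod.fst_add, Prod.snd_add]
  congr 1
  ring

theorem mul {d e : ℕ} {g h : K → K → L} (hg : IsBinaryForm d g) (hh : IsBinaryForm e h) :
    IsBinaryForm (d + e) (fun s t => g s t * h s t) :=
  map₂ (LinearMap.mul K L) hg hh

/-- Maps proportional to values of a form of degree `d` span at most `d + 1` dimensions. -/
theorem finrank_span_le [FiniteDimensional K V] {ι : Type*} {d : ℕ} {g : K → K → V}
    (hg : IsBinaryForm d g) (f : ι → V) (hf : ∀ i, ∃ c s t : K, f i = c • g s t) :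
    finrank K (Submodule.span K (Set.range f)) ≤ d + 1 := by
  classical
  obtain ⟨M, hM⟩ := hg
  have hle : Submodule.span K (Set.range f) ≤
      Submodule.span K (((antidiagonal d).image M : Finset V) : Set V) := by
    rw [Submodule.span_le]
    rintro _ ⟨i, rfl⟩
    obtain ⟨c, s, t, h⟩ := hf i
    rw [h, hM]
    exact Submodule.smul_mem _ _ (Submodule.sum_mem _ fun p hp => Submodule.smul_mem _ _
      (Submodule.subset_span (Finset.mem_coe.mpr (Finset.mem_image_of_mem M hp))))
  refine (Submodule.finrank_mono hle).trans ((finrank_span_finset_le_card _).trans ?_)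
  exact Finset.card_image_le.trans (by simp)

end IsBinaryForm

/-- If equal labels force proportionality, the dimension of the span of a family is at most
the number of labels. -/
theorem finrank_span_range_le_card_image {V α ι : Type*} [AddCommGroup V] [Module K V]
    [FiniteDimensional K V] [Fintype ι] [DecidableEq α] (f : ι → V) (κ : ι → α)
    (h : ∀ i j, κ i = κ j → ∃ c : K, f i = c • f j) :
    finrank K (Submodule.span K (Set.range f)) ≤ (Finset.univ.image κ).card := by
  classical
  have hrep : ∀ y : Finset.univ.image κ, ∃ i, κ i = y := fun y => by
    obtain ⟨i, -, hi⟩ := Finset.mem_image.mp y.2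
    exact ⟨i, hi⟩
  choose r hr using hrep
  have hle : Submodule.span K (Set.range f) ≤
      Submodule.span K (Set.range fun y : Finset.univ.image κ => f (r y)) := by
    rw [Submodule.span_le]
    rintro _ ⟨i, rfl⟩
    have hi : κ i ∈ Finset.univ.image κ := Finset.mem_image_of_mem κ (Finset.mem_univ i)
    obtain ⟨c, hc⟩ := h i (r ⟨κ i, hi⟩) (hr ⟨κ i, hi⟩).symm
    rw [hc]
    exact Submodule.smul_mem _ _ (Submodule.subset_span ⟨_, rfl⟩)
  refine (Submodule.finrank_mono hle).trans ((finrank_range_le_card _).trans ?_)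
  simp

/-- `σ` behaves like the Frobenius of the extension of degree four of a finite field. -/
structure IsQuarticFrobenius (σ : L →ₐ[K] L) : Prop where
  iterate_four : ∀ x, σ (σ (σ (σ x))) = x
  fixed : ∀ x, σ x = x → ∃ k : K, algebraMap K L k = x
  trace : ∀ x, algebraMap K L (Algebra.trace K L x) = x + σ x + σ (σ x) + σ (σ (σ x))
  indep : ∀ α β γ δ : L,
    (∀ x, α * x + β * σ x + γ * σ (σ x) + δ * σ (σ (σ x)) = 0) →
      α = 0 ∧ β = 0 ∧ γ = 0 ∧ δ = 0

theorem isQuarticFrobenius_frobeniusAlgHom [Fintype K] [Finite L] (h4 : finrank K L = 4) :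
    IsQuarticFrobenius (FiniteField.frobeniusAlgHom K L) where
  iterate_four x := by
    have h := pow_orderOf_eq_one (FiniteField.frobeniusAlgHom K L)
    rw [FiniteField.orderOf_frobeniusAlgHom, h4] at h
    exact DFunLike.congr_fun h x
  fixed x hx := by
    refine (IsGalois.mem_range_algebraMap_iff_fixed x).mpr fun g => ?_
    obtain ⟨n, rfl⟩ := (FiniteField.bijective_frobeniusAlgEquivOfAlgebraic_pow K L).2 g
    simp only [AlgEquiv.coe_pow]
    exact Function.iterate_fixed hx _
  trace x := by
    rw [FiniteField.algebraMap_trace_eq_sum_pow, h4]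
    simp only [Finset.sum_range_succ, Finset.sum_range_zero, FiniteField.frobeniusAlgHom_apply,
      Nat.card_eq_fintype_card]
    ring
  indep α β γ δ h := by
    have hinj : Function.Injective fun n : Fin 4 => FiniteField.frobeniusAlgHom K L ^ n.1 :=
      (FiniteField.bijective_frobeniusAlgHom_pow K L).1.comp (finCongr h4.symm).injective
    have hli := (linearIndependent_algHom_toLinearMap K L L).comp _ hinj
    rw [Fintype.linearIndependent_iff] at hli
    have := hli ![α, β, γ, δ] (by
      ext x
      simpa [Fin.sum_univ_four, pow_succ] using h x)
    exact ⟨this 0, this 1, this 2, this 3⟩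

namespace IsQuarticFrobenius

variable {σ : L →ₐ[K] L}

theorem exists_eq_algebraMap_mul (hσ : IsQuarticFrobenius σ) {X Y : L} (hX : X ≠ 0) (hY : Y ≠ 0)
    (h : Y * σ X = X * σ Y) : ∃ k : K, k ≠ 0 ∧ X = algebraMap K L k * Y := by
  have hσY : σ Y ≠ 0 := (map_ne_zero σ).mpr hY
  obtain ⟨k, hk⟩ := hσ.fixed (X / Y) (by
    rw [map_div₀, div_eq_div_iff hσY hY]
    linear_combination h)
  refine ⟨k, ?_, ?_⟩
  · rintro rfl
    rw [map_zero, eq_comm, div_eq_zero_iff] at hk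
    tauto
  · rw [hk, div_mul_cancel₀ _ hY]

theorem exists_algebraMap_eq_norm (hσ : IsQuarticFrobenius σ) (x : L) :
    ∃ k : K, algebraMap K L k = x * σ x * σ (σ x) * σ (σ (σ x)) :=
  hσ.fixed _ (by simp only [map_mul, hσ.iterate_four]; ring)

theorem norm_mul_eq (hσ : IsQuarticFrobenius σ) (a b : L) :
    (b * a) * σ (b * a) * σ (σ (b * a)) * σ (σ (σ (b * a))) =
      (b * σ a) * σ (b * σ a) * σ (σ (b * σ a)) * σ (σ (σ (b * σ a))) := by
  simp only [map_mul, hσ.iterate_four]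
  ring

theorem traceSMulRight_eq_smul (hσ : IsQuarticFrobenius σ) {a b a' b' : L}
    (ha : a ≠ 0) (ha' : a' ≠ 0) (hb : b ≠ 0) (hb' : b' ≠ 0) {c : K}
    (h₂ : b * σ (σ a) = c • (b' * σ (σ a')))
    (h₃ : b * σ (σ (σ a)) = c • (b' * σ (σ (σ a')))) :
    traceSMulRight K L a b = c • traceSMulRight K L a' b' := by
  have hA : σ (σ a) ≠ 0 := by simpa using ha
  have hA' : σ (σ a') ≠ 0 := by simpa using ha'
  rw [Algebra.smul_def] at h₂ h₃
  have hc : algebraMap K L c ≠ 0 := by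
    intro h0
    rw [h0, zero_mul] at h₂
    exact mul_ne_zero hb hA h₂
  obtain ⟨k, hk, hkA⟩ := hσ.exists_eq_algebraMap_mul hA hA' (by
    refine mul_left_cancel₀ (mul_ne_zero hb (mul_ne_zero hc hb')) ?_
    linear_combination (algebraMap K L c * b' * σ (σ a')) * h₃ -
      (algebraMap K L c * b' * σ (σ (σ a'))) * h₂)
  have hka : a = k • a' := by
    have := congrArg (fun y => σ (σ y)) hkA
    simpa [hσ.iterate_four, Algebra.smul_def] using this
  have hkb : k • b = c • b' := by
    rw [Algebra.smul_def, Algebra.smul_def]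
    refine mul_right_cancel₀ hA' ?_
    rw [hkA] at h₂
    linear_combination h₂
  rw [hka, map_smul, LinearMap.smul_apply, ← map_smul, hkb, map_smul]

theorem traceSMulRight_eq_of_twist (hσ : IsQuarticFrobenius σ)
    {a b a₀ b₀ l S S₀ F F₀ : L} (ha : a ≠ 0) (hb : b ≠ 0)
    (ha₀ : a₀ ≠ 0) (hb₀ : b₀ ≠ 0) (hF : F ≠ 0) (hF₀ : F₀ ≠ 0)
    (h : b * σ (σ (σ a)) = l * S) (h₀ : b₀ * σ (σ (σ a₀)) = l * S₀)
    (hS : b * σ (σ a) * σ F = F * S) (hS₀ : b₀ * σ (σ a₀) * σ F₀ = F₀ * S₀) :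
    traceSMulRight K L a b = traceSMulRight K L (σ (σ (σ (σ a₀) / F₀)) * σ (σ F))
      ((σ (σ a₀) / F₀)⁻¹ * (b * σ (σ a) / F)) := by
  have hA : σ (σ a) ≠ 0 := by simpa using ha
  have hA₀ : σ (σ a₀) ≠ 0 := by simpa using ha₀
  obtain ⟨μ, hμ⟩ : ∃ μ, μ = σ (σ a₀) / F₀ := ⟨_, rfl⟩
  have hμ0 : μ ≠ 0 := by rw [hμ]; exact div_ne_zero hA₀ hF₀
  have hμF : σ (σ a₀) = μ * F₀ := by rw [hμ, div_mul_cancel₀ _ hF₀]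
  have hσF₀ : σ F₀ ≠ 0 := by simpa using hF₀
  have hμσ : σ μ = l * μ := by
    have e : σ (σ (σ a₀)) = σ μ * σ F₀ := by rw [hμF, map_mul]
    rw [e] at h₀
    rw [hμF] at hS₀
    refine mul_left_cancel₀ (mul_ne_zero hb₀ (mul_ne_zero hσF₀ hF₀)) ?_
    linear_combination F₀ * h₀ - l * hS₀
  obtain ⟨k, hk, hkA⟩ := hσ.exists_eq_algebraMap_mul hA (mul_ne_zero hμ0 hF) (by
    rw [map_mul, hμσ]
    refine mul_left_cancel₀ hb ?_
    linear_combination μ * F * h - l * μ * hS)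
  have hka : a = k • (σ (σ μ) * σ (σ F)) := by
    have := congrArg (fun y => σ (σ y)) hkA
    simpa [hσ.iterate_four, Algebra.smul_def] using this
  have hkb : k • b = μ⁻¹ * (b * σ (σ a) / F) := by
    rw [hkA, Algebra.smul_def]
    field_simp
  rw [← hμ, ← hkb, map_smul, ← LinearMap.smul_apply, ← map_smul, ← hka]

theorem finrank_span_le_six (hσ : IsQuarticFrobenius σ) [FiniteDimensional K L] {ι : Type*}
    {a b : ι → L} (ha : ∀ i, a i ≠ 0)
    (hb : ∀ i, b i ≠ 0) (i₀ : ι) {u w l : L} {s t : ι → K}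
    (hx : ∀ i, b i * σ (σ (a i)) = s i • u + t i • w) {j : ℕ} (hj : j < 4)
    (hy : ∀ i, b i * σ (σ (σ (a i))) = l * σ^[j] (b i * σ (σ (a i)))) :
    finrank K (Submodule.span K (Set.range fun i => traceSMulRight K L (a i) (b i))) ≤ 6 := by
  have hX : IsBinaryForm (K := K) 1 (fun s t => s • u + t • w) := .linear u w
  have hX₂ : IsBinaryForm (K := K) 1 (fun s t => σ (σ (s • u + t • w))) := by
    simpa using IsBinaryForm.linear (K := K) (σ (σ u)) (σ (σ w))
  have hX₃ : IsBinaryForm (K := K) 1 (fun s t => σ (σ (σ (s • u + t • w)))) := by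
    simpa using IsBinaryForm.linear (K := K) (σ (σ (σ u))) (σ (σ (σ w)))
  have hx0 : ∀ i, s i • u + t i • w ≠ 0 := fun i => by
    rw [← hx]
    exact mul_ne_zero (hb i) (by simpa using ha i)
  have hx1 : ∀ i, σ (s i • u + t i • w) ≠ 0 := fun i => (map_ne_zero σ).mpr (hx0 i)
  have hx2 : ∀ i, σ (σ (s i • u + t i • w)) ≠ 0 := fun i => (map_ne_zero σ).mpr (hx1 i)
  have key : ∀ F : L → L, (∀ i, F (b i * σ (σ (a i))) ≠ 0) →
      (∀ i, b i * σ (σ (a i)) * σ (F (b i * σ (σ (a i)))) =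
        F (b i * σ (σ (a i))) * σ^[j] (b i * σ (σ (a i)))) →
      ∃ μ ν : L, ∀ i, traceSMulRight K L (a i) (b i) =
        traceSMulRight K L (ν * σ (σ (F (s i • u + t i • w))))
          (μ * ((s i • u + t i • w) / F (s i • u + t i • w))) := fun F hF hS =>
    ⟨_, _, fun i => by
      rw [← hx]
      exact hσ.traceSMulRight_eq_of_twist (ha i) (hb i) (ha i₀) (hb i₀) (hF i) (hF i₀)
        (hy i) (hy i₀) (hS i) (hS i₀)⟩
  interval_cases j
  · obtain ⟨μ, ν, h⟩ := key (fun _ => 1) (by simp) (by simp)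
    refine ((IsBinaryForm.map₂ (traceSMulRight K L) (.const ν)
      ((IsBinaryForm.const μ).mul hX)).finrank_span_le _
        fun i => ⟨1, s i, t i, ?_⟩).trans (by norm_num)
    rw [h, one_smul]
    simp only [map_one, mul_one, div_one]
  · obtain ⟨μ, ν, h⟩ := key (fun x => x) (by simpa only [hx] using hx0) (fun i => rfl)
    refine ((IsBinaryForm.map₂ (traceSMulRight K L) ((IsBinaryForm.const ν).mul hX₂)
      (.const μ)).finrank_span_le _ fun i => ⟨1, s i, t i, ?_⟩).trans (by norm_num)
    rw [h, one_smul, div_self (hx0 i), mul_one]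
  · obtain ⟨μ, ν, h⟩ := key (fun x => x * σ x)
      (fun i => by rw [hx]; exact mul_ne_zero (hx0 i) (hx1 i))
      (fun i => by simp only [map_mul, Function.iterate_succ, Function.iterate_zero,
        Function.comp_apply, id]; ring)
    refine ((IsBinaryForm.map₂ (traceSMulRight K L) ((IsBinaryForm.const ν).mul (hX₂.mul hX₃))
      ((IsBinaryForm.const μ).mul ((hX.mul hX₂).mul hX₃))).finrank_span_le _ fun i => ?_).trans
        (by norm_num)
    obtain ⟨k, hk⟩ := hσ.exists_algebraMap_eq_norm (s i • u + t i • w)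
    refine ⟨k⁻¹, s i, t i, ?_⟩
    rw [h, ← map_smul]
    have := hx0 i
    have := hx1 i
    have := hx2 i
    have : σ (σ (σ (s i • u + t i • w))) ≠ 0 := (map_ne_zero σ).mpr this
    generalize s i • u + t i • w = x at *
    rw [Algebra.smul_def, map_inv₀, hk]
    simp only [map_mul]
    congr 1
    field_simp
  · obtain ⟨μ, ν, h⟩ := key (fun x => x * σ x * σ (σ x))
      (fun i => by rw [hx]; exact mul_ne_zero (mul_ne_zero (hx0 i) (hx1 i)) (hx2 i))
      (fun i => by simp only [map_mul, Function.iterate_succ, Function.iterate_zero,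
        Function.comp_apply, id]; ring)
    refine ((IsBinaryForm.map₂ (traceSMulRight K L)
      ((IsBinaryForm.const ν).mul ((hX₂.mul hX₃).mul hX))
      ((IsBinaryForm.const μ).mul (hX.mul hX₃))).finrank_span_le _ fun i => ?_).trans
        (by norm_num)
    obtain ⟨k, hk⟩ := hσ.exists_algebraMap_eq_norm (s i • u + t i • w)
    refine ⟨k⁻¹, s i, t i, ?_⟩
    rw [h, ← map_smul]
    have := hx0 i
    have := hx1 i
    have := hx2 i
    have : σ (σ (σ (s i • u + t i • w))) ≠ 0 := (map_ne_zero σ).mpr this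
    generalize s i • u + t i • w = x at *
    rw [Algebra.smul_def, map_inv₀, hk]
    simp only [map_mul, hσ.iterate_four]
    congr 1
    field_simp

/-- The difference of the norms of the linear polynomials `u₁ + w₁ X` and `u₂ + w₂ X`. -/
noncomputable def normDiff (σ : L →ₐ[K] L) (u₁ w₁ u₂ w₂ : L) : L[X] :=
  (C u₁ + C w₁ * X) * (C (σ u₁) + C (σ w₁) * X) * (C (σ (σ u₁)) + C (σ (σ w₁)) * X) *
      (C (σ (σ (σ u₁))) + C (σ (σ (σ w₁))) * X) -
    (C u₂ + C w₂ * X) * (C (σ u₂) + C (σ w₂) * X) * (C (σ (σ u₂)) + C (σ (σ w₂)) * X) *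
      (C (σ (σ (σ u₂))) + C (σ (σ (σ w₂))) * X)

theorem natDegree_normDiff_le (σ : L →ₐ[K] L) (u₁ w₁ u₂ w₂ : L) :
    (normDiff σ u₁ w₁ u₂ w₂).natDegree ≤ 4 := by
  unfold normDiff
  compute_degree

theorem exists_twist_of_normDiff_eq_zero (σ : L →ₐ[K] L) {u₁ w₁ u₂ w₂ : L} (hw₁ : w₁ ≠ 0)
    (hw₂ : w₂ ≠ 0) (h : normDiff σ u₁ w₁ u₂ w₂ = 0) :
    ∃ j < 4, ∃ l : L, u₂ = l * σ^[j] u₁ ∧ w₂ = l * σ^[j] w₁ := by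
  have h1 : σ w₁ ≠ 0 := (map_ne_zero σ).mpr hw₁
  have h2 : σ (σ w₁) ≠ 0 := (map_ne_zero σ).mpr h1
  have h3 : σ (σ (σ w₁)) ≠ 0 := (map_ne_zero σ).mpr h2
  have he := congrArg (eval (-u₂ / w₂)) h
  have hz : u₂ + w₂ * (-u₂ / w₂) = 0 := by field_simp; ring
  simp only [normDiff, eval_sub, eval_mul, eval_add, eval_C, eval_X, hz, zero_mul, sub_zero,
    eval_zero, mul_eq_zero] at he
  have key : ∀ U W : L, W ≠ 0 → U + W * (-u₂ / w₂) = 0 →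
      u₂ = w₂ / W * U ∧ w₂ = w₂ / W * W := fun U W hW hU => by
    refine ⟨?_, by field_simp⟩
    field_simp at hU ⊢
    linear_combination -hU
  rcases he with ((he | he) | he) | he
  · exact ⟨0, by norm_num, _, key _ _ hw₁ he⟩
  · exact ⟨1, by norm_num, _, key _ _ h1 he⟩
  · exact ⟨2, by norm_num, _, key _ _ h2 he⟩
  · exact ⟨3, by norm_num, _, key _ _ h3 he⟩

/-- The code `{x ↦ α x + β σ(x)}`, as the range of a linear map. -/
noncomputable def gabidulinMap (σ : L →ₐ[K] L) : L × L →ₗ[K] (L →ₗ[K] L) :=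
  LinearMap.coprod (LinearMap.mul K L) ((LinearMap.lcomp K L σ.toLinearMap) ∘ₗ LinearMap.mul K L)

theorem gabidulinMap_apply (σ : L →ₐ[K] L) (α β x : L) :
    gabidulinMap σ (α, β) x = α * x + β * σ x := rfl

theorem finrank_range_gabidulinMap (hσ : IsQuarticFrobenius σ) (h4 : finrank K L = 4) :
    finrank K (LinearMap.range (gabidulinMap σ)) = 8 := by
  have : FiniteDimensional K L := .of_finrank_pos (by omega)
  rw [LinearMap.finrank_range_of_inj, finrank_prod, h4]
  rw [← LinearMap.ker_eq_bot, LinearMap.ker_eq_bot']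
  rintro ⟨α, β⟩ h
  obtain ⟨h1, h2, -⟩ := hσ.indep α β 0 0 fun x => by
    simpa [gabidulinMap_apply] using LinearMap.congr_fun h x
  rw [h1, h2, Prod.mk_zero_zero]

/-- A combination of rank-one maps in the code has vanishing coefficients at `σ²` and `σ³`. -/
theorem sum_coeff_eq_zero (hσ : IsQuarticFrobenius σ) {ι : Type*} [Fintype ι] {a b : ι → L}
    {c : ι → K}
    (h : ∑ i, c i • traceSMulRight K L (a i) (b i) ∈ LinearMap.range (gabidulinMap σ)) :
    ∑ i, c i • (b i * σ (σ (a i)), b i * σ (σ (σ (a i)))) = 0 := by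
  obtain ⟨⟨α, β⟩, h⟩ := h
  obtain ⟨-, -, h2, h3⟩ := hσ.indep (∑ i, c i • (b i * a i) - α) (∑ i, c i • (b i * σ (a i)) - β)
    (∑ i, c i • (b i * σ (σ (a i)))) (∑ i, c i • (b i * σ (σ (σ (a i))))) fun x => by
      have hx := LinearMap.congr_fun h x
      rw [gabidulinMap_apply, LinearMap.sum_apply] at hx
      rw [sub_mul, sub_mul, ← sub_eq_zero.mpr hx.symm]
      simp only [LinearMap.smul_apply, traceSMulRight_apply]
      simp only [Algebra.smul_def, hσ.trace, Finset.sum_mul, map_mul]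
      rw [sub_add_sub_comm, ← Finset.sum_add_distrib, sub_add_eq_add_sub,
        ← Finset.sum_add_distrib, sub_add_eq_add_sub, ← Finset.sum_add_distrib]
      congr 1
      exact Finset.sum_congr rfl fun i _ => by ring
  ext
  · simpa [Prod.fst_sum] using h2
  · simpa [Prod.snd_sum] using h3

theorem finrank_span_coeff_le (hσ : IsQuarticFrobenius σ) (h4 : finrank K L = 4) {ι : Type*}
    [Fintype ι] {a b : ι → L}
    (h : LinearMap.range (gabidulinMap σ) ≤
      Submodule.span K (Set.range fun i => traceSMulRight K L (a i) (b i))) :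
    finrank K (Submodule.span K
      (Set.range fun i => (b i * σ (σ (a i)), b i * σ (σ (σ (a i)))))) + 8 ≤ Fintype.card ι := by
  have : FiniteDimensional K L := .of_finrank_pos (by omega)
  let f : ι → L →ₗ[K] L := fun i => traceSMulRight K L (a i) (b i)
  let v : ι → L × L := fun i => (b i * σ (σ (a i)), b i * σ (σ (σ (a i))))
  let S := (LinearMap.range (gabidulinMap σ)).comap (Fintype.linearCombination K f)
  have hS : 8 ≤ finrank K S := by
    rw [← hσ.finrank_range_gabidulinMap h4]
    refine le_trans (Submodule.finrank_mono ?_)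
      (Submodule.finrank_map_le (Fintype.linearCombination K f) S)
    rw [Submodule.map_comap_eq, Fintype.range_linearCombination]
    exact le_inf h le_rfl
  have hSker : S ≤ LinearMap.ker (Fintype.linearCombination K v) := fun c hc => by
    rw [LinearMap.mem_ker, Fintype.linearCombination_apply]
    exact hσ.sum_coeff_eq_zero hc
  have hrn := LinearMap.finrank_range_add_finrank_ker (Fintype.linearCombination K v)
  rw [Fintype.range_linearCombination, finrank_fintype_fun_eq_card] at hrn
  have := Submodule.finrank_mono hSker
  change finrank K (Submodule.span K (Set.range v)) + 8 ≤ _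
  omega

theorem eval_normDiff_eq_zero (hσ : IsQuarticFrobenius σ) {a b u₁ w₁ u₂ w₂ : L} {s t : K}
    (hs : s ≠ 0) (h₂ : b * σ (σ a) = s • u₁ + t • w₁)
    (h₃ : b * σ (σ (σ a)) = s • u₂ + t • w₂) :
    (normDiff σ u₁ w₁ u₂ w₂).eval (algebraMap K L (t / s)) = 0 := by
  have hsL : algebraMap K L s ≠ 0 := by simpa using hs
  have h := hσ.norm_mul_eq (σ (σ a)) b
  rw [h₂, h₃] at h
  simp only [map_add, map_smul] at h
  simp only [Algebra.smul_def] at h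
  simp only [normDiff, eval_sub, eval_mul, eval_add, eval_C, eval_X, map_div₀]
  field_simp
  linear_combination h

/-- Ten rank-one maps do not span the code `{x ↦ α x + β σ(x)}`. -/
theorem not_range_gabidulinMap_le (hσ : IsQuarticFrobenius σ) (h4 : finrank K L = 4)
    {a b : Fin 10 → L} (ha : ∀ i, a i ≠ 0) (hb : ∀ i, b i ≠ 0) :
    ¬ LinearMap.range (gabidulinMap σ) ≤
      Submodule.span K (Set.range fun i => traceSMulRight K L (a i) (b i)) := by
  classical
  intro hle
  have : FiniteDimensional K L := .of_finrank_pos (by omega)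
  let f : Fin 10 → L →ₗ[K] L := fun i => traceSMulRight K L (a i) (b i)
  let v : Fin 10 → L × L := fun i => (b i * σ (σ (a i)), b i * σ (σ (σ (a i))))
  have hv1 : ∀ i, (v i).1 ≠ 0 := fun i => mul_ne_zero (hb i) (by simpa using ha i)
  have hv2 : ∀ i, (v i).2 ≠ 0 := fun i => mul_ne_zero (hb i) (by simpa using ha i)
  have hf8 : 8 ≤ finrank K (Submodule.span K (Set.range f)) := by
    rw [← hσ.finrank_range_gabidulinMap h4]
    exact Submodule.finrank_mono hle
  have hvW : finrank K (Submodule.span K (Set.range v)) + 8 ≤ 10 :=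
    hσ.finrank_span_coeff_le h4 hle
  have hprop : ∀ i j, ∀ c : K, v i = c • v j → f i = c • f j := fun i j c h =>
    hσ.traceSMulRight_eq_smul (ha i) (ha j) (hb i) (hb j)
      (congrArg Prod.fst h) (congrArg Prod.snd h)
  obtain ⟨i₁, hi₁⟩ : ∃ i, ∀ c : K, c • v 0 ≠ v i := by
    by_contra! hall
    have := finrank_span_range_le_card_image (K := K) f (fun _ => ()) fun i j _ => by
      obtain ⟨c, hc⟩ := hall i
      obtain ⟨d, hd⟩ := hall j
      have hd0 : d ≠ 0 := by
        rintro rfl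
        apply hv1 j
        rw [← hd, zero_smul, Prod.fst_zero]
      exact ⟨c * d⁻¹, hprop i j _ (by rw [← hc, ← hd, smul_smul, inv_mul_cancel_right₀ hd0])⟩
    have h1 : (Finset.univ.image fun _ : Fin 10 => ()).card ≤ 1 :=
      Finset.card_le_one_of_subsingleton _
    omega
  have hv0 : v 0 ≠ 0 := fun h => hv1 0 (by rw [h, Prod.fst_zero])
  have hli : LinearIndependent K ![v 0, v i₁] := (LinearIndependent.pair_iff' hv0).mpr hi₁
  have hspan : Submodule.span K (Set.range ![v 0, v i₁]) = Submodule.span K (Set.range v) := by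
    refine Submodule.eq_of_le_of_finrank_le (Submodule.span_mono ?_) ?_
    · rintro _ ⟨i, rfl⟩
      fin_cases i
      exacts [⟨0, rfl⟩, ⟨i₁, rfl⟩]
    · rw [finrank_span_eq_card hli, Fintype.card_fin]
      omega
  have hcoord : ∀ i, ∃ s t : K, s • v 0 + t • v i₁ = v i := fun i => by
    have hi : v i ∈ Submodule.span K (Set.range ![v 0, v i₁]) := by
      rw [hspan]
      exact Submodule.subset_span ⟨i, rfl⟩
    rwa [Matrix.range_cons, Matrix.range_cons, Matrix.range_empty, Set.union_empty,
      Set.singleton_union, Submodule.mem_span_pair] at hi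
  choose s t hst using hcoord
  by_cases hP : normDiff σ (v 0).1 (v i₁).1 (v 0).2 (v i₁).2 = 0
  · obtain ⟨j, hj, l, hu, hw⟩ := exists_twist_of_normDiff_eq_zero σ (hv1 i₁) (hv2 i₁) hP
    have := hσ.finrank_span_le_six ha hb 0 (fun i => (congrArg Prod.fst (hst i)).symm) hj
      (l := l) fun i => by
        have h1 : (v i).2 = s i • (v 0).2 + t i • (v i₁).2 := (congrArg Prod.snd (hst i)).symm
        have h2 : (v i).1 = s i • (v 0).1 + t i • (v i₁).1 := (congrArg Prod.fst (hst i)).symm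
        change (v i).2 = l * σ^[j] (v i).1
        rw [h1, h2, hu, hw, ← AlgHom.coe_pow, map_add, map_smul, map_smul, mul_add,
          mul_smul_comm, mul_smul_comm]
    exact absurd (hf8.trans this) (by norm_num)
  · let κ : Fin 10 → Option L := fun i =>
      if s i = 0 then none else some (algebraMap K L (t i / s i))
    have hκ : ∀ i j, κ i = κ j → ∃ c : K, f i = c • f j := fun i j h => by
      by_cases hi : s i = 0 <;> by_cases hj : s j = 0 <;> simp only [κ, hi, hj, if_true, if_false,
        reduceCtorEq, Option.some_inj] at h
      · have htj : t j ≠ 0 := by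
          intro h0
          apply hv1 j
          rw [← hst j, hj, h0, zero_smul, zero_smul, add_zero, Prod.fst_zero]
        refine ⟨t i / t j, hprop i j _ ?_⟩
        rw [← hst i, ← hst j, hi, hj, zero_smul, zero_add, zero_add, smul_smul,
          div_mul_cancel₀ _ htj]
      · have h' := (algebraMap K L).injective h
        refine ⟨s i / s j, hprop i j _ ?_⟩
        rw [← hst i, ← hst j, smul_add, smul_smul, smul_smul, div_mul_cancel₀ _ hj]
        congr 2
        field_simp at h' ⊢
        linear_combination h'
    have hcard := finrank_span_range_le_card_image (K := K) f κ hκ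
    set P := normDiff σ (v 0).1 (v i₁).1 (v 0).2 (v i₁).2 with hPdef
    have hsub : Finset.univ.image κ ⊆ insert none (P.roots.toFinset.image some) := by
      intro y hy
      obtain ⟨i, -, rfl⟩ := Finset.mem_image.mp hy
      by_cases hi : s i = 0
      · simp [κ, hi]
      · refine Finset.mem_insert_of_mem ?_
        simp only [κ, hi, if_false]
        refine Finset.mem_image_of_mem _ ?_
        rw [Multiset.mem_toFinset, mem_roots hP]
        exact hσ.eval_normDiff_eq_zero hi (congrArg Prod.fst (hst i)).symm
          (congrArg Prod.snd (hst i)).symm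
    have h1 := Finset.card_le_card hsub
    have h2 := Finset.card_insert_le none (P.roots.toFinset.image some)
    have h3 : (P.roots.toFinset.image some).card ≤ P.roots.toFinset.card := Finset.card_image_le
    have h5 := P.roots.toFinset_card_le
    have h6 := P.card_roots'
    have h7 : P.natDegree ≤ 4 := natDegree_normDiff_le σ _ _ _ _
    omega

end IsQuarticFrobenius

end Gabidulin

/-- For any `10` rank-one `K`-linear maps of `L`, where `|K| = q` and `|L| = q^4`,
the Gabidulin code `G_{2,1} = {x ↦ a·x + b·x^q}` is not contained in their `K`-span;
hence its tensor rank is at least `11` and `G_{2,1}` is not MTR. -/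
theorem stmt_2 (q : ℕ) (K L : Type*) [Field K] [Field L] [Algebra K L]
    [Fintype K] [Fintype L]
    (hK : Fintype.card K = q) (hL : Fintype.card L = q ^ 4) :
    ∀ f : Fin 10 → (L →ₗ[K] L),
      (∀ i, Module.finrank K (LinearMap.range (f i)) = 1) →
      ¬ (∀ g : L →ₗ[K] L, (∃ a b : L, ∀ x : L, g x = a * x + b * x ^ q) →
          g ∈ Submodule.span K (Set.range f)) := by
  intro f hf hG
  have h4 : finrank K L = 4 := by
    have h := Module.card_eq_pow_finrank (K := K) (V := L)
    rw [hL, hK] at h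
    exact (Nat.pow_right_injective (hK ▸ Fintype.one_lt_card) h).symm
  subst hK
  choose a b ha hb hab using fun i => exists_eq_traceSMulRight (hf i)
  obtain rfl : f = fun i => traceSMulRight K L (a i) (b i) := funext hab
  refine (isQuarticFrobenius_frobeniusAlgHom h4).not_range_gabidulinMap_le h4 ha hb ?_
  rintro _ ⟨⟨α, β⟩, rfl⟩
  exact hG _ ⟨α, β, fun x => rfl⟩
end

section
/- Let K be a finite field with q elements and let L be a field extension of K with q^4 elements. Assume q ≥ 5. Then there exist 11 rank-one K-linear maps f_1, …, f_11 : L → L such that the Gabidulin code G = {x ↦ a·x + b·x^q : a, b ∈ L} is contained in the K-linear span of {f_1, …, f_11}. In particular, the tensor rank of G equals 11. -/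
open Polynomial

section TraceMaps

variable {K L : Type*} [Field K] [Field L] [Algebra K L]

/-- The `K`-linear map `x ↦ Tr(u x) • v`. -/
noncomputable def traceSMul (u v : L) : L →ₗ[K] L :=
  ((Algebra.trace K L).comp (LinearMap.mulLeft K u)).smulRight v

@[simp]
theorem traceSMul_apply (u v x : L) :
    traceSMul (K := K) u v x = Algebra.trace K L (u * x) • v := rfl

theorem finrank_range_traceSMul [FiniteDimensional K L] [Algebra.IsSeparable K L] {u v : L}
    (hu : u ≠ 0) (hv : v ≠ 0) :
    Module.finrank K (LinearMap.range (traceSMul (K := K) u v)) = 1 := by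
  rw [traceSMul, LinearMap.range_smulRight_apply, finrank_span_singleton hv]
  intro h
  obtain ⟨y, hy⟩ := Algebra.trace_surjective K L 1
  have := LinearMap.congr_fun h (u⁻¹ * y)
  simp [hu, hy] at this

theorem exists_traceSMul_eq [FiniteDimensional K L] [Algebra.IsSeparable K L] {f : L →ₗ[K] L}
    (hf : Module.finrank K (LinearMap.range f) = 1) :
    ∃ u v : L, u ≠ 0 ∧ v ≠ 0 ∧ f = traceSMul u v := by
  obtain ⟨⟨v, hv⟩, hv1, h⟩ := finrank_eq_one_iff'.1 hf
  have hv0 : v ≠ 0 := fun h => hv1 (Subtype.ext h)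
  have h' : ∀ x, ∃ c : K, c • v = f x := fun x => by
    obtain ⟨c, hc⟩ := h ⟨f x, x, rfl⟩
    exact ⟨c, congrArg Subtype.val hc⟩
  choose φ hφ using h'
  let ψ : Module.Dual K L :=
    { toFun := φ
      map_add' := fun x y => smul_left_injective K hv0 (by simp [hφ, add_smul])
      map_smul' := fun c x => smul_left_injective K hv0 (by simp [hφ, mul_smul]) }
  obtain ⟨u, hu⟩ := (LinearMap.BilinForm.toDual _ (traceForm_nondegenerate K L)).surjective ψ
  have hux : ∀ x, Algebra.trace K L (u * x) = φ x := fun x => by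
    simpa [LinearMap.BilinForm.toDual_def, Algebra.traceForm_apply, ψ] using
      LinearMap.congr_fun hu x
  have hfe : f = traceSMul u v := by
    ext x
    simp [hux, hφ]
  refine ⟨u, v, ?_, hv0, hfe⟩
  rintro rfl
  obtain ⟨x, hx⟩ := id hv
  exact hv0 (hx.symm.trans (by rw [hfe]; simp))

end TraceMaps

section UpperBound

variable {K L : Type*} [Field K] [Field L] [Algebra K L] (σ : L →ₐ[K] L)

theorem sum_mul_eval_eq_interpolation {ι : Type*} [Fintype ι]
    (htr : ∀ z, algebraMap K L (Algebra.trace K L z) = z + σ z + σ (σ z) + σ (σ (σ z)))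
    (t : ι → K) (ht : Function.Injective t) (c θ : L) :
    ∃ (l : ι → K) (m : K), ∀ F : L[X], F.degree ≤ Fintype.card ι →
      c * F.eval θ + σ c * F.eval (σ θ) + σ (σ c) * F.eval (σ (σ θ))
        + σ (σ (σ c)) * F.eval (σ (σ (σ θ))) =
      F.coeff (Fintype.card ι) * algebraMap K L m +
        ∑ i, F.eval (algebraMap K L (t i)) * algebraMap K L (l i) := by
  classical
  let b : ι → K[X] := fun i => Lagrange.basis Finset.univ t i
  let P : K[X] := Lagrange.nodal Finset.univ t
  refine ⟨fun i => Algebra.trace K L (c * aeval θ (b i)),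
    Algebra.trace K L (c * aeval θ P), fun F hF => ?_⟩
  have hPm : (P.map (algebraMap K L)).Monic := (Lagrange.nodal_monic).map _
  have hPd : (P.map (algebraMap K L)).degree = Fintype.card ι := by
    rw [degree_map, Lagrange.degree_nodal, Finset.card_univ]
  have hFeq : F = C (F.coeff (Fintype.card ι)) * P.map (algebraMap K L) +
      ∑ i, C (F.eval (algebraMap K L (t i))) * (b i).map (algebraMap K L) := by
    rw [← sub_eq_iff_eq_add']
    refine eq_of_degrees_lt_of_eval_index_eq (s := Finset.univ)
      (v := fun i => algebraMap K L (t i))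
      (((algebraMap K L).injective.comp ht).injOn) ?_ ?_ ?_
    · rw [Finset.card_univ]
      rcases hF.lt_or_eq with h | h
      · rw [coeff_eq_zero_of_degree_lt h]
        simpa using h
      · have hF0 : F ≠ 0 := by
          rintro rfl
          simp at h
        have hn : F.natDegree = Fintype.card ι := natDegree_eq_of_degree_eq_some h
        have hl : F.coeff (Fintype.card ι) ≠ 0 := by
          rw [← hn]
          exact leadingCoeff_ne_zero.2 hF0
        rw [← h]
        refine degree_sub_lt_left ?_ hF0 ?_
        · rw [degree_C_mul hl, hPd, h]
        · rw [leadingCoeff_mul, hPm.leadingCoeff, leadingCoeff_C, mul_one, leadingCoeff, hn]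
    · refine (degree_sum_le _ _).trans_lt ?_
      rw [Finset.sup_lt_iff (by simp)]
      intro i _
      rw [← smul_eq_C_mul]
      refine (degree_smul_le _ _).trans_lt ?_
      rw [degree_map, Lagrange.degree_basis ht.injOn (Finset.mem_univ i), Nat.cast_lt]
      exact Nat.sub_lt (Finset.card_pos.2 ⟨i, Finset.mem_univ i⟩) one_pos
    · intro i _
      have h0 : P.eval (t i) = 0 := Lagrange.eval_nodal_at_node (Finset.mem_univ i)
      rw [eval_sub, eval_mul, eval_C, eval_map_apply, h0, eval_finsetSum,
        Finset.sum_eq_single i]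
      · rw [eval_mul, eval_C, eval_map_apply,
          Lagrange.eval_basis_self ht.injOn (Finset.mem_univ i)]
        simp
      · intro j _ hj
        rw [eval_mul, eval_map_apply, Lagrange.eval_basis_of_ne hj (Finset.mem_univ i)]
        simp
      · simp
  have hσ : ∀ (g : K[X]) z, σ (aeval z g) = aeval (σ z) g := fun g z =>
    (aeval_algHom_apply σ z g).symm
  have heval : ∀ z, F.eval z = F.coeff (Fintype.card ι) * aeval z P +
      ∑ i, F.eval (algebraMap K L (t i)) * aeval z (b i) := fun z => by
    conv_lhs => rw [hFeq]
    simp [eval_finsetSum, eval_map_algebraMap]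
  rw [heval θ, heval (σ θ), heval (σ (σ θ)), heval (σ (σ (σ θ)))]
  simp only [htr, map_mul, hσ, mul_add, Finset.mul_sum, Finset.sum_add_distrib]
  simp only [mul_left_comm c, mul_left_comm (σ c), mul_left_comm (σ (σ c)),
    mul_left_comm (σ (σ (σ c)))]
  ring

theorem degree_prod_X_sub_C_five (a b c d e : L) :
    ((X - C a) * (X - C b) * (X - C c) * (X - C d) * (X - C e) : L[X]).degree = 5 := by
  simp only [degree_mul, degree_X_sub_C]
  rfl

theorem coeff_prod_X_sub_C_five (a b c d e : L) :
    ((X - C a) * (X - C b) * (X - C c) * (X - C d) * (X - C e) : L[X]).coeff 5 = 1 := by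
  have hm : ((X - C a) * (X - C b) * (X - C c) * (X - C d) * (X - C e) : L[X]).Monic := by
    simp only [Monic, leadingCoeff_mul, leadingCoeff_X_sub_C, mul_one]
  have hn := natDegree_eq_of_degree_eq_some (degree_prod_X_sub_C_five a b c d e)
  simpa [Monic, leadingCoeff, hn] using hm

/-- The cubic-by-quadratic family of maps `x ↦ Tr(u x) v` with
`u = (t - σ²θ)(t - σ³θ)` and `v = (t - θ)(t - σ²θ)(t - σ³θ)`. -/
noncomputable def quinticMap (θ : L) (t : K) : L →ₗ[K] L :=
  traceSMul ((algebraMap K L t - σ (σ θ)) * (algebraMap K L t - σ (σ (σ θ))))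
    ((algebraMap K L t - θ) * (algebraMap K L t - σ (σ θ)) * (algebraMap K L t - σ (σ (σ θ))))

theorem exists_eq_trace_add_sum_quinticMap
    (h4 : ∀ z, σ (σ (σ (σ z))) = z)
    (htr : ∀ z, algebraMap K L (Algebra.trace K L z) = z + σ z + σ (σ z) + σ (σ (σ z)))
    {θ : L} (hθ : σ (σ θ) ≠ θ) {t : Fin 5 → K} (ht : Function.Injective t) (c : L) :
    ∃ (l : Fin 5 → K) (m : K), ∀ x : L,
      c * ((σ θ - σ (σ θ)) * x + (σ θ - θ) * σ x) =
        m • traceSMul (K := K) 1 1 x + ∑ i, l i • quinticMap σ θ (t i) x := by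
  have hσi : Function.Injective σ := σ.toRingHom.injective
  have h10 : σ θ - θ ≠ 0 := fun h => hθ (by rw [sub_eq_zero.1 h, sub_eq_zero.1 h])
  have h12 : σ θ - σ (σ θ) ≠ 0 := fun h => h10 (by
    rw [sub_eq_zero, hσi.eq_iff] at h
    rw [← h, sub_self])
  have h13 : σ θ - σ (σ (σ θ)) ≠ 0 := fun h => by
    rw [sub_eq_zero, hσi.eq_iff] at h
    exact hθ h.symm
  let κ := (σ θ - θ) * (σ θ - σ (σ θ)) * (σ θ - σ (σ (σ θ))) ^ 2
  have hκ : κ ≠ 0 := mul_ne_zero (mul_ne_zero h10 h12) (pow_ne_zero _ h13)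
  obtain ⟨l, m, h⟩ := sum_mul_eval_eq_interpolation σ htr t ht (σ (σ (σ (c / κ)))) θ
  refine ⟨l, m, fun x => ?_⟩
  let Q : L → L → L → L → L → L[X] := fun a b c d e =>
    (X - C a) * (X - C b) * (X - C c) * (X - C d) * (X - C e)
  let F : L[X] :=
    C x * Q θ (σ (σ θ)) (σ (σ (σ θ))) (σ (σ θ)) (σ (σ (σ θ))) +
    C (σ x) * Q θ (σ (σ θ)) (σ (σ (σ θ))) (σ (σ (σ θ))) θ +
    C (σ (σ x)) * Q θ (σ (σ θ)) (σ (σ (σ θ))) θ (σ θ) +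
    C (σ (σ (σ x))) * Q θ (σ (σ θ)) (σ (σ (σ θ))) (σ θ) (σ (σ θ))
  have hQ : ∀ z a b c d e, (C z * Q a b c d e).degree ≤ 5 := fun z a b c d e => by
    rw [← smul_eq_C_mul]
    exact (degree_smul_le _ _).trans (degree_prod_X_sub_C_five a b c d e).le
  have hF : F.degree ≤ 5 :=
    degree_add_le_of_degree_le (degree_add_le_of_degree_le
      (degree_add_le_of_degree_le (hQ _ _ _ _ _ _) (hQ _ _ _ _ _ _)) (hQ _ _ _ _ _ _))
      (hQ _ _ _ _ _ _)
  have hF5 : F.coeff 5 = algebraMap K L (Algebra.trace K L x) := by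
    simp only [F, Q, coeff_add, coeff_C_mul, coeff_prod_X_sub_C_five, htr, mul_one]
  have hFt : ∀ k : K, F.eval (algebraMap K L k) = quinticMap σ θ k x := fun k => by
    simp only [quinticMap, traceSMul_apply, Algebra.smul_def, htr, F, Q, eval_add, eval_mul,
      eval_C, eval_sub, eval_X, map_mul, map_sub, AlgHom.commutes, h4]
    ring
  have hF0 : F.eval θ = 0 := by simp [F, Q]
  have hF1 : F.eval (σ θ) = κ * ((σ θ - σ (σ θ)) * x + (σ θ - θ) * σ x) := by
    simp only [F, Q, κ, eval_add, eval_mul, eval_C, eval_sub, eval_X]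
    ring
  have hF2 : F.eval (σ (σ θ)) = 0 := by simp [F, Q]
  have hF3 : F.eval (σ (σ (σ θ))) = 0 := by simp [F, Q]
  have key := h F (by simpa using hF)
  simp only [Fintype.card_fin, hF0, hF1, hF2, hF3, hF5, hFt, h4] at key
  simp only [traceSMul_apply, one_mul, Algebra.smul_def, mul_one]
  calc _ = c / κ * (κ * ((σ θ - σ (σ θ)) * x + (σ θ - θ) * σ x)) := by
        field_simp
    _ = _ := by
        rw [mul_comm (algebraMap K L m), ← Finset.sum_congr rfl fun i _ => mul_comm _ _, ← key]
        ring

theorem exists_eleven_rankOne [FiniteDimensional K L] [Algebra.IsSeparable K L]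
    (h4 : ∀ z, σ (σ (σ (σ z))) = z)
    (htr : ∀ z, algebraMap K L (Algebra.trace K L z) = z + σ z + σ (σ z) + σ (σ (σ z)))
    {θ : L} (hθ : σ (σ θ) ≠ θ) {t : Fin 5 → K} (ht : Function.Injective t) (ht0 : t 0 = 0) :
    ∃ f : Fin 11 → (L →ₗ[K] L),
      (∀ i, Module.finrank K (LinearMap.range (f i)) = 1) ∧
      ∀ g : L →ₗ[K] L, (∃ a b : L, ∀ x : L, g x = a * x + b * σ x) →
        g ∈ Submodule.span K (Set.range f) := by
  have hσi : Function.Injective σ := σ.toRingHom.injective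
  have h10 : σ θ - θ ≠ 0 := fun h => hθ (by rw [sub_eq_zero.1 h, sub_eq_zero.1 h])
  have h12 : σ θ - σ (σ θ) ≠ 0 := fun h => h10 (by
    rw [sub_eq_zero, hσi.eq_iff] at h
    rw [← h, sub_self])
  have hθ0 : θ ≠ 0 := fun h => hθ (by simp [h])
  have hne : ∀ z : L, z ≠ 0 → σ z ≠ 0 := fun z hz => (map_ne_zero σ).2 hz
  let γ := σ (σ θ) * σ (σ (σ θ))
  let δ := θ * σ (σ θ) * σ (σ (σ θ))
  have hγ : γ ≠ 0 := mul_ne_zero (hne _ (hne _ hθ0)) (hne _ (hne _ (hne _ hθ0)))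
  have hδ : δ ≠ 0 := mul_ne_zero (mul_ne_zero hθ0 (hne _ (hne _ hθ0))) (hne _ (hne _ (hne _ hθ0)))
  let T : (L →ₗ[K] L) →ₗ[K] (L →ₗ[K] L) :=
    (LinearMap.lcomp K L (LinearMap.mulLeft K γ)).comp
      (LinearMap.compRight K (LinearMap.mulLeft K δ))
  have hT : ∀ (f : L →ₗ[K] L) (x : L), T f x = δ * f (γ * x) := fun f x => rfl
  have hTs : ∀ u v : L, T (traceSMul u v) = traceSMul (γ * u) (δ * v) := fun u v => by
    ext x
    simp [hT, mul_left_comm u, mul_assoc, Algebra.smul_def]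
    ring_nf
  let φ : Option (Fin 5) ⊕ Fin 5 → (L →ₗ[K] L) :=
    Sum.elim (fun o => o.elim (traceSMul 1 1) fun i => quinticMap σ θ (t i))
      fun i => T (quinticMap σ θ (t i))
  have hk : ∀ k : K, ∀ z, σ (σ z) ≠ z → algebraMap K L k - z ≠ 0 := fun k z hz h => hz (by
    rw [← sub_eq_zero.1 h]
    simp)
  have hθ2 : σ (σ (σ (σ θ))) ≠ σ (σ θ) := fun h => hθ (hσi (hσi h))
  have hθ3 : σ (σ (σ (σ (σ θ)))) ≠ σ (σ (σ θ)) := fun h => hθ2 (hσi h)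
  have hφ : ∀ i, Module.finrank K (LinearMap.range (φ i)) = 1 := by
    rintro ((_ | j) | j)
    · exact finrank_range_traceSMul one_ne_zero one_ne_zero
    · exact finrank_range_traceSMul (mul_ne_zero (hk _ _ hθ2) (hk _ _ hθ3))
        (mul_ne_zero (mul_ne_zero (hk _ _ hθ) (hk _ _ hθ2)) (hk _ _ hθ3))
    · change Module.finrank K (LinearMap.range (T (quinticMap σ θ (t j)))) = 1
      rw [quinticMap, hTs]
      exact finrank_range_traceSMul (mul_ne_zero hγ (mul_ne_zero (hk _ _ hθ2) (hk _ _ hθ3)))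
        (mul_ne_zero hδ (mul_ne_zero (mul_ne_zero (hk _ _ hθ) (hk _ _ hθ2)) (hk _ _ hθ3)))
  suffices h : ∀ g : L →ₗ[K] L, (∃ a b : L, ∀ x : L, g x = a * x + b * σ x) →
      g ∈ Submodule.span K (Set.range φ) by
    have e : Fin 11 ≃ Option (Fin 5) ⊕ Fin 5 := (Fintype.equivFinOfCardEq (by simp)).symm
    refine ⟨φ ∘ e, fun i => hφ _, ?_⟩
    rwa [e.surjective.range_comp φ]
  rintro g ⟨a, b, hg⟩
  set S := Submodule.span K (Set.range φ)
  have m1 : traceSMul 1 1 ∈ S := Submodule.subset_span ⟨Sum.inl none, rfl⟩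
  have m2 : ∀ i, quinticMap σ θ (t i) ∈ S := fun i =>
    Submodule.subset_span ⟨Sum.inl (some i), rfl⟩
  have m3 : ∀ i, T (quinticMap σ θ (t i)) ∈ S := fun i =>
    Submodule.subset_span ⟨Sum.inr i, rfl⟩
  have m4 : T (traceSMul 1 1) ∈ S := by
    have : T (traceSMul 1 1) = - quinticMap σ θ (t 0) := by
      ext x
      simp [quinticMap, ht0, hTs, γ, δ]
    rw [this]
    exact neg_mem (m2 0)
  have hγσ : γ - σ γ ≠ 0 := by
    have : γ - σ γ = σ (σ (σ θ)) * (σ (σ θ) - θ) := by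
      simp only [γ, map_mul, h4]
      ring
    rw [this]
    exact mul_ne_zero (hne _ (hne _ (hne _ hθ0))) (sub_ne_zero.2 hθ)
  let d := (a / (σ θ - σ (σ θ)) - b / (σ θ - θ)) / (δ * (γ - σ γ))
  obtain ⟨l, m, h⟩ := exists_eq_trace_add_sum_quinticMap σ h4 htr hθ ht
    (a / (σ θ - σ (σ θ)) - δ * γ * d)
  obtain ⟨l', m', h'⟩ := exists_eq_trace_add_sum_quinticMap σ h4 htr hθ ht d
  have hgeq : g = (m • traceSMul 1 1 + ∑ i, l i • quinticMap σ θ (t i)) +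
      (m' • T (traceSMul 1 1) + ∑ i, l' i • T (quinticMap σ θ (t i))) := by
    have hT' : m' • T (traceSMul 1 1) + ∑ i, l' i • T (quinticMap σ θ (t i)) =
        T (m' • traceSMul 1 1 + ∑ i, l' i • quinticMap σ θ (t i)) := by
      simp only [map_add, map_sum, map_smul]
    rw [hT']
    ext x
    rw [LinearMap.add_apply, hT]
    simp only [LinearMap.add_apply, LinearMap.sum_apply, LinearMap.smul_apply, ← h, ← h', hg,
      map_mul]
    simp only [d]
    field_simp
    ring
  rw [hgeq]
  exact add_mem
    (add_mem (S.smul_mem _ m1) (sum_mem fun i _ => S.smul_mem _ (m2 i)))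
    (add_mem (S.smul_mem _ m4) (sum_mem fun i _ => S.smul_mem _ (m3 i)))

end UpperBound

section LowerBound

variable {K L : Type*} [Field K] [Field L] [Algebra K L] (σ : L →ₐ[K] L)

/-- The coefficients of `x ↦ Tr(u x) v` as a `σ`-polynomial. -/
def coeffVec (u v : L) : (L × L) × (L × L) :=
  ((v * u, v * σ u), (v * σ (σ u), v * σ (σ (σ u))))

theorem coeffVec_mem_span_singleton (hfix : ∀ z, σ z = z → ∃ k : K, algebraMap K L k = z)
    {u v u' v' : L} (hu : u ≠ 0) (hv : v ≠ 0) (hu' : u' ≠ 0) (hv' : v' ≠ 0) (k : K)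
    (h₂ : v * σ (σ u) = algebraMap K L k * (v' * σ (σ u')))
    (h₃ : v * σ (σ (σ u)) = algebraMap K L k * (v' * σ (σ (σ u')))) :
    coeffVec σ u v ∈ Submodule.span K {coeffVec σ u' v'} := by
  have hσi : Function.Injective σ := σ.toRingHom.injective
  have hne : ∀ z : L, z ≠ 0 → σ z ≠ 0 := fun z hz => (map_ne_zero σ).2 hz
  have hr : σ (u / u') = u / u' := by
    apply hσi
    apply hσi
    simp only [map_div₀]
    rw [div_eq_div_iff (hne _ (hne _ (hne _ hu'))) (hne _ (hne _ hu'))]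
    have hk : algebraMap K L k ≠ 0 := fun h0 => by
      rw [h0, zero_mul] at h₂
      exact mul_ne_zero hv (hne _ (hne _ hu)) h₂
    apply mul_left_cancel₀ (mul_ne_zero hv (mul_ne_zero hk hv'))
    linear_combination (algebraMap K L k * v' * σ (σ u')) * h₃ -
      (algebraMap K L k * v' * σ (σ (σ u'))) * h₂
  obtain ⟨r, hr'⟩ := hfix _ hr
  have hur : u = algebraMap K L r * u' := by
    rw [hr']
    field_simp
  have hvr : v * algebraMap K L r = algebraMap K L k * v' := by
    apply mul_right_cancel₀ (hne _ (hne _ hu'))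
    rw [hur] at h₂
    simp only [map_mul, AlgHom.commutes] at h₂
    linear_combination h₂
  refine Submodule.mem_span_singleton.2 ⟨k, ?_⟩
  ext <;> simp only [coeffVec, Prod.smul_fst, Prod.smul_snd] <;>
    simp only [Algebra.smul_def, hur, map_mul, AlgHom.commutes, ← mul_assoc, hvr]

theorem eight_add_finrank_map_snd_le [FiniteDimensional K L] (hdim : Module.finrank K L = 4)
    (V : Submodule K ((L × L) × (L × L))) (hV : ∀ a : L × L, (a, 0) ∈ V) :
    8 + Module.finrank K (V.map (LinearMap.snd K (L × L) (L × L))) ≤ Module.finrank K V := by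
  let W := V.map (LinearMap.snd K (L × L) (L × L))
  let j : ((L × L) × W) →ₗ[K] ((L × L) × (L × L)) := LinearMap.prodMap LinearMap.id W.subtype
  have hj : Function.Injective j := Function.injective_id.prodMap W.injective_subtype
  have hle : LinearMap.range j ≤ V := by
    rintro _ ⟨⟨a, ⟨w, hw⟩⟩, rfl⟩
    obtain ⟨⟨a', w'⟩, h', rfl⟩ := hw
    have := V.add_mem h' (hV (a - a'))
    simpa [j] using this
  have := Submodule.finrank_mono hle
  rw [LinearMap.finrank_range_of_inj hj, Module.finrank_prod, Module.finrank_prod, hdim] at this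
  exact this

/-- Evaluate four polynomials at a common point. -/
def evalVec (F : Fin 4 → L[X]) (x : L) : (L × L) × (L × L) :=
  (((F 0).eval x, (F 1).eval x), ((F 2).eval x, (F 3).eval x))

theorem finrank_span_le_seven {ι : Type*} (m : ι → (L × L) × (L × L)) (w : (L × L) × (L × L))
    (F : Fin 4 → L[X]) (hF : ∀ j, (F j).natDegree ≤ 5)
    (h : ∀ i, m i ∈ Submodule.span K {w} ∨
      ∃ x : K, m i ∈ Submodule.span K {evalVec F (algebraMap K L x)}) :
    Module.finrank K (Submodule.span K (Set.range m)) ≤ 7 := by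
  let e : Option (Fin 6) → (L × L) × (L × L) := fun o => o.elim w fun n =>
    (((F 0).coeff n, (F 1).coeff n), ((F 2).coeff n, (F 3).coeff n))
  have hc := finrank_range_le_card (R := K) e
  simp only [Fintype.card_option, Fintype.card_fin] at hc
  have hfin : FiniteDimensional K (Submodule.span K (Set.range e)) :=
    FiniteDimensional.span_of_finite K (Set.finite_range e)
  refine (Submodule.finrank_mono (Submodule.span_le.2 ?_)).trans hc
  rintro _ ⟨i, rfl⟩
  have hw : w ∈ Submodule.span K (Set.range e) := Submodule.subset_span ⟨none, rfl⟩
  rcases h i with h | ⟨x, h⟩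
  · exact (Submodule.span_singleton_le_iff_mem _ _).2 hw h
  · refine (Submodule.span_singleton_le_iff_mem _ _).2 ?_ h
    have hx : evalVec F (algebraMap K L x) = ∑ n : Fin 6, x ^ (n : ℕ) • e (some n) := by
      have hev : ∀ j, (F j).eval (algebraMap K L x) =
          ∑ n : Fin 6, x ^ (n : ℕ) • (F j).coeff n := fun j => by
        rw [eval_eq_sum_range' (Nat.lt_succ_of_le (hF j)), Finset.sum_range]
        simp [Algebra.smul_def, mul_comm]
      simp only [evalVec, hev, e, Option.elim]
      ext <;> simp [Prod.fst_sum, Prod.snd_sum]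
    rw [hx]
    exact sum_mem fun n _ => Submodule.smul_mem _ _ (Submodule.subset_span ⟨some n, rfl⟩)

theorem natDegree_prod_X_add_C_five_le (a b c d e : L) :
    ((X + C a) * (X + C b) * (X + C c) * (X + C d) * (X + C e) : L[X]).natDegree ≤ 5 := by
  compute_degree

theorem exists_evalVec_eq_coeffVec (h4 : ∀ z, σ (σ (σ (σ z))) = z)
    (hfix : ∀ z, σ z = z → ∃ k : K, algebraMap K L k = z) (β δ : L)
    (h : δ = β ∨ δ = σ β ∨ δ = σ (σ β) ∨ δ = σ (σ (σ β))) :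
    ∃ F : Fin 4 → L[X], (∀ j, (F j).natDegree ≤ 5) ∧
      ∀ x : K, algebraMap K L x + β ≠ 0 → ∃ (u v : L) (k : K), u ≠ 0 ∧ v ≠ 0 ∧ k ≠ 0 ∧
        evalVec F (algebraMap K L x) = coeffVec σ u v ∧
        v * σ (σ u) = algebraMap K L k * (algebraMap K L x + β) ∧
        v * σ (σ (σ u)) = algebraMap K L k * (algebraMap K L x + δ) := by
  have hne : ∀ z : L, z ≠ 0 → σ z ≠ 0 := fun z hz => (map_ne_zero σ).2 hz
  have hN : ∀ z, z ≠ 0 → ∃ k : K, k ≠ 0 ∧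
      algebraMap K L k = z * σ z * σ (σ z) * σ (σ (σ z)) := fun z hz => by
    obtain ⟨k, hk⟩ := hfix (z * σ z * σ (σ z) * σ (σ (σ z))) (by
      simp only [map_mul, h4]
      ring)
    refine ⟨k, ?_, hk⟩
    rintro rfl
    rw [map_zero] at hk
    exact mul_ne_zero (mul_ne_zero (mul_ne_zero hz (hne _ hz)) (hne _ (hne _ hz)))
      (hne _ (hne _ (hne _ hz))) hk.symm
  have h1 : ∀ z : L, (X + C z).natDegree ≤ 5 := fun z =>
    (natDegree_X_add_C z).le.trans (by norm_num)
  rcases h with h | h | h | h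
  · refine ⟨![X + C β, X + C β, X + C β, X + C β], ?_, fun x hx => ?_⟩
    · intro j
      fin_cases j <;> exact h1 _
    · refine ⟨1, algebraMap K L x + β, 1, one_ne_zero, hx, one_ne_zero, ?_, ?_, ?_⟩
      · simp [evalVec, coeffVec]
      · simp
      · simp [h]
  · refine ⟨![X + C (σ (σ β)), X + C (σ (σ (σ β))), X + C β, X + C (σ β)], ?_, fun x hx => ?_⟩
    · intro j
      fin_cases j <;> exact h1 _
    · refine ⟨σ (σ (algebraMap K L x + β)), 1, 1, hne _ (hne _ hx), one_ne_zero, one_ne_zero,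
        ?_, ?_, ?_⟩
      · simp [evalVec, coeffVec, h4]
      · simp [h4]
      · simp [h, h4]
  · refine ⟨![(X + C β) * (X + C (σ (σ β))) * (X + C (σ (σ (σ β)))) *
          (X + C (σ (σ β))) * (X + C (σ (σ (σ β)))),
        (X + C β) * (X + C (σ (σ β))) * (X + C (σ (σ (σ β)))) * (X + C (σ (σ (σ β)))) * (X + C β),
        (X + C β) * (X + C (σ (σ β))) * (X + C (σ (σ (σ β)))) * (X + C β) * (X + C (σ β)),
        (X + C β) * (X + C (σ (σ β))) * (X + C (σ (σ (σ β)))) * (X + C (σ β)) *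
          (X + C (σ (σ β)))], ?_, fun x hx => ?_⟩
    · intro j
      fin_cases j <;> exact natDegree_prod_X_add_C_five_le _ _ _ _ _
    · obtain ⟨k, hk0, hk⟩ := hN _ hx
      refine ⟨σ (σ (algebraMap K L x + β)) * σ (σ (σ (algebraMap K L x + β))),
        (algebraMap K L x + β) * σ (σ (algebraMap K L x + β)) *
          σ (σ (σ (algebraMap K L x + β))), k,
        mul_ne_zero (hne _ (hne _ hx)) (hne _ (hne _ (hne _ hx))),
        mul_ne_zero (mul_ne_zero hx (hne _ (hne _ hx))) (hne _ (hne _ (hne _ hx))),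
        hk0, ?_, ?_, ?_⟩
      · simp [evalVec, coeffVec, h4, mul_assoc]
      · rw [hk]
        simp only [map_mul, h4]
        ring
      · rw [hk, h]
        simp only [map_mul, map_add, AlgHom.commutes, h4]
        ring
  · refine ⟨![(X + C β) * (X + C (σ (σ (σ β)))) * (X + C β) * (X + C (σ (σ β))) *
          (X + C (σ (σ (σ β)))),
        (X + C β) * (X + C (σ (σ (σ β)))) * (X + C (σ β)) * (X + C (σ (σ (σ β)))) * (X + C β),
        (X + C β) * (X + C (σ (σ (σ β)))) * (X + C (σ (σ β))) * (X + C β) * (X + C (σ β)),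
        (X + C β) * (X + C (σ (σ (σ β)))) * (X + C (σ (σ (σ β)))) * (X + C (σ β)) *
          (X + C (σ (σ β)))], ?_, fun x hx => ?_⟩
    · intro j
      fin_cases j <;> exact natDegree_prod_X_add_C_five_le _ _ _ _ _
    · obtain ⟨k, hk0, hk⟩ := hN _ hx
      refine ⟨(algebraMap K L x + β) * σ (σ (algebraMap K L x + β)) *
          σ (σ (σ (algebraMap K L x + β))),
        (algebraMap K L x + β) * σ (σ (σ (algebraMap K L x + β))), k,
        mul_ne_zero (mul_ne_zero hx (hne _ (hne _ hx))) (hne _ (hne _ (hne _ hx))),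
        mul_ne_zero hx (hne _ (hne _ (hne _ hx))), hk0, ?_, ?_, ?_⟩
      · simp [evalVec, coeffVec, h4, mul_assoc]
      · rw [hk]
        simp only [map_mul, h4]
        ring
      · rw [hk, h]
        simp only [map_mul, map_add, AlgHom.commutes, h4]
        ring

theorem eleven_le_finrank_span_of_normalized [FiniteDimensional K L]
    (hdim : Module.finrank K L = 4) (h4 : ∀ z, σ (σ (σ (σ z))) = z)
    (hfix : ∀ z, σ z = z → ∃ k : K, algebraMap K L k = z)
    {ι : Type*} (u v : ι → L) (hu : ∀ i, u i ≠ 0) (hv : ∀ i, v i ≠ 0)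
    (i₀ : ι) (hu₀ : u i₀ = 1) (hv₀ : v i₀ = 1)
    (hV : ∀ a : L × L, (a, 0) ∈ Submodule.span K (Set.range fun i => coeffVec σ (u i) (v i))) :
    11 ≤ Module.finrank K (Submodule.span K (Set.range fun i => coeffVec σ (u i) (v i))) := by
  classical
  set m : ι → (L × L) × (L × L) := fun i => coeffVec σ (u i) (v i)
  set V := Submodule.span K (Set.range m)
  set W := V.map (LinearMap.snd K (L × L) (L × L)) with hW
  have h8 := eight_add_finrank_map_snd_le hdim V hV
  by_contra! hlt
  suffices h7 : Module.finrank K V ≤ 7 by omega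
  have hW2 : Module.finrank K W ≤ 2 := by
    rw [← hW] at h8
    omega
  have hne : ∀ z : L, z ≠ 0 → σ z ≠ 0 := fun z hz => (map_ne_zero σ).2 hz
  have hmW : ∀ i, (m i).2 ∈ W := fun i => ⟨m i, Submodule.subset_span ⟨i, rfl⟩, rfl⟩
  have hone : ∀ i (s : K), (m i).2 = s • (1, 1) →
      m i ∈ Submodule.span K {coeffVec σ (1 : L) 1} := fun i s h => by
    have h₁ := congrArg Prod.fst h
    have h₂ := congrArg Prod.snd h
    refine coeffVec_mem_span_singleton σ hfix (hu i) (hv i) one_ne_zero one_ne_zero s ?_ ?_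
    · simpa [m, coeffVec, Algebra.smul_def] using h₁
    · simpa [m, coeffVec, Algebra.smul_def] using h₂
  by_cases hA : ∀ i, ∃ s : K, (m i).2 = s • (1, 1)
  · refine finrank_span_le_seven m (coeffVec σ 1 1) 0 (by simp) fun i => ?_
    obtain ⟨s, hs⟩ := hA i
    exact Or.inl (hone i s hs)
  push Not at hA
  obtain ⟨i₁, hi₁⟩ := hA
  obtain ⟨β, δ, hβδ⟩ : ∃ β δ : L, (m i₁).2 = (β, δ) := ⟨_, _, rfl⟩
  have h11 : ((1 : L), (1 : L)) ∈ W := by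
    have := hmW i₀
    simpa [m, coeffVec, hu₀, hv₀] using this
  have hli : LinearIndependent K ![((1 : L), (1 : L)), (β, δ)] := by
    rw [LinearIndependent.pair_iff' (by simp)]
    intro a ha
    exact hi₁ a (by rw [hβδ, ha])
  have hspan : Submodule.span K {((1 : L), (1 : L)), (β, δ)} = W := by
    refine Submodule.eq_of_le_of_finrank_le (Submodule.span_le.2 ?_) ?_
    · rintro _ (rfl | rfl)
      · exact h11
      · exact hβδ ▸ hmW i₁
    · have := finrank_span_eq_card hli
      rw [Matrix.range_cons, Matrix.range_cons, Matrix.range_empty, Set.union_empty,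
        Set.singleton_union, Fintype.card_fin] at this
      rw [this]
      exact hW2
  -- every coefficient vector is either proportional to the normalised one or has a parameter `x`
  have hcase : ∀ i, m i ∈ Submodule.span K {coeffVec σ (1 : L) 1} ∨ ∃ s x : K, s ≠ 0 ∧
      v i * σ (σ (u i)) = algebraMap K L s * (algebraMap K L x + β) ∧
      v i * σ (σ (σ (u i))) = algebraMap K L s * (algebraMap K L x + δ) := fun i => by
    have := hmW i
    rw [← hspan, Submodule.mem_span_pair] at this
    obtain ⟨s, t, hst⟩ := this
    by_cases ht : t = 0
    · left
      apply hone i s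
      rw [← hst, ht, zero_smul, add_zero]
    · right
      have ht' : algebraMap K L t ≠ 0 := by simpa using ht
      have h₁ := congrArg Prod.fst hst
      have h₂ := congrArg Prod.snd hst
      simp only [m, coeffVec, Prod.fst_add, Prod.snd_add, Prod.smul_fst, Prod.smul_snd] at h₁ h₂
      simp only [Algebra.smul_def, mul_one] at h₁ h₂
      refine ⟨t, s / t, ht, ?_, ?_⟩
      · rw [← h₁, map_div₀]
        field_simp
      · rw [← h₂, map_div₀]
        field_simp
  let N : L → L := fun z => z * σ z * σ (σ z) * σ (σ (σ z))
  let D : L[X] :=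
    (X + C β) * (X + C (σ β)) * (X + C (σ (σ β))) * (X + C (σ (σ (σ β)))) -
      (X + C δ) * (X + C (σ δ)) * (X + C (σ (σ δ))) * (X + C (σ (σ (σ δ))))
  have hroot : ∀ i (s x : K), s ≠ 0 →
      v i * σ (σ (u i)) = algebraMap K L s * (algebraMap K L x + β) →
      v i * σ (σ (σ (u i))) = algebraMap K L s * (algebraMap K L x + δ) →
      D.eval (algebraMap K L x) = 0 := fun i s x hs h₁ h₂ => by
    have hs' : algebraMap K L s ≠ 0 := by simpa using hs
    have e₁ : N (v i * σ (σ (u i))) = N (v i * σ (σ (σ (u i)))) := by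
      simp only [N, map_mul, h4]
      ring
    rw [h₁, h₂] at e₁
    simp only [N, map_mul, map_add, AlgHom.commutes] at e₁
    simp only [D, eval_sub, eval_mul, eval_add, eval_X, eval_C]
    apply mul_left_cancel₀ (pow_ne_zero 4 hs')
    linear_combination e₁
  by_cases hD : D = 0
  · have hz : ∀ i (s x : K),
        v i * σ (σ (u i)) = algebraMap K L s * (algebraMap K L x + β) →
        algebraMap K L x + β ≠ 0 := fun i s x h₁ h0 => by
      rw [h0, mul_zero] at h₁
      exact mul_ne_zero (hv i) (hne _ (hne _ (hu i))) h₁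
    have hfam : ∀ (F : Fin 4 → L[X]), (∀ j, (F j).natDegree ≤ 5) →
        (∀ x : K, algebraMap K L x + β ≠ 0 → ∃ (u' v' : L) (k : K), u' ≠ 0 ∧ v' ≠ 0 ∧ k ≠ 0 ∧
          evalVec F (algebraMap K L x) = coeffVec σ u' v' ∧
          v' * σ (σ u') = algebraMap K L k * (algebraMap K L x + β) ∧
          v' * σ (σ (σ u')) = algebraMap K L k * (algebraMap K L x + δ)) →
        Module.finrank K V ≤ 7 := fun F hF hx => by
      refine finrank_span_le_seven m (coeffVec σ 1 1) F hF fun i => (hcase i).imp_right ?_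
      rintro ⟨s, x, -, h₁, h₂⟩
      obtain ⟨u', v', k, hu', hv', hk, he, h₁', h₂'⟩ := hx x (hz i s x h₁)
      refine ⟨x, ?_⟩
      rw [he]
      have hk' : algebraMap K L k ≠ 0 := by simpa using hk
      refine coeffVec_mem_span_singleton σ hfix (hu i) (hv i) hu' hv' (s / k) ?_ ?_
      · rw [h₁, h₁', map_div₀]
        field_simp
      · rw [h₂, h₂', map_div₀]
        field_simp
    have hβ := congrArg (eval (-β)) hD
    simp only [D, eval_sub, eval_mul, eval_add, eval_X, eval_C, eval_zero, neg_add_cancel,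
      zero_mul, zero_sub, neg_eq_zero, mul_eq_zero, neg_add_eq_zero] at hβ
    have hδ : δ = β ∨ δ = σ β ∨ δ = σ (σ β) ∨ δ = σ (σ (σ β)) := by
      rcases hβ with ((hβ | hβ) | hβ) | hβ <;> simp [hβ, h4]
    obtain ⟨F, hF, hF'⟩ := exists_evalVec_eq_coeffVec σ h4 hfix β δ hδ
    exact hfam F hF hF'
  · let g : L → (L × L) × (L × L) := fun r =>
      if h : ∃ i, ∃ s x : K, s ≠ 0 ∧ v i * σ (σ (u i)) = algebraMap K L s * (r + β) ∧
        v i * σ (σ (σ (u i))) = algebraMap K L s * (r + δ) then m h.choose else 0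
    let S : Finset ((L × L) × (L × L)) :=
      insert (coeffVec σ (1 : L) 1) (D.roots.toFinset.image g)
    have hS : S.card ≤ 5 := by
      refine (Finset.card_insert_le _ _).trans (Nat.succ_le_succ (Finset.card_image_le.trans
        ((Multiset.toFinset_card_le _).trans ((card_roots' D).trans ?_))))
      simp only [D]
      compute_degree
    have hS' : Module.finrank K (Submodule.span K (S : Set ((L × L) × (L × L)))) ≤ S.card :=
      finrank_span_finset_le_card S
    suffices hVS : V ≤ Submodule.span K (S : Set ((L × L) × (L × L))) by
      have := Submodule.finrank_mono hVS
      omega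
    refine Submodule.span_le.2 ?_
    rintro _ ⟨i, rfl⟩
    rcases hcase i with h | ⟨s, x, hs, h₁, h₂⟩
    · exact Submodule.span_mono (by simp [S]) h
    · have hr := hroot i s x hs h₁ h₂
      have hex : ∃ i, ∃ s x' : K, s ≠ 0 ∧
          v i * σ (σ (u i)) = algebraMap K L s * (algebraMap K L x + β) ∧
          v i * σ (σ (σ (u i))) = algebraMap K L s * (algebraMap K L x + δ) :=
        ⟨i, s, x, hs, h₁, h₂⟩
      have hg : g (algebraMap K L x) = m hex.choose := dif_pos hex
      obtain ⟨s', -, hs', h₁', h₂'⟩ := hex.choose_spec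
      have hs'' : algebraMap K L s' ≠ 0 := by simpa using hs'
      have hmem : m i ∈ Submodule.span K {g (algebraMap K L x)} := by
        rw [hg]
        refine coeffVec_mem_span_singleton σ hfix (hu i) (hv i) (hu _) (hv _) (s / s') ?_ ?_
        · rw [h₁, h₁', map_div₀]
          field_simp
        · rw [h₂, h₂', map_div₀]
          field_simp
      refine Submodule.span_mono ?_ hmem
      rw [Set.singleton_subset_iff]
      refine Finset.mem_coe.2 (Finset.mem_insert_of_mem (Finset.mem_image_of_mem g ?_))
      rw [Multiset.mem_toFinset, mem_roots hD]
      exact hr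

theorem eleven_le_finrank_span [FiniteDimensional K L]
    (hdim : Module.finrank K L = 4) (h4 : ∀ z, σ (σ (σ (σ z))) = z)
    (hfix : ∀ z, σ z = z → ∃ k : K, algebraMap K L k = z)
    {ι : Type*} (u v : ι → L) (hu : ∀ i, u i ≠ 0) (hv : ∀ i, v i ≠ 0)
    (hV : ∀ a : L × L, (a, 0) ∈ Submodule.span K (Set.range fun i => coeffVec σ (u i) (v i))) :
    11 ≤ Module.finrank K (Submodule.span K (Set.range fun i => coeffVec σ (u i) (v i))) := by
  have hne : ∀ z : L, z ≠ 0 → σ z ≠ 0 := fun z hz => (map_ne_zero σ).2 hz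
  rcases isEmpty_or_nonempty ι with hι | ⟨⟨i₀⟩⟩
  · have := hV (1, 1)
    rw [Set.range_eq_empty, Submodule.span_empty, Submodule.mem_bot] at this
    simpa using congrArg (fun w => w.1.1) this
  let p := fun w : L => LinearMap.mulLeft K ((v i₀)⁻¹ * w⁻¹)
  let s : ((L × L) × (L × L)) →ₗ[K] ((L × L) × (L × L)) :=
    ((p (u i₀)).prodMap (p (σ (u i₀)))).prodMap
      ((p (σ (σ (u i₀)))).prodMap (p (σ (σ (σ (u i₀))))))
  have hs : ∀ i, s (coeffVec σ (u i) (v i)) = coeffVec σ (u i / u i₀) (v i / v i₀) := fun i => by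
    simp only [s, p, coeffVec, LinearMap.prodMap_apply, LinearMap.mulLeft_apply, map_div₀]
    ext <;> simp only [div_eq_mul_inv] <;> ring
  have hmap : (Submodule.span K (Set.range fun i => coeffVec σ (u i) (v i))).map s =
      Submodule.span K (Set.range fun i => coeffVec σ (u i / u i₀) (v i / v i₀)) := by
    rw [Submodule.map_span, ← Set.range_comp]
    congr 2
    funext i
    exact hs i
  refine le_trans ?_ (Submodule.finrank_map_le s _)
  rw [hmap]
  refine eleven_le_finrank_span_of_normalized σ hdim h4 hfix _ _
    (fun i => div_ne_zero (hu i) (hu i₀)) (fun i => div_ne_zero (hv i) (hv i₀)) i₀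
    (div_self (hu i₀)) (div_self (hv i₀)) fun a => ?_
  rw [← hmap]
  refine ⟨((v i₀ * u i₀ * a.1, v i₀ * σ (u i₀) * a.2), 0), hV _, ?_⟩
  have h0 := hu i₀
  have h1 := hne _ (hu i₀)
  have h2 := hv i₀
  simp only [s, p, LinearMap.prodMap_apply, LinearMap.mulLeft_apply, map_zero]
  ext <;> simp only <;> field_simp

/-- The linear map given by a `σ`-polynomial of degree at most three. -/
noncomputable def skewEval : ((L × L) × (L × L)) →ₗ[K] (L →ₗ[K] L) where
  toFun w := LinearMap.mulLeft K w.1.1 + (LinearMap.mulLeft K w.1.2).comp σ.toLinearMap +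
    (LinearMap.mulLeft K w.2.1).comp (σ.comp σ).toLinearMap +
    (LinearMap.mulLeft K w.2.2).comp (σ.comp (σ.comp σ)).toLinearMap
  map_add' w w' := by
    ext x
    simp [add_mul]
    ring
  map_smul' k w := by
    ext x
    simp [smul_add]

theorem skewEval_apply (w : (L × L) × (L × L)) (x : L) :
    skewEval σ w x = w.1.1 * x + w.1.2 * σ x + w.2.1 * σ (σ x) + w.2.2 * σ (σ (σ x)) := rfl

theorem skewEval_injective (h4 : ∀ z, σ (σ (σ (σ z))) = z) {θ : L} (hθ : σ (σ θ) ≠ θ) :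
    Function.Injective (skewEval (K := K) σ) := by
  have hσi : Function.Injective σ := σ.toRingHom.injective
  have h1 : σ θ ≠ θ := fun h => hθ (by rw [h, h])
  let s : Fin 4 → (L →ₐ[K] L) := ![AlgHom.id K L, σ, σ.comp σ, σ.comp (σ.comp σ)]
  have hθ3 : σ (σ (σ θ)) ≠ θ := fun h => h1 (by
    have := congrArg σ h
    rw [h4] at this
    exact this.symm)
  have hs : Function.Injective s := by
    intro i j hij
    have := DFunLike.congr_fun hij θ
    fin_cases i <;> fin_cases j <;> simp [s, hσi.eq_iff] at this ⊢ <;>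
      first
      | exact h1 this | exact h1 this.symm | exact hθ this | exact hθ this.symm
      | exact hθ3 this | exact hθ3 this.symm
  have hli := (linearIndependent_toLinearMap K L L).comp s hs
  rw [injective_iff_map_eq_zero]
  intro w hw
  rw [Fintype.linearIndependent_iff] at hli
  have := hli ![w.1.1, w.1.2, w.2.1, w.2.2] (by
    ext x
    have := LinearMap.congr_fun hw x
    rw [skewEval_apply] at this
    simpa [Fin.sum_univ_four, s] using this)
  ext
  · exact this 0
  · exact this 1
  · exact this 2
  · exact this 3

theorem skewEval_coeffVec
    (htr : ∀ z, algebraMap K L (Algebra.trace K L z) = z + σ z + σ (σ z) + σ (σ (σ z)))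
    (u v : L) : skewEval (K := K) σ (coeffVec σ u v) = traceSMul u v := by
  ext x
  rw [skewEval_apply, traceSMul_apply, Algebra.smul_def, htr]
  simp only [coeffVec, map_mul]
  ring

theorem eleven_le_of_span_rankOne [FiniteDimensional K L] [Algebra.IsSeparable K L]
    (hdim : Module.finrank K L = 4) (h4 : ∀ z, σ (σ (σ (σ z))) = z)
    (hfix : ∀ z, σ z = z → ∃ k : K, algebraMap K L k = z)
    (htr : ∀ z, algebraMap K L (Algebra.trace K L z) = z + σ z + σ (σ z) + σ (σ (σ z)))
    {θ : L} (hθ : σ (σ θ) ≠ θ) {R : ℕ} (f : Fin R → (L →ₗ[K] L))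
    (hf : ∀ i, Module.finrank K (LinearMap.range (f i)) = 1)
    (hG : ∀ g : L →ₗ[K] L, (∃ a b : L, ∀ x : L, g x = a * x + b * σ x) →
      g ∈ Submodule.span K (Set.range f)) : 11 ≤ R := by
  choose u v hu hv hfuv using fun i => exists_traceSMul_eq (hf i)
  have hspan : Submodule.span K (Set.range f) =
      (Submodule.span K (Set.range fun i => coeffVec σ (u i) (v i))).map (skewEval σ) := by
    rw [Submodule.map_span, ← Set.range_comp]
    congr 2
    funext i
    rw [hfuv i, Function.comp_apply, skewEval_coeffVec σ htr]
  have h := eleven_le_finrank_span σ hdim h4 hfix u v hu hv fun a => by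
    have := hG (skewEval σ (a, 0)) ⟨a.1, a.2, fun x => by simp [skewEval_apply]⟩
    rw [hspan] at this
    obtain ⟨w, hw, he⟩ := this
    rwa [← skewEval_injective σ h4 hθ he]
  exact h.trans ((finrank_range_le_card _).trans (Fintype.card_fin R).le)

end LowerBound


/-- For `|K| = q ≥ 5` and `|L| = q^4` there exist `11` rank-one `K`-linear maps of `L`
whose `K`-span contains the Gabidulin code `G_{2,1} = {x ↦ a·x + b·x^q}`.
In particular, the tensor rank of `G_{2,1}` equals `11`. -/
theorem stmt_3 (q : ℕ) (hq : 5 ≤ q) (K L : Type*) [Field K] [Field L]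
    [Algebra K L] [Fintype K] [Fintype L]
    (hK : Fintype.card K = q) (hL : Fintype.card L = q ^ 4) :
    (∃ f : Fin 11 → (L →ₗ[K] L),
      (∀ i, Module.finrank K (LinearMap.range (f i)) = 1) ∧
      ∀ g : L →ₗ[K] L, (∃ a b : L, ∀ x : L, g x = a * x + b * x ^ q) →
        g ∈ Submodule.span K (Set.range f)) ∧
    IsLeast {R : ℕ | ∃ f : Fin R → (L →ₗ[K] L),
      (∀ i, Module.finrank K (LinearMap.range (f i)) = 1) ∧
      ∀ g : L →ₗ[K] L, (∃ a b : L, ∀ x : L, g x = a * x + b * x ^ q) →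
        g ∈ Submodule.span K (Set.range f)} 11 := by
  classical
  have hdim : Module.finrank K L = 4 := by
    have := Module.card_eq_pow_finrank (K := K) (V := L)
    rw [hL, hK] at this
    exact (Nat.pow_right_injective (by omega : 2 ≤ q) this).symm
  let σ : L →ₐ[K] L := FiniteField.frobeniusAlgHom K L
  have hσ : ∀ x : L, σ x = x ^ q := fun x => by rw [← hK]; rfl
  have h4 : ∀ z, σ (σ (σ (σ z))) = z := fun z => by
    simp only [hσ, ← pow_mul]
    rw [show q * q * q * q = Fintype.card L by rw [hL]; ring, FiniteField.pow_card]
  have htr : ∀ z, algebraMap K L (Algebra.trace K L z) =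
      z + σ z + σ (σ z) + σ (σ (σ z)) := fun z => by
    rw [FiniteField.algebraMap_trace_eq_sum_pow, hdim, Nat.card_eq_fintype_card, hK]
    simp only [hσ, ← pow_mul, Finset.sum_range_succ, Finset.sum_range_zero]
    ring
  have hfix : ∀ z, σ z = z → ∃ k : K, algebraMap K L k = z := fun z hz => by
    rw [← Set.mem_range, ← IntermediateField.mem_bot, IsGalois.mem_bot_iff_fixed]
    intro g
    obtain ⟨n, rfl⟩ := (FiniteField.bijective_frobeniusAlgEquivOfAlgebraic_pow K L).2 g
    rw [AlgEquiv.coe_pow]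
    exact Function.iterate_fixed hz _
  obtain ⟨θ, hθ⟩ : ∃ θ : L, σ (σ θ) ≠ θ := by
    by_contra! h
    have hq2 : 1 < q ^ 2 := Nat.one_lt_pow two_ne_zero (by omega)
    have hle : (Finset.univ : Finset L).card ≤ (X ^ (q ^ 2) - X : L[X]).natDegree := by
      refine card_le_degree_of_subset_roots fun x _ => ?_
      rw [mem_roots (FiniteField.X_pow_card_sub_X_ne_zero L hq2)]
      have := h x
      rw [hσ, hσ, ← pow_mul, ← sq] at this
      simp [this]
    rw [FiniteField.X_pow_card_sub_X_natDegree_eq L hq2, Finset.card_univ, hL] at hle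
    exact absurd hle (not_le.2 (Nat.pow_lt_pow_right (by omega) (by norm_num)))
  obtain ⟨t, ht, ht0⟩ : ∃ t : Fin 5 → K, Function.Injective t ∧ t 0 = 0 := by
    obtain ⟨e⟩ := Function.Embedding.nonempty_of_card_le
      (show Fintype.card (Fin 5) ≤ Fintype.card K by simpa [hK] using hq)
    exact ⟨fun i => e i - e 0, fun i j h => e.injective (sub_left_injective h), sub_self _⟩
  have hex := exists_eleven_rankOne σ h4 htr hθ ht ht0
  simp only [hσ] at hex
  refine ⟨hex, hex, ?_⟩
  rintro R ⟨f, hf, hG⟩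
  refine eleven_le_of_span_rankOne σ hdim h4 hfix htr hθ f hf ?_
  simpa only [hσ] using hG
end

section
/- Let K be a finite field with q elements and let L be a field extension of K with q^4 elements. Then the tensor rank of the Gabidulin code G_{2,1} = {x ↦ a·x + b·x^q : a, b ∈ L} equals the tensor rank of the Gabidulin code G_{2,3} = {x ↦ a·x + b·x^{q^3} : a, b ∈ L}; that is, for every natural number R, there exist R rank-one K-linear maps of L whose K-span contains G_{2,1} if and only if there exist R rank-one K-linear maps of L whose K-span contains G_{2,3}. -/
/-- If precomposition with the linear equivalence `e` maps every element of `D` into `C`, then a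
family of rank-one maps whose span contains `C` yields one of the same size for `D`. -/
theorem exists_rankOne_span_of_comp {K L : Type*} [Field K] [AddCommGroup L] [Module K L]
    {ι : Type*} {C D : (L →ₗ[K] L) → Prop} (e : L ≃ₗ[K] L)
    (hCD : ∀ g, D g → C (g ∘ₗ e.toLinearMap))
    (h : ∃ f : ι → (L →ₗ[K] L), (∀ i, Module.finrank K (LinearMap.range (f i)) = 1) ∧
      ∀ g, C g → g ∈ Submodule.span K (Set.range f)) :
    ∃ f : ι → (L →ₗ[K] L), (∀ i, Module.finrank K (LinearMap.range (f i)) = 1) ∧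
      ∀ g, D g → g ∈ Submodule.span K (Set.range f) := by
  obtain ⟨f, hf, hspan⟩ := h
  refine ⟨fun i => f i ∘ₗ e.symm.toLinearMap, fun i => ?_, fun g hg => ?_⟩
  · rw [LinearMap.range_comp_of_range_eq_top _ (LinearEquiv.range e.symm)]
    exact hf i
  · have hmem := Submodule.mem_map_of_mem (f := LinearMap.lcomp K L e.symm.toLinearMap)
      (hspan _ (hCD g hg))
    have hcomp : LinearMap.lcomp K L e.symm.toLinearMap (g ∘ₗ e.toLinearMap) = g := by
      ext x
      simp
    rw [Submodule.map_span, ← Set.range_comp, hcomp] at hmem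
    exact hmem

/-- For `|K| = q` and `|L| = q^4`, the Gabidulin codes `G_{2,1} = {x ↦ a·x + b·x^q}`
and `G_{2,3} = {x ↦ a·x + b·x^(q^3)}` have the same tensor rank: for every `R`, there
are `R` rank-one maps whose span contains `G_{2,1}` iff there are `R` rank-one maps
whose span contains `G_{2,3}`. -/
theorem stmt_4 (q : ℕ) (K L : Type*) [Field K] [Field L] [Algebra K L]
    [Fintype K] [Fintype L]
    (hK : Fintype.card K = q) (hL : Fintype.card L = q ^ 4) :
    ∀ R : ℕ,
      (∃ f : Fin R → (L →ₗ[K] L),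
        (∀ i, Module.finrank K (LinearMap.range (f i)) = 1) ∧
        ∀ g : L →ₗ[K] L, (∃ a b : L, ∀ x : L, g x = a * x + b * x ^ q) →
          g ∈ Submodule.span K (Set.range f)) ↔
      (∃ f : Fin R → (L →ₗ[K] L),
        (∀ i, Module.finrank K (LinearMap.range (f i)) = 1) ∧
        ∀ g : L →ₗ[K] L, (∃ a b : L, ∀ x : L, g x = a * x + b * x ^ (q ^ 3)) →
          g ∈ Submodule.span K (Set.range f)) := by
  subst hK
  have hpow : ∀ x : L, x ^ (Fintype.card K ^ 4) = x := fun x => hL ▸ FiniteField.pow_card x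
  let φ : L ≃ₐ[K] L := FiniteField.frobeniusAlgEquivOfAlgebraic K L
  have hφ : ∀ x, φ x = x ^ Fintype.card K := fun x => rfl
  have hφ₃ : ∀ x, (φ ^ 3) x = x ^ (Fintype.card K ^ 3) := fun x => by
    simp only [pow_succ, pow_zero, one_mul, AlgEquiv.mul_apply, hφ, ← pow_mul]
  intro R
  constructor
  · refine exists_rankOne_span_of_comp φ.toLinearEquiv ?_
    rintro g ⟨a, b, hg⟩
    refine ⟨b, a, fun x => ?_⟩
    simp [hg, hφ, ← pow_mul, ← pow_succ', hpow, add_comm]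
  · refine exists_rankOne_span_of_comp (φ ^ 3).toLinearEquiv ?_
    rintro g ⟨a, b, hg⟩
    refine ⟨b, a, fun x => ?_⟩
    have h : (x ^ Fintype.card K ^ 3) ^ Fintype.card K = x := by
      rw [← pow_mul, ← pow_succ, hpow]
    change g ((φ ^ 3) x) = _
    rw [hg, hφ₃, h, add_comm]
end

section
/- Let K be a finite field with q elements, let L be a field extension of K with q^4 elements, and let Y, Z ∈ L. Then the following three equations hold simultaneously: (i) Y·Z^q − Y·Z^{q^2} + Y^q·Z^{q^2} − Y^q·Z^{q^3} − Y^{q^2}·Z + Y^{q^2}·Z^{q^3} + Y^{q^3}·Z − Y^{q^3}·Z^q = 0; (ii) Y^{q+1}·Z^{q^2+q} − Y^{q+1}·Z^{q^3+q^2} − Y^{q^2+1}·Z^{q^2+1} + Y^{q^2+1}·Z^{q^3+q} + Y^{q^3+1}·Z^{q+1} − Y^{q^3+1}·Z^{q^2+q} − Y^{q^2+q}·Z^{q^3+1} + Y^{q^2+q}·Z^{q^3+q^2} + Y^{q^3+q}·Z^{q^2+1} − Y^{q^3+q}·Z^{q^3+q} − Y^{q^3+q^2}·Z^{q+1} + Y^{q^3+q^2}·Z^{q^3+1}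 = 0; (iii) Y^{q^2+q+1}·Z^{q^3+q^2+1} − Y^{q^2+q+1}·Z^{q^3+q^2+q} − Y^{q^3+q+1}·Z^{q^2+q+1} + Y^{q^3+q+1}·Z^{q^3+q^2+q} + Y^{q^3+q^2+1}·Z^{q^2+q+1} − Y^{q^3+q^2+1}·Z^{q^3+q+1} + Y^{q^3+q^2+q}·Z^{q^3+q+1} − Y^{q^3+q^2+q}·Z^{q^3+q^2+1} = 0, if and only if one of the following holds: (C1) Y^q = Y or Z^q = Z; (C2) Y^{q^2} ≠ Y and there exists ρ ∈ L with ρ ≠ 0, ρ^q = ρ, and Z = ρ·Y^{q+1}; (C3) Z^{q^2} ≠ Z and there exists ρ ∈ L with ρ ≠ 0, ρ^q = ρ, and Y·Z^{q^2+q} = ρ. -/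
/-- Elimination for the system satisfied by the conjugates `yᵢ = Y ^ q ^ i`, `zᵢ = Z ^ q ^ i`. -/
theorem conj_system_elim {L : Type*} [Field L] {y₀ y₁ y₂ y₃ z₀ z₁ z₂ z₃ : L}
    (h₁ : y₀ * z₁ - y₀ * z₂ + y₁ * z₂ - y₁ * z₃ - y₂ * z₀ + y₂ * z₃ + y₃ * z₀ - y₃ * z₁ = 0)
    (h₂ : y₁ * y₀ * (z₂ * z₁) - y₁ * y₀ * (z₃ * z₂) - y₂ * y₀ * (z₂ * z₀)
      + y₂ * y₀ * (z₃ * z₁) + y₃ * y₀ * (z₁ * z₀) - y₃ * y₀ * (z₂ * z₁)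
      - y₂ * y₁ * (z₃ * z₀) + y₂ * y₁ * (z₃ * z₂) + y₃ * y₁ * (z₂ * z₀)
      - y₃ * y₁ * (z₃ * z₁) - y₃ * y₂ * (z₁ * z₀) + y₃ * y₂ * (z₃ * z₀) = 0)
    (h₃ : y₂ * y₁ * y₀ * (z₃ * z₂ * z₀) - y₂ * y₁ * y₀ * (z₃ * z₂ * z₁)
      - y₃ * y₁ * y₀ * (z₂ * z₁ * z₀) + y₃ * y₁ * y₀ * (z₃ * z₂ * z₁)
      + y₃ * y₂ * y₀ * (z₂ * z₁ * z₀) - y₃ * y₂ * y₀ * (z₃ * z₁ * z₀)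
      + y₃ * y₂ * y₁ * (z₃ * z₁ * z₀) - y₃ * y₂ * y₁ * (z₃ * z₂ * z₀) = 0)
    (hy : y₀ ≠ y₃) (hz : z₂ ≠ z₁) : z₁ * y₀ = z₀ * y₂ ∨ y₀ * z₁ = y₁ * z₃ := by
  have key : (z₂ - z₁) * (y₀ - y₃) * ((z₁ * y₀ - z₀ * y₂) * (y₀ * z₁ - y₁ * z₃)) = 0 := by
    linear_combination (-y₀ ^ 2 * z₁ ^ 2) * h₁ + (y₀ * z₁) * h₂ + h₃
  have hne := mul_ne_zero (sub_ne_zero.mpr hz) (sub_ne_zero.mpr hy)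
  simpa [sub_eq_zero] using (mul_eq_zero.mp key).resolve_left hne

/-- Characterization of the solutions `(Y, Z) ∈ L × L` of System (7) of the paper,
where `|K| = q` and `|L| = q^4`. -/
theorem stmt_5 (q : ℕ) (K L : Type*) [Field K] [Field L] [Algebra K L]
    [Fintype K] [Fintype L]
    (hK : Fintype.card K = q) (hL : Fintype.card L = q ^ 4) (Y Z : L) :
    (Y * Z ^ q - Y * Z ^ q ^ 2 + Y ^ q * Z ^ q ^ 2 - Y ^ q * Z ^ q ^ 3
        - Y ^ q ^ 2 * Z + Y ^ q ^ 2 * Z ^ q ^ 3 + Y ^ q ^ 3 * Z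
        - Y ^ q ^ 3 * Z ^ q = 0 ∧
      Y ^ (q + 1) * Z ^ (q ^ 2 + q) - Y ^ (q + 1) * Z ^ (q ^ 3 + q ^ 2)
        - Y ^ (q ^ 2 + 1) * Z ^ (q ^ 2 + 1) + Y ^ (q ^ 2 + 1) * Z ^ (q ^ 3 + q)
        + Y ^ (q ^ 3 + 1) * Z ^ (q + 1) - Y ^ (q ^ 3 + 1) * Z ^ (q ^ 2 + q)
        - Y ^ (q ^ 2 + q) * Z ^ (q ^ 3 + 1) + Y ^ (q ^ 2 + q) * Z ^ (q ^ 3 + q ^ 2)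
        + Y ^ (q ^ 3 + q) * Z ^ (q ^ 2 + 1) - Y ^ (q ^ 3 + q) * Z ^ (q ^ 3 + q)
        - Y ^ (q ^ 3 + q ^ 2) * Z ^ (q + 1)
        + Y ^ (q ^ 3 + q ^ 2) * Z ^ (q ^ 3 + 1) = 0 ∧
      Y ^ (q ^ 2 + q + 1) * Z ^ (q ^ 3 + q ^ 2 + 1)
        - Y ^ (q ^ 2 + q + 1) * Z ^ (q ^ 3 + q ^ 2 + q)
        - Y ^ (q ^ 3 + q + 1) * Z ^ (q ^ 2 + q + 1)
        + Y ^ (q ^ 3 + q + 1) * Z ^ (q ^ 3 + q ^ 2 + q)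
        + Y ^ (q ^ 3 + q ^ 2 + 1) * Z ^ (q ^ 2 + q + 1)
        - Y ^ (q ^ 3 + q ^ 2 + 1) * Z ^ (q ^ 3 + q + 1)
        + Y ^ (q ^ 3 + q ^ 2 + q) * Z ^ (q ^ 3 + q + 1)
        - Y ^ (q ^ 3 + q ^ 2 + q) * Z ^ (q ^ 3 + q ^ 2 + 1) = 0) ↔
    ((Y ^ q = Y ∨ Z ^ q = Z) ∨
      (Y ^ q ^ 2 ≠ Y ∧ ∃ ρ : L, ρ ≠ 0 ∧ ρ ^ q = ρ ∧ Z = ρ * Y ^ (q + 1)) ∨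
      (Z ^ q ^ 2 ≠ Z ∧ ∃ ρ : L, ρ ≠ 0 ∧ ρ ^ q = ρ ∧ Y * Z ^ (q ^ 2 + q) = ρ)) := by
  subst hK
  set q := Fintype.card K
  have hq : q ≠ 0 := Fintype.card_ne_zero
  have hY : (Y ^ q ^ 3) ^ q = Y := by rw [← pow_mul, ← pow_succ, ← hL, FiniteField.pow_card]
  have hZ : (Z ^ q ^ 3) ^ q = Z := by rw [← pow_mul, ← pow_succ, ← hL, FiniteField.pow_card]
  have hY₂ : (Y ^ q ^ 2) ^ q = Y ^ q ^ 3 := by rw [← pow_mul, ← pow_succ]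
  have hZ₂ : (Z ^ q ^ 2) ^ q = Z ^ q ^ 3 := by rw [← pow_mul, ← pow_succ]
  have hY₁ : (Y ^ q) ^ q = Y ^ q ^ 2 := by rw [← pow_mul, sq]
  have hZ₁ : (Z ^ q) ^ q = Z ^ q ^ 2 := by rw [← pow_mul, sq]
  simp only [pow_add, pow_one]
  generalize Y ^ q ^ 3 = y₃ at *
  generalize Z ^ q ^ 3 = z₃ at *
  generalize Y ^ q ^ 2 = y₂ at *
  generalize Z ^ q ^ 2 = z₂ at *
  generalize hY₀ : Y ^ q = y₁ at *
  generalize hZ₀ : Z ^ q = z₁ at *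
  constructor
  · rintro ⟨h₁, h₂, h₃⟩
    by_cases hyy : y₁ = Y
    · exact Or.inl (Or.inl hyy)
    by_cases hzz : z₁ = Z
    · exact Or.inl (Or.inr hzz)
    have hY_ne : Y ≠ 0 := by
      rintro rfl
      exact hyy (by rw [← hY₀, zero_pow hq])
    have hZ_ne : Z ≠ 0 := by
      rintro rfl
      exact hzz (by rw [← hZ₀, zero_pow hq])
    have hy₁_ne : y₁ ≠ 0 := hY₀ ▸ pow_ne_zero q hY_ne
    have hz₁_ne : z₁ ≠ 0 := hZ₀ ▸ pow_ne_zero q hZ_ne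
    have hy₂_ne : y₂ ≠ 0 := hY₁ ▸ pow_ne_zero q hy₁_ne
    have hz₂_ne : z₂ ≠ 0 := hZ₁ ▸ pow_ne_zero q hz₁_ne
    have hy₃ : Y ≠ y₃ := fun h ↦ hyy (by rw [← hY₀, h, hY, ← h])
    have hz₂ : z₂ ≠ z₁ := fun h ↦ hzz (by
      have h' : z₃ = z₂ := by rw [← hZ₂, h, hZ₁, h]
      rw [← hZ, h', hZ₂, h', h])
    rcases conj_system_elim h₁ h₂ h₃ hy₃ hz₂ with h | h
    · refine Or.inr (Or.inl ⟨?_, Z / (y₁ * Y), ?_, ?_, by field_simp⟩)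
      · rintro rfl
        exact hzz (mul_right_cancel₀ hY_ne h)
      · exact div_ne_zero hZ_ne (mul_ne_zero hy₁_ne hY_ne)
      · rw [div_pow, mul_pow, hY₁, hY₀, hZ₀, div_eq_div_iff (mul_ne_zero hy₂_ne hy₁_ne)
          (mul_ne_zero hy₁_ne hY_ne)]
        linear_combination y₁ * h
    · refine Or.inr (Or.inr ⟨?_, Y * (z₂ * z₁), ?_, ?_, rfl⟩)
      · rintro rfl
        have h' : z₃ = z₁ := by rw [← hZ₂, hZ₀]
        rw [h'] at h
        exact hyy (mul_right_cancel₀ hz₁_ne h).symm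
      · exact mul_ne_zero hY_ne (mul_ne_zero hz₂_ne hz₁_ne)
      · rw [mul_pow, mul_pow, hY₀, hZ₁, hZ₂]
        linear_combination -z₂ * h
  · rintro ((rfl | rfl) | ⟨-, ρ, -, hρ, h⟩ | ⟨-, ρ, hρ_ne, hρ, h⟩)
    · obtain rfl : y₁ = y₂ := hY₀.symm.trans hY₁
      obtain rfl : y₁ = y₃ := hY₀.symm.trans hY₂
      refine ⟨?_, ?_, ?_⟩ <;> ring
    · obtain rfl : z₁ = z₂ := hZ₀.symm.trans hZ₁
      obtain rfl : z₁ = z₃ := hZ₀.symm.trans hZ₂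
      refine ⟨?_, ?_, ?_⟩ <;> ring
    · have hz₁ : z₁ = ρ * (y₂ * y₁) := by rw [← hZ₀, h, mul_pow, mul_pow, hρ, hY₁, hY₀]
      have hz₂ : z₂ = ρ * (y₃ * y₂) := by rw [← hZ₁, hz₁, mul_pow, mul_pow, hρ, hY₂, hY₁]
      have hz₃ : z₃ = ρ * (Y * y₃) := by rw [← hZ₂, hz₂, mul_pow, mul_pow, hρ, hY, hY₂]
      rw [h, hz₁, hz₂, hz₃]
      refine ⟨?_, ?_, ?_⟩ <;> ring
    · have hy₁ : y₁ * (z₃ * z₂) = ρ := by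
        rw [← hρ, ← h, mul_pow, mul_pow, hY₀, hZ₁, hZ₂]
      have hy₂ : y₂ * (Z * z₃) = ρ := by
        rw [← hρ, ← hy₁, mul_pow, mul_pow, hY₁, hZ₂, hZ]
      have hy₃ : y₃ * (z₁ * Z) = ρ := by
        rw [← hρ, ← hy₂, mul_pow, mul_pow, hY₂, hZ, hZ₀]
      have hz₁_ne : z₁ ≠ 0 := by rintro rfl; simp [hρ_ne.symm] at h
      have hz₂_ne : z₂ ≠ 0 := by rintro rfl; simp [hρ_ne.symm] at h
      have hz₃_ne : z₃ ≠ 0 := by rintro rfl; simp [hρ_ne.symm] at hy₁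
      have hz₀_ne : Z ≠ 0 := by rintro rfl; simp [hρ_ne.symm] at hy₂
      rw [eq_div_of_mul_eq (mul_ne_zero hz₂_ne hz₁_ne) h,
        eq_div_of_mul_eq (mul_ne_zero hz₃_ne hz₂_ne) hy₁,
        eq_div_of_mul_eq (mul_ne_zero hz₀_ne hz₃_ne) hy₂,
        eq_div_of_mul_eq (mul_ne_zero hz₁_ne hz₀_ne) hy₃]
      refine ⟨?_, ?_, ?_⟩ <;> field_simp <;> ring
end

section
/- With the matrix M defined as in the context, if Y^q = Y or Z^q = Z, then the rank of M (as a matrix over L) equals 2. -/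
theorem FiniteField.mul_add_one_pow_card_pow (K : Type*) {L : Type*} [Field K] [Field L]
    [Algebra K L] [Fintype K] {l : L} (hl : l ^ Fintype.card K = l) (a : L) (i : ℕ) :
    (l * a + 1) ^ Fintype.card K ^ i = l * a ^ Fintype.card K ^ i + 1 := by
  induction i with
  | zero => simp
  | succ i ih =>
    have hadd (b : L) : (l * b + 1) ^ Fintype.card K = l * b ^ Fintype.card K + 1 := by
      have h := map_add (FiniteField.frobeniusAlgHom K L) (l * b) 1
      simpa [FiniteField.coe_frobeniusAlgHom, mul_pow, hl] using h
    rw [pow_succ, pow_mul, ih, hadd, pow_mul]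

/-- A matrix whose rows all lie in the span of two linearly independent rows has rank two. -/
theorem Matrix.rank_eq_two_of_rows {m n F : Type*} [Finite m] [Fintype n] [Field F]
    (M : Matrix m n F) (a b : m) (hab : LinearIndependent F ![M a, M b])
    (h : ∀ i, ∃ s t : F, s • M a + t • M b = M i) : M.rank = 2 := by
  have hspan : Submodule.span F (Set.range M.row) =
      Submodule.span F (Set.range ![M a, M b]) := by
    rw [Matrix.range_cons_cons_empty]
    apply le_antisymm
    · rw [Submodule.span_le]
      rintro _ ⟨i, rfl⟩
      exact Submodule.mem_span_pair.2 (h i)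
    · apply Submodule.span_mono
      rintro _ (rfl | rfl)
      exacts [⟨a, rfl⟩, ⟨b, rfl⟩]
  rw [Matrix.rank_eq_finrank_span_row, hspan, finrank_span_eq_card hab, Fintype.card_fin]


/-- Case (R1) of Theorem A.2 of the paper: if `Y ∈ F_q` or `Z ∈ F_q`, then the
`10×10` matrix `M` of the paper has rank `2`.  Here `|K| = q`, `|L| = q^4`,
`N l = l·Z^(q^2)·Y^q + 1` and `D l = l·Z^(q^2)·Y + 1`, and `lam 0, …, lam 7`
play the role of `λ_1, …, λ_8`. -/
theorem stmt_6 (q : ℕ) (K L : Type*) [Field K] [Field L] [Algebra K L]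
    [Fintype K] [Fintype L]
    (hK : Fintype.card K = q) (hL : Fintype.card L = q ^ 4)
    (Y Z : L) (lam : Fin 8 → L)
    (hinj : Function.Injective lam) (hne : ∀ j, lam j ≠ 0)
    (hfq : ∀ j, lam j ^ q = lam j)
    (N D : L → L)
    (hN : ∀ l : L, N l = l * Z ^ q ^ 2 * Y ^ q + 1)
    (hD : ∀ l : L, D l = l * Z ^ q ^ 2 * Y + 1)
    (hN0 : ∀ j, N (lam j) ≠ 0) (hD0 : ∀ j, D (lam j) ≠ 0)
    (M : Matrix (Fin 10) (Fin 10) L)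
    (hM0 : ∀ j : Fin 8, M 0 ⟨j.1, by omega⟩ = 1)
    (hM0' : M 0 8 = 0) (hM0'' : M 0 9 = 1)
    (hM1 : ∀ j : Fin 8, M 1 ⟨j.1, by omega⟩ = lam j)
    (hM1' : M 1 8 = 1) (hM1'' : M 1 9 = 0)
    (hMa : ∀ (i : Fin 4) (j : Fin 8), M ⟨2 + i.1, by omega⟩ ⟨j.1, by omega⟩ =
      (D (lam j) ^ (q ^ 2 + q + 1) / N (lam j) ^ (q + 1)) ^ q ^ i.1)
    (hMa' : ∀ i : Fin 4, M ⟨2 + i.1, by omega⟩ 8 = (Y * Z) ^ q ^ i.1)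
    (hMa'' : ∀ i : Fin 4, M ⟨2 + i.1, by omega⟩ 9 = 1)
    (hMb : ∀ (i : Fin 4) (j : Fin 8), M ⟨6 + i.1, by omega⟩ ⟨j.1, by omega⟩ =
      (D (lam j) ^ (q ^ 2 + q) / N (lam j) ^ q) ^ q ^ i.1)
    (hMb' : ∀ i : Fin 4, M ⟨6 + i.1, by omega⟩ 8 = (Y ^ q * Z) ^ q ^ i.1)
    (hMb'' : ∀ i : Fin 4, M ⟨6 + i.1, by omega⟩ 9 = 1)
    (h : Y ^ q = Y ∨ Z ^ q = Z) :
    M.rank = 2 := by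
  subst hK
  set q := Fintype.card K
  have hZ4 : Z ^ q ^ 4 = Z := by rw [← hL]; exact FiniteField.pow_card Z
  have hlin (j : Fin 8) (a : L) (i : ℕ) :
      (lam j * a + 1) ^ q ^ i = lam j * a ^ q ^ i + 1 :=
    FiniteField.mul_add_one_pow_card_pow K (hfq j) a i
  have hDN (j : Fin 8) :
      D (lam j) ^ (q ^ 2 + q + 1) / N (lam j) ^ (q + 1) = lam j * (Y * Z) + 1 ∧
      D (lam j) ^ (q ^ 2 + q) / N (lam j) ^ q = lam j * (Y ^ q * Z) + 1 := by
    have hD' : D (lam j) = lam j * (Z ^ q ^ 2 * Y) + 1 := by rw [hD, mul_assoc]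
    have hN' : N (lam j) = lam j * (Z ^ q ^ 2 * Y ^ q) + 1 := by rw [hN, mul_assoc]
    have hD0 := hD0 j
    rcases h with hY | hZ
    · have hND : N (lam j) = D (lam j) := by rw [hN', hD', hY]
      have hY2 : Y ^ q ^ 2 = Y := by rw [pow_two, pow_mul, hY, hY]
      have hD2 : D (lam j) ^ q ^ 2 = lam j * (Y * Z) + 1 := by
        rw [hD', hlin, mul_pow, hY2, ← pow_mul, ← pow_add, hZ4, mul_comm Z]
      rw [hND, hY, ← hD2, add_assoc, pow_add, pow_add _ _ q]
      constructor <;> field_simp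
    · have hZ2 : Z ^ q ^ 2 = Z := by rw [pow_two, pow_mul, hZ, hZ]
      have hND : N (lam j) = D (lam j) ^ q := by
        have h1 := hlin j (Z * Y) 1
        rw [pow_one, mul_pow, hZ] at h1
        rw [hN', hD', hZ2, h1]
      have hDq : D (lam j) ^ q = lam j * (Y ^ q * Z) + 1 := by
        rw [← hND, hN', hZ2, mul_comm Z]
      have hNq : N (lam j) ^ q = D (lam j) ^ q ^ 2 := by rw [hND, ← pow_mul, ← pow_two]
      have hDZ : D (lam j) = lam j * (Y * Z) + 1 := by rw [hD', hZ2, mul_comm Z]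
      rw [pow_succ (N _), hNq, hND, ← hDq, ← hDZ, pow_succ, pow_add]
      constructor <;> field_simp
  have hrow (c : L) (r : Fin 10) (i : ℕ)
      (h1 : ∀ j : Fin 8, M r ⟨j.1, by omega⟩ = (lam j * c + 1) ^ q ^ i)
      (h2 : M r 8 = c ^ q ^ i) (h3 : M r 9 = 1) :
      (1 : L) • M 0 + c ^ q ^ i • M 1 = M r := by
    ext k
    rcases lt_or_ge k.1 8 with hk | hk
    · have e0 := hM0 ⟨k, hk⟩
      have e1 := hM1 ⟨k, hk⟩
      have e2 := h1 ⟨k, hk⟩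
      rw [hlin] at e2
      simp only [Fin.eta] at e0 e1 e2
      simp only [Pi.add_apply, Pi.smul_apply, smul_eq_mul, e0, e1, e2]
      ring
    · obtain rfl | rfl : k = 8 ∨ k = 9 := by omega
      · simp [hM0', hM1', h2]
      · simp [hM0'', hM1'', h3]
  refine Matrix.rank_eq_two_of_rows M 0 1 ?_ fun r => ?_
  · refine LinearIndependent.pair_iff.2 fun s t hst => ⟨?_, ?_⟩
    · simpa [hM0'', hM1''] using congrFun hst 9
    · simpa [hM0', hM1'] using congrFun hst 8
  · obtain rfl | rfl | ⟨i, rfl⟩ | ⟨i, rfl⟩ : r = 0 ∨ r = 1 ∨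
        (∃ i : Fin 4, r = ⟨2 + i.1, by omega⟩) ∨ ∃ i : Fin 4, r = ⟨6 + i.1, by omega⟩ := by
      rcases lt_or_ge r.1 2 with h2 | h2
      · omega
      rcases lt_or_ge r.1 6 with h6 | h6
      · exact .inr (.inr (.inl ⟨⟨r.1 - 2, by omega⟩, Fin.ext (by simp only; omega)⟩))
      · exact .inr (.inr (.inr ⟨⟨r.1 - 6, by omega⟩, Fin.ext (by simp only; omega)⟩))
    · exact ⟨1, 0, by simp⟩
    · exact ⟨0, 1, by simp⟩
    · exact ⟨_, _, hrow (Y * Z) _ i (fun j => by rw [hMa, (hDN j).1]) (hMa' i) (hMa'' i)⟩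
    · exact ⟨_, _, hrow (Y ^ q * Z) _ i (fun j => by rw [hMb, (hDN j).2]) (hMb' i) (hMb'' i)⟩
end

section
/- With the matrix M defined as in the context, if Y^{q^2} ≠ Y and Z = ρ·Y^{q+1} for some ρ ∈ L with ρ ≠ 0 and ρ^q = ρ, then the rank of M (as a matrix over L) equals 6. -/
open Polynomial in
/-- A combination of `1`, `x` and the four functions `F (i+2) * F (i+3) / F i`, where
`F k = x * e k + 1`, which vanishes at eight points is trivial. -/
theorem coeffs_eq_zero_of_vanishing {L : Type*} [Field L] (e : Fin 4 → L)
    (he : Function.Injective e) (he0 : ∀ i, e i ≠ 0) (x : Fin 8 → L)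
    (hx : Function.Injective x) (hF : ∀ i j, x j * e i + 1 ≠ 0) (α β : L) (γ : Fin 4 → L)
    (h : ∀ j, α + β * x j + ∑ i, γ i *
      ((x j * e (i + 2) + 1) * (x j * e (i + 3) + 1) / (x j * e i + 1)) = 0) :
    α = 0 ∧ β = 0 ∧ ∀ i, γ i = 0 := by
  let F : Fin 4 → L[X] := fun i => X * C (e i) + 1
  have evalF (i : Fin 4) (t : L) : (F i).eval t = t * e i + 1 := by
    simp only [F, eval_add, eval_mul, eval_X, eval_C, eval_one]
  have degF (i : Fin 4) : (F i).natDegree ≤ 1 := by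
    simp only [F]; compute_degree
  let G : Fin 4 → L[X] := fun i =>
    C (γ i) * (F (i + 2) * F (i + 3) * ∏ k ∈ Finset.univ.erase i, F k)
  let P : L[X] := (C α + C β * X) * ∏ k, F k + ∑ i, G i
  have hP : P = 0 := by
    refine eq_zero_of_natDegree_lt_card_of_eval_eq_zero P hx (fun j => ?_) ?_
    · have hG (i : Fin 4) : (G i).eval (x j) = γ i *
          ((x j * e (i + 2) + 1) * (x j * e (i + 3) + 1) / (x j * e i + 1)) *
          ∏ k, (x j * e k + 1) := by
        rw [← Finset.mul_prod_erase _ _ (Finset.mem_univ i)]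
        simp only [G, eval_mul, eval_C, eval_prod, evalF]
        field_simp [hF i j]
      have hlin : ((C α + C β * X) * ∏ k, F k).eval (x j) =
          (α + β * x j) * ∏ k, (x j * e k + 1) := by
        simp [eval_prod, evalF]
      simp only [P, eval_add, hlin, eval_finsetSum, hG]
      rw [← Finset.sum_mul, ← add_mul, h j, zero_mul]
    · have hprod (s : Finset (Fin 4)) : (∏ k ∈ s, F k).natDegree ≤ s.card := by
        refine (natDegree_prod_le _ _).trans ?_
        simpa using Finset.sum_le_card_nsmul s _ 1 (fun i _ => degF i)
      have hlin : (C α + C β * X).natDegree ≤ 1 := by compute_degree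
      have hG (i : Fin 4) : (G i).natDegree ≤ 5 := by
        refine (natDegree_C_mul_le _ _).trans ?_
        refine (natDegree_mul_le_of_le (natDegree_mul_le_of_le (degF _) (degF _))
          (hprod _)).trans ?_
        simp
      have hdeg : P.natDegree ≤ 5 :=
        natDegree_add_le_of_degree_le
          ((natDegree_mul_le_of_le hlin (hprod _)).trans (by simp))
          (natDegree_sum_le_of_forall_le _ _ (fun i _ => hG i))
      simpa using hdeg.trans_lt (by norm_num : 5 < 8)
  have hγ (i : Fin 4) : γ i = 0 := by
    have hroot : (F i).eval (-(e i)⁻¹) = 0 := by simp [evalF, he0 i]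
    have hne (k : Fin 4) (hk : k ≠ i) : (F k).eval (-(e i)⁻¹) ≠ 0 := by
      rw [evalF]
      intro h0
      have h1 := he0 i
      field_simp at h0
      exact hk (he (by linear_combination -h0))
    have h0 : P.eval (-(e i)⁻¹) = 0 := by simp [hP]
    have hz : ((C α + C β * X) * ∏ k, F k).eval (-(e i)⁻¹) = 0 := by
      rw [eval_mul, eval_prod, Finset.prod_eq_zero (Finset.mem_univ i) hroot, mul_zero]
    have hsum : (∑ k, G k).eval (-(e i)⁻¹) = (G i).eval (-(e i)⁻¹) := by
      rw [eval_finsetSum]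
      refine Finset.sum_eq_single i (fun k _ hk => ?_) (by simp)
      have hmem : i ∈ Finset.univ.erase k := by simpa using hk.symm
      simp only [G, eval_mul, eval_prod]
      rw [Finset.prod_eq_zero hmem hroot]
      simp
    have hi2 : i + 2 ≠ i := by omega
    have hi3 : i + 3 ≠ i := by omega
    rw [show P = (C α + C β * X) * ∏ k, F k + ∑ i, G i from rfl, eval_add, hz, hsum,
      zero_add] at h0
    simp only [G, eval_mul, eval_C, eval_prod] at h0
    refine (mul_eq_zero.1 h0).resolve_right (mul_ne_zero (mul_ne_zero (hne _ hi2) (hne _ hi3)) ?_)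
    exact Finset.prod_ne_zero_iff.2 (fun k hk => hne k (Finset.ne_of_mem_erase hk))
  have hprod0 : ∏ k, F k ≠ 0 := by
    intro h0
    have := congrArg (eval 0) h0
    simp [eval_prod, evalF] at this
  have hlin : C α + C β * X = 0 := by
    have : (C α + C β * X) * ∏ k, F k = 0 := by
      simpa [P, G, hγ] using hP
    exact (mul_eq_zero.1 this).resolve_right hprod0
  have h0 := congrArg (fun p => coeff p 0) hlin
  have h1 := congrArg (fun p => coeff p 1) hlin
  simp only [coeff_add, coeff_C_zero, coeff_C_succ, coeff_C_mul, coeff_X_zero, coeff_X_one,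
    coeff_zero, mul_zero, mul_one, add_zero, zero_add] at h0 h1
  exact ⟨h0, h1, hγ⟩

/-- Two quadratics over the same linear denominator differ, after rescaling, by an affine
function. -/
theorem div_eq_mul_div_add_affine {L : Type*} [Field L] {e a b a' b' t : L} (he : e ≠ 0)
    (ha : e ≠ a) (hb : e ≠ b) (ht : t * e + 1 ≠ 0) :
    (t * a' + 1) * (t * b' + 1) / (t * e + 1) =
      (e - a') * (e - b') / ((e - a) * (e - b)) *
          ((t * a + 1) * (t * b + 1) / (t * e + 1)) +
        (1 - (e - a') * (e - b') / ((e - a) * (e - b))) +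
        (a' * b' / e - (e - a') * (e - b') / ((e - a) * (e - b)) * (a * b / e)) * t := by
  have h1 := sub_ne_zero.2 ha
  have h2 := sub_ne_zero.2 hb
  field_simp
  ring

theorem fin_ten_cases {P : Fin 10 → Prop} (h : ∀ j : Fin 8, P ⟨j.1, by omega⟩) (h8 : P 8)
    (h9 : P 9) (k : Fin 10) : P k := by
  by_cases hk : k.1 < 8
  · exact h ⟨k.1, hk⟩
  · obtain rfl | rfl : k = 8 ∨ k = 9 := by omega
    · exact h8
    · exact h9

/-- The rank of the matrix whose rows are `1`, `x`, `F (i+2) * F (i+3) / F i` and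
`F (i+2) * F (i+3) / F (i+1)`, evaluated at eight points, at infinity and at zero. -/
theorem rank_eq_six_of_rows {L : Type*} [Field L] (e : Fin 4 → L)
    (he : Function.Injective e) (he0 : ∀ i, e i ≠ 0) (x : Fin 8 → L)
    (hx : Function.Injective x) (hF : ∀ i j, x j * e i + 1 ≠ 0)
    (M : Matrix (Fin 10) (Fin 10) L)
    (hM0 : ∀ j : Fin 8, M 0 ⟨j.1, by omega⟩ = 1)
    (hM0' : M 0 8 = 0) (hM0'' : M 0 9 = 1)
    (hM1 : ∀ j : Fin 8, M 1 ⟨j.1, by omega⟩ = x j)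
    (hM1' : M 1 8 = 1) (hM1'' : M 1 9 = 0)
    (hMa : ∀ (i : Fin 4) (j : Fin 8), M ⟨2 + i.1, by omega⟩ ⟨j.1, by omega⟩ =
      (x j * e (i + 2) + 1) * (x j * e (i + 3) + 1) / (x j * e i + 1))
    (hMa' : ∀ i : Fin 4, M ⟨2 + i.1, by omega⟩ 8 = e (i + 2) * e (i + 3) / e i)
    (hMa'' : ∀ i : Fin 4, M ⟨2 + i.1, by omega⟩ 9 = 1)
    (hMb : ∀ (i : Fin 4) (j : Fin 8), M ⟨6 + i.1, by omega⟩ ⟨j.1, by omega⟩ =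
      (x j * e (i + 2) + 1) * (x j * e (i + 3) + 1) / (x j * e (i + 1) + 1))
    (hMb' : ∀ i : Fin 4, M ⟨6 + i.1, by omega⟩ 8 = e (i + 2) * e (i + 3) / e (i + 1))
    (hMb'' : ∀ i : Fin 4, M ⟨6 + i.1, by omega⟩ 9 = 1) :
    M.rank = 6 := by
  let v : Fin 6 → Fin 10 → L := fun r => M ⟨r.1, by omega⟩
  have hv : LinearIndependent L v := by
    rw [Fintype.linearIndependent_iff]
    intro g hg
    obtain ⟨h0, h1, h2⟩ := coeffs_eq_zero_of_vanishing e he he0 x hx hF (g 0) (g 1)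
      (fun i => g ⟨2 + i.1, by omega⟩) (fun j => by
        have h := congrFun hg ⟨j.1, by omega⟩
        rw [Finset.sum_apply, Fin.sum_univ_succ, Fin.sum_univ_succ] at h
        rw [← add_assoc] at h
        simp only [Pi.smul_apply, smul_eq_mul, Pi.zero_apply] at h
        rw [← h]
        congr 1
        · congr 1
          · rw [show v 0 = M 0 from rfl, hM0, mul_one]
          · rw [show v (Fin.succ 0) = M 1 from rfl, hM1]; rfl
        · refine Finset.sum_congr rfl fun i _ => ?_
          have hi : i.succ.succ = (⟨2 + i.1, by omega⟩ : Fin 6) :=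
            Fin.ext (by simp only [Fin.val_succ]; omega)
          rw [hi, ← hMa])
    intro r
    by_cases hr : r.1 < 2
    · obtain rfl | rfl : r = 0 ∨ r = 1 := by omega
      · exact h0
      · exact h1
    · have := h2 ⟨r.1 - 2, by omega⟩
      convert this using 2
      exact Fin.ext (by simp only; omega)
  have hspan : Submodule.span L (Set.range M.row) = Submodule.span L (Set.range v) := by
    apply le_antisymm
    · rw [Submodule.span_le]
      rintro _ ⟨r, rfl⟩
      have hmem (s : Fin 10) (hs : s.1 < 6) : M s ∈ Submodule.span L (Set.range v) :=
        Submodule.subset_span ⟨⟨s.1, hs⟩, rfl⟩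
      by_cases hr : r.1 < 6
      · exact hmem r hr
      · obtain ⟨i, rfl⟩ : ∃ i : Fin 4, r = ⟨6 + i.1, Nat.add_lt_add_left i.2 6⟩ :=
          ⟨⟨r.1 - 6, by omega⟩, Fin.ext (by simp only; omega)⟩
        obtain ⟨κ, hκ⟩ : ∃ κ, κ = (e (i + 1) - e (i + 2)) * (e (i + 1) - e (i + 3)) /
          ((e (i + 1) - e (i + 1 + 2)) * (e (i + 1) - e (i + 1 + 3))) := ⟨_, rfl⟩
        have hrow : M ⟨6 + i.1, by omega⟩ = κ • M ⟨2 + (i + 1).1, by omega⟩ + (1 - κ) • M 0 +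
            (e (i + 2) * e (i + 3) / e (i + 1) -
              κ * (e (i + 1 + 2) * e (i + 1 + 3) / e (i + 1))) • M 1 := by
          funext k
          refine fin_ten_cases (P := fun k => M _ k = (_ : Fin 10 → L) k) (fun j => ?_) ?_ ?_ k
          · simp only [Pi.add_apply, Pi.smul_apply, smul_eq_mul]
            rw [hMb, hMa, hM0, hM1, mul_one, hκ]
            refine div_eq_mul_div_add_affine (he0 _) (he.ne ?_) (he.ne ?_) (hF _ _)
            · omega
            · omega
          · simp only [Pi.add_apply, Pi.smul_apply, smul_eq_mul]
            rw [hMb', hMa', hM0', hM1']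
            ring
          · simp only [Pi.add_apply, Pi.smul_apply, smul_eq_mul]
            rw [hMb'', hMa'', hM0'', hM1'']
            ring
        change M _ ∈ _
        rw [hrow]
        exact add_mem (add_mem (Submodule.smul_mem _ _ (hmem _ (by simp only; omega)))
          (Submodule.smul_mem _ _ (hmem 0 (by decide))))
          (Submodule.smul_mem _ _ (hmem 1 (by decide)))
    · refine Submodule.span_mono ?_
      rintro _ ⟨r, rfl⟩
      exact ⟨_, rfl⟩
  rw [Matrix.rank_eq_finrank_span_row, hspan, finrank_span_eq_card hv, Fintype.card_fin]

theorem apply_add_eq_pow {L : Type*} [Monoid L] {q : ℕ} {G : Fin 4 → L}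
    (h : ∀ k, G (k + 1) = G k ^ q) (k i : Fin 4) : G (k + i) = G k ^ q ^ i.1 := by
  have h2 : G (k + 2) = G k ^ q ^ 2 := by
    rw [show k + 2 = k + 1 + 1 by omega, h, h, ← pow_mul, sq]
  have h3 : G (k + 3) = G k ^ q ^ 3 := by
    rw [show k + 3 = k + 2 + 1 by omega, h, h2, ← pow_mul, ← pow_succ]
  fin_cases i
  · simp
  · simpa using h k
  · exact h2
  · exact h3


/-- Case (R2): if `Y ∉ F_{q^2}` and `Z = ρ·Y^(q+1)` with `ρ ∈ F_q^*`, then `rank M = 6`.  Here `|K| = q`, `|L| = q^4`,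
`N l = l·Z^(q^2)·Y^q + 1` and `D l = l·Z^(q^2)·Y + 1`, and `lam 0, …, lam 7`
play the role of `λ_1, …, λ_8` in the `10×10` matrix `M` of the paper. -/
theorem stmt_7 (q : ℕ) (K L : Type*) [Field K] [Field L] [Algebra K L]
    [Fintype K] [Fintype L]
    (hK : Fintype.card K = q) (hL : Fintype.card L = q ^ 4)
    (Y Z : L) (lam : Fin 8 → L)
    (hinj : Function.Injective lam) (hne : ∀ j, lam j ≠ 0)
    (hfq : ∀ j, lam j ^ q = lam j)
    (N D : L → L)
    (hN : ∀ l : L, N l = l * Z ^ q ^ 2 * Y ^ q + 1)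
    (hD : ∀ l : L, D l = l * Z ^ q ^ 2 * Y + 1)
    (hN0 : ∀ j, N (lam j) ≠ 0) (hD0 : ∀ j, D (lam j) ≠ 0)
    (M : Matrix (Fin 10) (Fin 10) L)
    (hM0 : ∀ j : Fin 8, M 0 ⟨j.1, by omega⟩ = 1)
    (hM0' : M 0 8 = 0) (hM0'' : M 0 9 = 1)
    (hM1 : ∀ j : Fin 8, M 1 ⟨j.1, by omega⟩ = lam j)
    (hM1' : M 1 8 = 1) (hM1'' : M 1 9 = 0)
    (hMa : ∀ (i : Fin 4) (j : Fin 8), M ⟨2 + i.1, by omega⟩ ⟨j.1, by omega⟩ =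
      (D (lam j) ^ (q ^ 2 + q + 1) / N (lam j) ^ (q + 1)) ^ q ^ i.1)
    (hMa' : ∀ i : Fin 4, M ⟨2 + i.1, by omega⟩ 8 = (Y * Z) ^ q ^ i.1)
    (hMa'' : ∀ i : Fin 4, M ⟨2 + i.1, by omega⟩ 9 = 1)
    (hMb : ∀ (i : Fin 4) (j : Fin 8), M ⟨6 + i.1, by omega⟩ ⟨j.1, by omega⟩ =
      (D (lam j) ^ (q ^ 2 + q) / N (lam j) ^ q) ^ q ^ i.1)
    (hMb' : ∀ i : Fin 4, M ⟨6 + i.1, by omega⟩ 8 = (Y ^ q * Z) ^ q ^ i.1)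
    (hMb'' : ∀ i : Fin 4, M ⟨6 + i.1, by omega⟩ 9 = 1)
    (h1 : Y ^ q ^ 2 ≠ Y) (h2 : ∃ ρ : L, ρ ≠ 0 ∧ ρ ^ q = ρ ∧ Z = ρ * Y ^ (q + 1)) :
    M.rank = 6 := by
  obtain ⟨ρ, hρ0, hρ, rfl⟩ := h2
  have hadd (a b : L) : (a + b) ^ q = a ^ q + b ^ q := by
    have := map_add (FiniteField.frobeniusAlgHom K L) a b
    simpa [FiniteField.coe_frobeniusAlgHom, hK, Fintype.card_eq_nat_card] using this
  have hq0 : q ≠ 0 := hK ▸ Fintype.card_ne_zero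
  have hY0 : Y ≠ 0 := by
    rintro rfl
    exact h1 (zero_pow (pow_ne_zero _ hq0))
  let y : Fin 4 → L := fun i => Y ^ q ^ i.1
  have hy (k : Fin 4) : y (k + 1) = y k ^ q := by
    have h4 : Y ^ q ^ 4 = Y := by rw [← hL, FiniteField.pow_card]
    fin_cases k
    · simp [y]
    · simp [y, ← pow_mul, sq]
    · simp [y, ← pow_mul, ← pow_succ]
    · simp [y, ← pow_mul, ← pow_succ, h4]
  have hy0 (k : Fin 4) : y k ≠ 0 := pow_ne_zero _ hY0
  have hyinj : Function.Injective y := by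
    intro i j hij
    have H (k : Fin 4) : y (i + k) = y (j + k) := by
      rw [apply_add_eq_pow hy, apply_add_eq_pow hy, hij]
    have h02 : y 0 ≠ y 2 := fun h => h1 (by simpa [y] using h.symm)
    have H0 := H 0
    have H1 := H 1
    have H2 := H 2
    have H3 := H 3
    clear H hij
    fin_cases i <;> fin_cases j <;> simp at H0 H1 H2 H3 ⊢ <;> grind
  let e : Fin 4 → L := fun i => ρ * (y (i + 1) * y (i + 2) * y (i + 3))
  have he (k : Fin 4) : e (k + 1) = e k ^ q := by
    simp only [e, mul_pow, hρ, ← hy]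
    rw [show k + 1 + 2 = k + 2 + 1 by omega, show k + 1 + 3 = k + 3 + 1 by omega]
  have he0 (k : Fin 4) : e k ≠ 0 :=
    mul_ne_zero hρ0 (mul_ne_zero (mul_ne_zero (hy0 _) (hy0 _)) (hy0 _))
  have hmul (k : Fin 4) : e k * y k = ρ * (y 0 * y 1 * y 2 * y 3) := by
    fin_cases k <;> simp [e] <;> ring
  have heinj : Function.Injective e := by
    intro i j hij
    apply hyinj
    have := (hmul i).trans (hmul j).symm
    rw [hij] at this
    exact mul_left_cancel₀ (he0 j) this
  have hF (j : Fin 8) (k : Fin 4) :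
      lam j * e (k + 1) + 1 = (lam j * e k + 1) ^ q := by
    rw [hadd, mul_pow, hfq, he, one_pow]
  have hZ : (ρ * Y ^ (q + 1)) ^ q ^ 2 = ρ * (y 2 * y 3) := by
    have hρ2 : ρ ^ q ^ 2 = ρ := by rw [sq, pow_mul, hρ, hρ]
    simp only [y, mul_pow, hρ2, ← pow_mul, ← pow_add]
    congr 2
    simp
    ring
  have hNe (j : Fin 8) : N (lam j) = lam j * e 0 + 1 := by
    rw [hN, hZ]
    simp [e, y]
    ring
  have hDe (j : Fin 8) : D (lam j) = lam j * e 1 + 1 := by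
    rw [hD, hZ]
    simp [e, y]
    ring
  have hF0 (i : Fin 4) (j : Fin 8) : lam j * e i + 1 ≠ 0 := by
    have h := apply_add_eq_pow (G := fun k => lam j * e k + 1) (hF j) 0 i
    simp only [zero_add] at h
    rw [h, ← hNe]
    exact pow_ne_zero _ (hN0 j)
  have hFrob (j : Fin 8) (k i : Fin 4) :
      (lam j * e k + 1) ^ q ^ i.1 = lam j * e (i + k) + 1 := by
    rw [add_comm i k]
    exact (apply_add_eq_pow (G := fun k => lam j * e k + 1) (hF j) k i).symm
  have hFrobe (k i : Fin 4) : e k ^ q ^ i.1 = e (i + k) := by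
    rw [add_comm i k]
    exact (apply_add_eq_pow he k i).symm
  have hDq (j : Fin 8) : D (lam j) ^ q = lam j * e 2 + 1 := by
    rw [hDe]; exact (hF j 1).symm
  have hDq2 (j : Fin 8) : D (lam j) ^ q ^ 2 = lam j * e 3 + 1 := by
    rw [sq, pow_mul, hDq]; exact (hF j 2).symm
  have hNq (j : Fin 8) : N (lam j) ^ q = lam j * e 1 + 1 := by
    rw [hNe]; exact (hF j 0).symm
  have ha (j : Fin 8) : D (lam j) ^ (q ^ 2 + q + 1) / N (lam j) ^ (q + 1) =
      (lam j * e 2 + 1) * (lam j * e 3 + 1) / (lam j * e 0 + 1) := by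
    rw [pow_succ, pow_add, pow_succ (N _), hDq, hDq2, hNq, hDe, hNe]
    have h0 := hF0 0 j
    have h1 := hF0 1 j
    field_simp
  have hb (j : Fin 8) : D (lam j) ^ (q ^ 2 + q) / N (lam j) ^ q =
      (lam j * e 2 + 1) * (lam j * e 3 + 1) / (lam j * e 1 + 1) := by
    rw [pow_add, hDq, hDq2, hNq, mul_comm]
  have hYa : Y * (ρ * Y ^ (q + 1)) = e 2 * e 3 / e 0 := by
    rw [eq_div_iff (he0 0)]
    simp [e, y]
    ring
  have hYb : Y ^ q * (ρ * Y ^ (q + 1)) = e 2 * e 3 / e 1 := by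
    rw [eq_div_iff (he0 1)]
    simp [e, y]
    ring
  refine rank_eq_six_of_rows e heinj he0 lam hinj hF0 M hM0 hM0' hM0'' hM1 hM1' hM1''
    (fun i j => ?_) (fun i => ?_) hMa'' (fun i j => ?_) (fun i => ?_) hMb''
  · rw [hMa, ha, div_pow, mul_pow, hFrob, hFrob, hFrob, add_zero]
  · rw [hMa', hYa, div_pow, mul_pow, hFrobe, hFrobe, hFrobe, add_zero]
  · rw [hMb, hb, div_pow, mul_pow, hFrob, hFrob, hFrob]
  · rw [hMb', hYb, div_pow, mul_pow, hFrobe, hFrobe, hFrobe]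
end
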